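/- Fix B ≥ 1 and c ∈ {6, 7}. There exist constants c2 > 0 and C > 0 such that for every sufficiently large integer n and every pair of integers a, q with 0 ≤ a ≤ q, gcd(a,q) = 1 and 1 ≤ q ≤ L^B, one has |f_{5,c}(a/q) − (S_5(q,a)/φ(q)) · P_5^{θ_c}| ≤ C · P_5^{θ_c} · exp(−c2 · √L). -/

import Mathlib

open MeasureTheory Finset

noncomputable section

/-- `e(x) = exp(2πix)`. -/
def e (x : ℝ) : ℂ := Complex.exp (2 * Real.pi * Complex.I * x)

/-- `P_k = n^(1/k)`. -/
def P (n k : ℕ) : ℝ := (n : ℝ) ^ ((k : ℝ))⁻¹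

/-- `θ_6 = 5/6`, `θ_7 = 87/98`. -/
def θ (c : ℕ) : ℝ := if c = 6 then 5 / 6 else 87 / 98

/-- `Θ_c = 2/3 + θ_c/5 + 1/6 + 1/c`. -/
def Θ (c : ℕ) : ℝ := 2 / 3 + θ c / 5 + 1 / 6 + ((c : ℝ))⁻¹

/-- `f_k(α) = Σ_{P_k/2 < p ≤ P_k, p prime} e(α p^k) log p`. -/
def f (n k : ℕ) (α : ℝ) : ℂ :=
  ∑ p ∈ (Finset.range (n + 1)).filter
      (fun p : ℕ => p.Prime ∧ P n k / 2 < (p : ℝ) ∧ (p : ℝ) ≤ P n k),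
    e (α * (p : ℝ) ^ k) * (Real.log p)

/-- `f_{5,c}(α) = Σ_{1 < p ≤ P_5^{θ_c}, p prime} e(α p^5) log p`. -/
def f5 (n c : ℕ) (α : ℝ) : ℂ :=
  ∑ p ∈ (Finset.range (n + 1)).filter
      (fun p : ℕ => p.Prime ∧ 1 < (p : ℝ) ∧ (p : ℝ) ≤ P n 5 ^ θ c),
    e (α * (p : ℝ) ^ 5) * (Real.log p)

/-- `F_c(α) = f_2(α)^2 f_3(α)^2 f_{5,c}(α) f_6(α) f_c(α)`. -/
def F (n c : ℕ) (α : ℝ) : ℂ :=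
  f n 2 α ^ 2 * f n 3 α ^ 2 * f5 n c α * f n 6 α * f n c α

/-- `S_k(q,a) = Σ_{x=1,(x,q)=1}^{q} e(a x^k / q)`. -/
def S (k q a : ℕ) : ℂ :=
  ∑ x ∈ (Finset.Icc 1 q).filter (fun x => Nat.gcd x q = 1),
    e ((a : ℝ) * (x : ℝ) ^ k / q)

/-- `v_k(β) = (1/k) Σ_{2^{-k} n < m ≤ n} m^{1/k-1} e(β m)`. -/
def v (n k : ℕ) (β : ℝ) : ℂ :=
  ((k : ℂ))⁻¹ *
    ∑ m ∈ (Finset.Icc 1 n).filter (fun m : ℕ => (n : ℝ) / 2 ^ k < (m : ℝ)),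
      ((m : ℝ) ^ ((k : ℝ)⁻¹ - 1) : ℝ) * e (β * m)

/-- `w_c(β) = v_2(β)^2 v_3(β)^2 v_6(β) v_c(β)`. -/
def w (n c : ℕ) (β : ℝ) : ℂ := v n 2 β ^ 2 * v n 3 β ^ 2 * v n 6 β * v n c β

/-- `U_c(q,a) = S_2(q,a)^2 S_3(q,a)^2 S_5(q,a) S_6(q,a) S_c(q,a)`. -/
def U (c q a : ℕ) : ℂ := S 2 q a ^ 2 * S 3 q a ^ 2 * S 5 q a * S 6 q a * S c q a

/-- `A_{n,c}(q) = Σ_{a=1,(a,q)=1}^{q} U_c(q,a) e(-a n / q)`. -/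
def A (n : ℤ) (c q : ℕ) : ℂ :=
  ∑ a ∈ (Finset.Icc 1 q).filter (fun a => Nat.gcd a q = 1),
    U c q a * e (-((a : ℝ) * (n : ℝ)) / q)

/-- The major arcs `𝔐`. -/
def Maj (n : ℕ) (B : ℝ) : Set ℝ :=
  {α | α ∈ Set.Icc (0 : ℝ) 1 ∧ ∃ a q : ℕ, a ≤ q ∧ 1 ≤ q ∧
    (q : ℝ) ≤ Real.log n ^ B ∧ Nat.gcd a q = 1 ∧
    |α - (a : ℝ) / q| ≤ Real.log n ^ B / n}

/-- `Q_c = n^{2/(3c²(c-1))}`. -/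
def Q (n c : ℕ) : ℝ := (n : ℝ) ^ (2 / (3 * (c : ℝ) ^ 2 * ((c : ℝ) - 1)))

/-- The arcs `𝕽_c`. -/
def R (n c : ℕ) : Set ℝ :=
  {α | α ∈ Set.Icc (0 : ℝ) 1 ∧ ∃ a q : ℕ, a ≤ q ∧ 1 ≤ q ∧
    (q : ℝ) ≤ Q n c ∧ Nat.gcd a q = 1 ∧ |(q : ℝ) * α - a| ≤ Q n c / n}

/-- `τ = 2^{-20}`. -/
def τ : ℝ := ((2 : ℝ) ^ (20 : ℕ))⁻¹

/-- The sets `𝓔_c`. -/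
def E (n c : ℕ) : Set ℝ :=
  {α | α ∈ Set.Icc (0 : ℝ) 1 ∧
    ‖f n c α‖ ≤ P n c ^ (if c = 6 then 1 - 24 * τ else 139 / 140 - 24 * τ)}

end

namespace SW

open Complex Metric

/-- A logarithm of a nonvanishing holomorphic function on a ball. -/
theorem exists_log_ball {f : ℂ → ℂ} {R : ℝ} (hR : 0 < R)
    (hf : DifferentiableOn ℂ f (ball 0 R)) (h0 : ∀ z ∈ ball (0 : ℂ) R, f z ≠ 0) :
    ∃ h : ℂ → ℂ, h 0 = 0 ∧ (∀ z ∈ ball (0 : ℂ) R, f z = f 0 * exp (h z)) ∧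
      ∀ z ∈ ball (0 : ℂ) R, HasDerivAt h (deriv f z / f z) z := by
  have hd : DifferentiableOn ℂ (fun z => deriv f z / f z) (ball 0 R) :=
    (hf.deriv isOpen_ball).div hf h0
  obtain ⟨h, hh⟩ := hd.isExactOn_ball
  have hh' : ∀ z ∈ ball (0 : ℂ) R, HasDerivAt (fun z => h z - h 0) (deriv f z / f z) z :=
    fun z hz => (hh z hz).sub_const _
  refine ⟨fun z => h z - h 0, by simp, ?_, hh'⟩
  have hconst : ∀ z ∈ ball (0 : ℂ) R,
      HasDerivAt (fun z => f z * exp (-(h z - h 0))) 0 z := by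
    intro z hz
    have h1 : HasDerivAt f (deriv f z) z :=
      ((hf z hz).differentiableAt (isOpen_ball.mem_nhds hz)).hasDerivAt
    have h2 := h1.mul ((hh' z hz).neg.cexp)
    have := div_mul_cancel₀ (deriv f z) (h0 z hz)
    refine h2.congr_deriv ?_
    change deriv f z * exp (-(h z - h 0)) +
      f z * (exp (-(h z - h 0)) * -(deriv f z / f z)) = 0
    linear_combination (-exp (-(h z - h 0))) * this
  have hz0 : (0 : ℂ) ∈ ball (0 : ℂ) R := by simpa using hR
  intro z hz
  have := (convex_ball (0 : ℂ) R).is_const_of_fderivWithin_eq_zero (𝕜 := ℂ)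
    (f := fun z => f z * exp (-(h z - h 0)))
    (fun w hw => (hconst w hw).differentiableAt.differentiableWithinAt)
    (fun w hw => by
      rw [fderivWithin_of_isOpen isOpen_ball hw]
      ext
      simpa using (hconst w hw).deriv) hz hz0
  simp only [sub_self, neg_zero, exp_zero, mul_one] at this
  rw [← this, mul_assoc, ← exp_add]
  simp

/-- Borel-Caratheodory for logarithmic derivatives. -/
theorem logDeriv_bound {f : ℂ → ℂ} {R M : ℝ} (hR : 0 < R) (hM : 0 < M)
    (hf : DifferentiableOn ℂ f (ball 0 R)) (h0 : ∀ z ∈ ball (0 : ℂ) R, f z ≠ 0)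
    (hb : ∀ z ∈ ball (0 : ℂ) R, ‖f z‖ ≤ Real.exp M * ‖f 0‖) {z : ℂ} (hz : ‖z‖ ≤ R / 2) :
    ‖deriv f z / f z‖ ≤ 24 * M / R := by
  obtain ⟨h, hh0, hexp, hder⟩ := exists_log_ball hR hf h0
  have hz0 : (0 : ℂ) ∈ ball (0 : ℂ) R := by simpa using hR
  have hdiff : DifferentiableOn ℂ h (ball 0 R) :=
    fun w hw => (hder w hw).differentiableAt.differentiableWithinAt
  have hre : Set.MapsTo h (ball 0 R) {z | z.re ≤ M} := by
    intro w hw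
    have h1 := hb w hw
    have hpos : 0 < ‖f 0‖ := norm_pos_iff.mpr (h0 0 hz0)
    rw [hexp w hw, norm_mul, Complex.norm_exp, mul_comm] at h1
    have := le_of_mul_le_mul_right h1 hpos
    exact Real.exp_le_exp.mp this
  have hbd : ∀ w ∈ sphere z (R / 4), ‖h w‖ ≤ 6 * M := by
    intro w hw
    have hw' : ‖w‖ ≤ 3 * R / 4 := by
      have : ‖w - z‖ = R / 4 := by simpa [dist_eq_norm] using hw
      calc ‖w‖ = ‖(w - z) + z‖ := by ring_nf
        _ ≤ ‖w - z‖ + ‖z‖ := norm_add_le _ _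
        _ ≤ 3 * R / 4 := by linarith
    have hwb : w ∈ ball (0 : ℂ) R := by
      rw [mem_ball_zero_iff]; linarith
    refine (borelCaratheodory_zero hM hdiff hre hR hwb hh0).trans ?_
    rw [div_le_iff₀ (by linarith)]
    nlinarith [norm_nonneg w]
  have hzb : z ∈ ball (0 : ℂ) R := by rw [mem_ball_zero_iff]; linarith
  have hsub : closedBall z (R / 4) ⊆ ball (0 : ℂ) R := by
    intro w hw
    rw [mem_closedBall, dist_eq_norm] at hw
    rw [mem_ball_zero_iff]
    calc ‖w‖ = ‖(w - z) + z‖ := by ring_nf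
        _ ≤ ‖w - z‖ + ‖z‖ := norm_add_le _ _
        _ < R := by linarith
  have hcl : DiffContOnCl ℂ h (ball z (R / 4)) :=
    (hdiff.mono hsub).diffContOnCl_ball subset_rfl
  have := norm_deriv_le_of_forall_mem_sphere_norm_le (by linarith : 0 < R / 4) hcl hbd
  rw [(hder z hzb).deriv] at this
  refine this.trans (le_of_eq ?_)
  field_simp
  ring

/-- Blaschke division step. -/
theorem blaschke_step {f : ℂ → ℂ} (hf : Differentiable ℂ f) {r B : ℝ} (hr : 0 < r) {ρ : ℂ}
    (hρ : ‖ρ‖ ≤ r / 2) (hfρ : f ρ = 0) (hf0 : f 0 ≠ 0)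
    (hB : ∀ z, ‖z‖ ≤ r → ‖f z‖ ≤ B) :
    ∃ g : ℂ → ℂ, Differentiable ℂ g ∧ g 0 ≠ 0 ∧ (∀ z, ‖z‖ ≤ r → ‖g z‖ ≤ B) ∧
      2 * ‖f 0‖ ≤ ‖g 0‖ ∧ (∀ z, ‖z‖ ≤ r / 2 → g z = 0 → f z = 0) ∧
      (-(deriv f 0 / f 0)).re = (-(deriv g 0 / g 0)).re +
        ρ.re * (1 / ‖ρ‖ ^ 2 - 1 / r ^ 2) := by
  have hρ0 : ρ ≠ 0 := by rintro rfl; exact hf0 hfρ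
  have hρn : 0 < ‖ρ‖ := norm_pos_iff.mpr hρ0
  set d := dslope f ρ with hd
  have hdd : Differentiable ℂ d := by
    rw [← differentiableOn_univ] at hf ⊢
    exact (differentiableOn_dslope (by simp)).mpr hf
  have hfd : ∀ z, f z = (z - ρ) * d z := by
    intro z
    have := sub_smul_dslope f ρ z
    rw [hfρ, sub_zero, smul_eq_mul] at this
    exact this.symm
  have hrc : (r : ℂ) ≠ 0 := by exact_mod_cast hr.ne'
  set k : ℂ → ℂ := fun z => ((r : ℂ) ^ 2 - (starRingEnd ℂ) ρ * z) / r with hk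
  have hkd : Differentiable ℂ k := by
    intro z; simp only [hk]; fun_prop
  have hf0d : f 0 = -ρ * d 0 := by rw [hfd 0]; ring
  have hd0 : d 0 ≠ 0 := by
    intro h; apply hf0; rw [hf0d, h, mul_zero]
  have hk0 : k 0 = r := by simp only [hk]; field_simp; ring
  refine ⟨fun z => d z * k z, hdd.mul hkd, ?_, ?_, ?_, ?_, ?_⟩
  · simp only [hk0]; exact mul_ne_zero hd0 hrc
  · intro z hz
    refine norm_le_of_forall_mem_frontier_norm_le (U := ball (0:ℂ) r) isBounded_ball
      (hdd.mul hkd).diffContOnCl ?_ ?_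
    · intro w hw
      rw [frontier_ball _ hr.ne', mem_sphere_zero_iff_norm] at hw
      have hkw : ‖k w‖ = ‖w - ρ‖ := by
        have h1 : (r : ℂ) ^ 2 - (starRingEnd ℂ) ρ * w = w * (starRingEnd ℂ) (w - ρ) := by
          rw [map_sub, mul_sub, Complex.mul_conj, Complex.normSq_eq_norm_sq, hw]
          push_cast; ring
        simp only [hk]
        rw [h1, norm_div, norm_mul, RCLike.norm_conj, hw]
        simp [abs_of_pos hr, hr.ne']
      have : ‖d w * k w‖ = ‖f w‖ := by
        rw [hfd w, norm_mul, norm_mul, hkw, mul_comm]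
      change ‖d w * k w‖ ≤ B
      rw [this]
      exact hB w hw.le
    · rw [closure_ball _ hr.ne']
      simpa using hz
  · simp only [hk0]
    rw [hf0d, norm_mul, norm_mul, norm_neg]
    simp only [norm_real, Real.norm_eq_abs, abs_of_pos hr]
    nlinarith [norm_nonneg (d 0)]
  · intro z hz hgz
    have hkz : k z ≠ 0 := by
      intro h
      simp only [hk, div_eq_zero_iff, hrc, or_false] at h
      have h1 : (r : ℂ) ^ 2 = (starRingEnd ℂ) ρ * z := sub_eq_zero.mp h
      have h2 : r ^ 2 = ‖ρ‖ * ‖z‖ := by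
        have := congrArg norm h1
        rw [norm_mul, RCLike.norm_conj, norm_pow] at this
        simpa [abs_of_pos hr] using this
      nlinarith [norm_nonneg z]
    have : d z = 0 := by simpa [hkz] using hgz
    rw [hfd z, this, mul_zero]
  · have e1 : deriv f 0 = d 0 + (0 - ρ) * deriv d 0 := by
      have : f = fun z => (z - ρ) * d z := funext hfd
      have h2 : HasDerivAt (fun z => (z - ρ) * d z) (1 * d 0 + (0 - ρ) * deriv d 0) 0 :=
        ((hasDerivAt_id (0:ℂ)).sub_const ρ).mul hdd.differentiableAt.hasDerivAt
      rw [this, h2.deriv, one_mul]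
    have e2 : deriv (fun z => d z * k z) 0 =
        deriv d 0 * r + d 0 * (-(starRingEnd ℂ) ρ / r) := by
      have hk' : HasDerivAt k (-(starRingEnd ℂ) ρ / r) 0 := by
        simp only [hk]
        have := (((hasDerivAt_id (0:ℂ)).const_mul ((starRingEnd ℂ) ρ)).const_sub
          ((r:ℂ) ^ 2)).div_const (r : ℂ)
        simpa using this
      have h2 := (hdd.differentiableAt (x := 0)).hasDerivAt.mul hk'
      have h3 := h2.deriv
      rw [hk0] at h3
      exact h3
    simp only [hk0, e2]
    rw [e1, hf0d]
    have e3 : -((d 0 + (0 - ρ) * deriv d 0) / (-ρ * d 0)) =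
        -((deriv d 0 * r + d 0 * (-(starRingEnd ℂ) ρ / r)) / (d 0 * r)) +
          (ρ⁻¹ - (starRingEnd ℂ) ρ / r ^ 2) := by
      field_simp
      ring
    rw [e3, add_re]
    congr 1
    rw [sub_re, inv_re, Complex.normSq_eq_norm_sq]
    have : ((starRingEnd ℂ) ρ / (r:ℂ) ^ 2).re = ρ.re / r ^ 2 := by
      rw [← ofReal_pow, div_ofReal_re, conj_re]
    rw [this]
    ring

theorem landau_aux {r M : ℝ} (hr : 0 < r) (hM : 0 < M) (k : ℕ) : ∀ (f : ℂ → ℂ) (B : ℝ),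
    Differentiable ℂ f → f 0 ≠ 0 → B ≤ 2 ^ k * ‖f 0‖ → B ≤ Real.exp M * ‖f 0‖ →
    (∀ z, ‖z‖ ≤ r → ‖f z‖ ≤ B) → (∀ z, ‖z‖ ≤ r / 2 → f z = 0 → z.re ≤ 0) →
    (-(deriv f 0 / f 0)).re ≤ 48 * M / r := by
  induction k with
  | zero =>
    intro f B hf hf0 hk hBM hB hz
    by_cases hex : ∃ ρ, ‖ρ‖ ≤ r / 2 ∧ f ρ = 0
    · obtain ⟨ρ, hρ, hfρ⟩ := hex
      obtain ⟨g, -, -, hgB, hg2, -, -⟩ := blaschke_step hf hr hρ hfρ hf0 hB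
      have := hgB 0 (by simpa using hr.le)
      have : 0 < ‖f 0‖ := norm_pos_iff.mpr hf0
      simp at hk
      linarith
    · push Not at hex
      have := logDeriv_bound (f := f) (half_pos hr) hM hf.differentiableOn
        (fun z hz => hex z (by simpa using (mem_ball_zero_iff.mp hz).le))
        (fun z hz => (hB z (by linarith [mem_ball_zero_iff.mp hz])).trans hBM)
        (z := 0) (by simp; linarith)
      refine ((re_le_norm _).trans ((norm_neg _).trans_le this)).trans (le_of_eq ?_)
      field_simp; ring
  | succ k ih =>
    intro f B hf hf0 hk hBM hB hz
    by_cases hex : ∃ ρ, ‖ρ‖ ≤ r / 2 ∧ f ρ = 0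
    · obtain ⟨ρ, hρ, hfρ⟩ := hex
      obtain ⟨g, hg, hg0, hgB, hg2, hgz, hgd⟩ := blaschke_step hf hr hρ hfρ hf0 hB
      have hpos : 0 < ‖f 0‖ := norm_pos_iff.mpr hf0
      have := ih g B hg hg0 (by rw [pow_succ] at hk; nlinarith [pow_pos (two_pos : (0:ℝ) < 2) k])
        (hBM.trans (by nlinarith [Real.exp_pos M])) hgB
        (fun z h1 h2 => hz z h1 (hgz z h1 h2))
      rw [hgd]
      have h3 : ρ.re * (1 / ‖ρ‖ ^ 2 - 1 / r ^ 2) ≤ 0 := by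
        have hρ0 : 0 < ‖ρ‖ := norm_pos_iff.mpr (by rintro rfl; exact hf0 hfρ)
        refine mul_nonpos_of_nonpos_of_nonneg (hz ρ hρ hfρ) ?_
        rw [sub_nonneg]
        gcongr
        linarith
      linarith
    · push Not at hex
      have := logDeriv_bound (f := f) (half_pos hr) hM hf.differentiableOn
        (fun z hz => hex z (by simpa using (mem_ball_zero_iff.mp hz).le))
        (fun z hz => (hB z (by linarith [mem_ball_zero_iff.mp hz])).trans hBM)
        (z := 0) (by simp; linarith)
      refine ((re_le_norm _).trans ((norm_neg _).trans_le this)).trans (le_of_eq ?_)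
      field_simp; ring

/-- Landau's lemma without extracted zero. -/
theorem landau {f : ℂ → ℂ} {r M : ℝ} {c : ℂ} (hr : 0 < r) (hM : 0 < M) (hf : Differentiable ℂ f)
    (hf0 : f c ≠ 0) (hB : ∀ z, ‖z - c‖ ≤ r → ‖f z‖ ≤ Real.exp M * ‖f c‖)
    (hz : ∀ z, f z = 0 → z.re ≤ c.re) :
    (-(deriv f c / f c)).re ≤ 48 * M / r := by
  obtain ⟨k, hk⟩ := pow_unbounded_of_one_lt (Real.exp M) (one_lt_two)
  have := landau_aux hr hM k (fun z => f (z + c)) (Real.exp M * ‖f c‖)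
    (hf.comp (by fun_prop)) (by simpa using hf0) (by simp; gcongr) (by simp)
    (fun z hzr => hB _ (by simpa using hzr)) (fun z _ h => by
      have := hz _ h
      simp at this
      linarith)
  rwa [deriv_comp_add_const, zero_add] at this

/-- Landau's lemma with one extracted zero. -/
theorem landau_zero {f : ℂ → ℂ} {r M : ℝ} {c ρ : ℂ} (hr : 0 < r) (hM : 0 < M)
    (hf : Differentiable ℂ f)
    (hf0 : f c ≠ 0) (hB : ∀ z, ‖z - c‖ ≤ r → ‖f z‖ ≤ Real.exp M * ‖f c‖)
    (hz : ∀ z, f z = 0 → z.re ≤ c.re) (hρ : f ρ = 0) (hρr : ‖ρ - c‖ ≤ r / 2) :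
    (-(deriv f c / f c)).re ≤ 48 * M / r +
      (ρ.re - c.re) * (1 / ‖ρ - c‖ ^ 2 - 1 / r ^ 2) := by
  obtain ⟨g, hg, hg0, hgB, hg2, hgz, hgd⟩ := blaschke_step (f := fun z => f (z + c))
    (hf.comp (by fun_prop)) hr hρr (by simpa using hρ) (by simpa using hf0)
    (B := Real.exp M * ‖f c‖) (fun z hzr => hB _ (by simpa using hzr))
  obtain ⟨k, hk⟩ := pow_unbounded_of_one_lt (Real.exp M) (one_lt_two)
  simp only [zero_add] at hg2 hgd
  have hpos : 0 < ‖f c‖ := norm_pos_iff.mpr hf0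
  have hle : Real.exp M * ‖f c‖ ≤ Real.exp M * ‖g 0‖ := by gcongr; linarith
  have := landau_aux hr hM k g (Real.exp M * ‖f c‖) hg hg0
    (hle.trans (by gcongr)) hle hgB (fun z h1 h2 => by
      have := hz _ (hgz z h1 h2)
      simp at this
      linarith)
  rw [deriv_comp_add_const, zero_add] at hgd
  rw [hgd, sub_re]
  linarith

end SW

namespace SW

open Complex Metric

/-- The Mellin-type integral attached to an error term. -/
noncomputable def errI (E : ℝ → ℂ) (s : ℂ) : ℂ := ∫ t in Set.Ioi (1 : ℝ), E t * (t : ℂ) ^ (-(s + 1))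

theorem errI_integrable {E : ℝ → ℂ} {K r : ℝ} (hm : Measurable E)
    (hE : ∀ t, 1 < t → ‖E t‖ ≤ K * t ^ r) {s : ℂ} (hs : r < s.re) :
    IntegrableOn (fun t : ℝ => E t * (t : ℂ) ^ (-(s + 1))) (Set.Ioi 1) := by
  have h1 : IntegrableOn (fun t : ℝ => K * t ^ (r - s.re - 1)) (Set.Ioi 1) :=
    (integrableOn_Ioi_rpow_of_lt (by linarith) zero_lt_one).const_mul K
  refine h1.mono' ?_ ?_
  · refine (hm.aestronglyMeasurable).mul ?_
    exact (by fun_prop : Measurable (fun t : ℝ => (t : ℂ) ^ (-(s + 1)))).aestronglyMeasurable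
  · filter_upwards [self_mem_ae_restrict measurableSet_Ioi] with t ht
    have ht0 : (0 : ℝ) < t := lt_trans zero_lt_one ht
    rw [norm_mul, Complex.norm_cpow_eq_rpow_re_of_pos ht0,
      show r - s.re - 1 = r + (-(s + 1)).re by simp; ring, Real.rpow_add ht0, ← mul_assoc]
    exact mul_le_mul_of_nonneg_right (hE t ht) (by positivity)

theorem errI_norm_le {E : ℝ → ℂ} {K r : ℝ}
    (hE : ∀ t, 1 < t → ‖E t‖ ≤ K * t ^ r) {s : ℂ} (hs : r < s.re) :
    ‖errI E s‖ ≤ K / (s.re - r) := by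
  have h1 : IntegrableOn (fun t : ℝ => K * t ^ (r - s.re - 1)) (Set.Ioi 1) :=
    (integrableOn_Ioi_rpow_of_lt (by linarith) zero_lt_one).const_mul K
  have h2 : ‖errI E s‖ ≤ ∫ t in Set.Ioi (1 : ℝ), K * t ^ (r - s.re - 1) := by
    refine norm_integral_le_of_norm_le h1 ?_
    filter_upwards [self_mem_ae_restrict measurableSet_Ioi] with t ht
    have ht0 : (0 : ℝ) < t := lt_trans zero_lt_one ht
    rw [norm_mul, Complex.norm_cpow_eq_rpow_re_of_pos ht0,
      show r - s.re - 1 = r + (-(s + 1)).re by simp; ring, Real.rpow_add ht0, ← mul_assoc]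
    exact mul_le_mul_of_nonneg_right (hE t ht) (by positivity)
  refine h2.trans (le_of_eq ?_)
  rw [integral_const_mul, integral_Ioi_rpow_of_lt (by linarith) zero_lt_one]
  simp only [Real.one_rpow]
  have : s.re - r ≠ 0 := by linarith
  have h3 : r - s.re - 1 + 1 ≠ 0 := by intro h; apply this; linarith
  field_simp
  ring

theorem errI_differentiableAt {E : ℝ → ℂ} {K r : ℝ} (hm : Measurable E)
    (hE : ∀ t, 1 < t → ‖E t‖ ≤ K * t ^ r) {s : ℂ} (hs : r < s.re) :
    DifferentiableAt ℂ (errI E) s := by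
  set f : ℝ → ℂ := Set.indicator (Set.Ioi 1) E with hf
  have hfm : Measurable f := hm.indicator measurableSet_Ioi
  have hb : ∀ t, 0 < t → ‖f t‖ ≤ |K| * t ^ r := by
    intro t ht
    by_cases h : t ∈ Set.Ioi (1 : ℝ)
    · rw [hf, Set.indicator_of_mem h]
      refine (hE t h).trans ?_
      gcongr
      exact le_abs_self K
    · rw [hf, Set.indicator_of_notMem h]; simp; positivity
  have hloc : LocallyIntegrableOn f (Set.Ioi 0) := by
    have hc : LocallyIntegrableOn (fun t : ℝ => |K| * t ^ r) (Set.Ioi 0) := by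
      refine ContinuousOn.locallyIntegrableOn ?_ measurableSet_Ioi
      refine continuousOn_const.mul ?_
      exact fun t ht ↦ (Real.continuousAt_rpow_const _ _
        <| Or.inl (ne_of_gt ht)).continuousWithinAt
    intro t ht
    obtain ⟨u, hu, hi⟩ := hc t ht
    refine ⟨u ∩ Set.Ioi 0, Filter.inter_mem hu self_mem_nhdsWithin, ?_⟩
    refine Integrable.mono' (hi.mono_set Set.inter_subset_left) hfm.aestronglyMeasurable ?_
    rw [ae_restrict_iff₀]
    · exact Filter.Eventually.of_forall fun x hx => hb x hx.2
    · exact (measurableSet_le hfm.norm (by fun_prop)).nullMeasurableSet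
  have hdiff : DifferentiableAt ℂ (mellin f) (-s) := by
    refine mellin_differentiableAt_of_isBigO_rpow (a := -r) (b := (-s).re - 1) hloc ?_ (by simpa)
      ?_ (by linarith)
    · rw [neg_neg]
      refine Asymptotics.IsBigO.of_bound |K| ?_
      filter_upwards [Filter.eventually_gt_atTop 0] with t ht
      rw [Real.norm_of_nonneg (by positivity)]
      exact hb t ht
    · refine Asymptotics.IsBigO.of_bound 0 ?_
      filter_upwards [mem_nhdsWithin_of_mem_nhds (Iio_mem_nhds zero_lt_one)] with t ht
      rw [hf, Set.indicator_of_notMem (by simpa using le_of_lt ht)]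
      simp
  have heq : errI E = fun s => mellin f (-s) := by
    funext s
    rw [errI, mellin]
    have : ∀ t : ℝ, (t : ℂ) ^ (-s - 1) • f t =
        Set.indicator (Set.Ioi 1) (fun t : ℝ => E t * (t : ℂ) ^ (-(s + 1))) t := by
      intro t
      by_cases h : t ∈ Set.Ioi (1 : ℝ)
      · rw [hf, Set.indicator_of_mem h, Set.indicator_of_mem h, smul_eq_mul, mul_comm]
        congr 2; ring
      · rw [hf, Set.indicator_of_notMem h, Set.indicator_of_notMem h, smul_zero]
    simp_rw [this]
    rw [setIntegral_indicator measurableSet_Ioi]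
    congr 2
    ext t; simp only [Set.mem_inter_iff, Set.mem_Ioi]
    exact ⟨fun h => ⟨by linarith, h⟩, fun h => h.2⟩
  rw [heq]
  exact hdiff.comp s differentiableAt_id.neg

/-- measurability of a summatory function -/
theorem measurable_summatory (a : ℕ → ℂ) : Measurable (fun t : ℝ => ∑ k ∈ Icc 1 ⌊t⌋₊, a k) :=
  (measurable_from_nat (f := fun n => ∑ k ∈ Icc 1 n, a k)).comp Nat.measurable_floor

theorem LSeries_eq_errI {a : ℕ → ℂ} {ρ : ℂ} {K r : ℝ} (ha : ∀ n, ‖a n‖ ≤ 1)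
    (hr : r < 1)
    (hE : ∀ t : ℝ, 1 < t → ‖(∑ k ∈ Icc 1 ⌊t⌋₊, a k) - ρ * t‖ ≤ K * t ^ r) {s : ℂ} (hs : 1 < s.re) :
    LSeries a s = ρ * (s / (s - 1)) +
      s * errI (fun t : ℝ => (∑ k ∈ Icc 1 ⌊t⌋₊, a k) - ρ * t) s := by
  have hO : (fun n : ℕ ↦ ∑ k ∈ Icc 1 n, ‖a k‖) =O[Filter.atTop] fun n : ℕ ↦ (n : ℝ) ^ (1 : ℝ) := by
    refine Asymptotics.IsBigO.of_bound 1 (Filter.Eventually.of_forall fun n => ?_)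
    rw [Real.rpow_one, one_mul, Real.norm_of_nonneg (Finset.sum_nonneg fun _ _ => norm_nonneg _),
      Real.norm_of_nonneg (by positivity)]
    refine (Finset.sum_le_sum fun i _ => ha i).trans (by simp)
  rw [LSeries_eq_mul_integral' a zero_le_one hs hO, errI]
  have hm : Measurable (fun t : ℝ => (∑ k ∈ Icc 1 ⌊t⌋₊, a k) - ρ * (t : ℂ)) :=
    (measurable_summatory a).sub (by fun_prop)
  have h1 := errI_integrable hm hE (s := s) (by linarith)
  have hre : (-s).re < -1 := by simpa using hs
  have h2 : IntegrableOn (fun t : ℝ => ρ * (t : ℂ) ^ (-s)) (Set.Ioi 1) :=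
    (integrableOn_Ioi_cpow_of_lt hre zero_lt_one).const_mul ρ
  have h3 : ∫ t in Set.Ioi (1 : ℝ), ρ * (t : ℂ) ^ (-s) = ρ / (s - 1) := by
    rw [integral_const_mul, integral_Ioi_cpow_of_lt hre zero_lt_one]
    have : s - 1 ≠ 0 := by
      intro h; rw [sub_eq_zero] at h; simp [h] at hs
    have h' : -s + 1 ≠ 0 := by intro h; apply this; linear_combination -h
    simp only [ofReal_one, one_cpow]
    field_simp
    ring
  have h4 : ∀ t ∈ Set.Ioi (1 : ℝ), (∑ k ∈ Icc 1 ⌊t⌋₊, a k) * (t : ℂ) ^ (-(s + 1)) =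
      ρ * (t : ℂ) ^ (-s) + ((∑ k ∈ Icc 1 ⌊t⌋₊, a k) - ρ * t) * (t : ℂ) ^ (-(s + 1)) := by
    intro t ht
    have ht0 : (t : ℂ) ≠ 0 := by
      have : (0 : ℝ) < t := lt_trans zero_lt_one ht
      exact_mod_cast this.ne'
    rw [show -s = -(s + 1) + 1 by ring, cpow_add _ _ ht0, cpow_one]
    ring
  rw [setIntegral_congr_fun measurableSet_Ioi h4, integral_add h2 h1, h3]
  ring

end SW

namespace SW

open Complex Metric

theorem sum_range_zmod {q : ℕ} [NeZero q] (g : ZMod q → ℂ) :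
    ∑ k ∈ range q, g (k : ZMod q) = ∑ x, g x := by
  refine Finset.sum_bij' (fun k _ => (k : ZMod q)) (fun x _ => x.val) ?_ ?_ ?_ ?_ ?_
  · simp
  · intro x _; simpa using ZMod.val_lt x
  · intro k hk; simpa using ZMod.val_cast_of_lt (by simpa using hk)
  · intro x _; simp
  · simp

theorem sum_char_period {q : ℕ} [NeZero q] {χ : DirichletCharacter ℂ q} (hχ : χ ≠ 1) (m : ℕ) :
    ∑ k ∈ range q, χ ((k + m : ℕ) : ZMod q) = 0 := by
  have := sum_range_zmod (fun x : ZMod q => χ (x + m))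
  simp only [Nat.cast_add]
  rw [this, ← χ.sum_eq_zero_of_ne_one hχ]
  exact Fintype.sum_equiv (Equiv.addRight (m : ZMod q)) _ _ (fun x => rfl)

theorem norm_sum_char_range_le {q : ℕ} [NeZero q] {χ : DirichletCharacter ℂ q} (hχ : χ ≠ 1)
    (N : ℕ) : ‖∑ k ∈ range N, χ ((k + 1 : ℕ) : ZMod q)‖ ≤ q := by
  induction N using Nat.strong_induction_on with
  | _ N ih =>
    by_cases h : N < q
    · refine (norm_sum_le _ _).trans ((Finset.sum_le_sum fun i _ => χ.norm_le_one _).trans ?_)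
      simp only [sum_const, card_range, nsmul_eq_mul, mul_one]
      exact_mod_cast h.le
    · obtain ⟨m, rfl⟩ : ∃ m, N = m + q := ⟨N - q, by omega⟩
      rw [Finset.sum_range_add]
      have h2 := sum_char_period hχ (m + 1)
      have h3 : ∑ x ∈ range q, χ ((m + x + 1 : ℕ) : ZMod q) = 0 := by
        rw [← h2]; refine Finset.sum_congr rfl fun x _ => ?_
        congr 2; ring
      rw [h3, add_zero]
      exact ih m (by have := NeZero.pos q; omega)

theorem sum_Icc_one (a : ℕ → ℂ) (N : ℕ) : ∑ k ∈ Icc 1 N, a k = ∑ k ∈ range N, a (k + 1) := by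
  rw [Finset.range_eq_Ico, Finset.sum_Ico_add' a 0 N 1]
  rfl

theorem norm_sum_char_le {q : ℕ} [NeZero q] {χ : DirichletCharacter ℂ q} (hχ : χ ≠ 1)
    {κ : ℝ} (hκ : 0 ≤ κ) (hκ1 : κ ≤ 1) (t : ℝ) (ht : 1 < t) :
    ‖(∑ k ∈ Icc 1 ⌊t⌋₊, χ (k : ZMod q)) - 0 * t‖ ≤ (q : ℝ) ^ κ * t ^ (1 - κ) := by
  rw [zero_mul, sub_zero]
  have h1 : ‖∑ k ∈ Icc 1 ⌊t⌋₊, χ (k : ZMod q)‖ ≤ q := by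
    rw [sum_Icc_one (fun k => χ (k : ZMod q))]; exact norm_sum_char_range_le hχ _
  have h2 : ‖∑ k ∈ Icc 1 ⌊t⌋₊, χ (k : ZMod q)‖ ≤ t := by
    refine (norm_sum_le _ _).trans ((Finset.sum_le_sum fun i _ => χ.norm_le_one _).trans ?_)
    simp only [sum_const, Nat.card_Icc, nsmul_eq_mul, mul_one, Nat.add_sub_cancel]
    exact Nat.floor_le (by linarith)
  set x := ‖∑ k ∈ Icc 1 ⌊t⌋₊, χ (k : ZMod q)‖ with hx
  have hx0 : 0 ≤ x := norm_nonneg _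
  rcases hx0.eq_or_lt with h | h
  · rw [← h]; positivity
  · calc x = x ^ κ * x ^ (1 - κ) := by rw [← Real.rpow_add h]; simp
      _ ≤ _ := by gcongr

/-- The entire function attached to `χ`. -/
noncomputable def Lf {q : ℕ} [NeZero q] (χ : DirichletCharacter ℂ q) : ℂ → ℂ :=
  open Classical in
  if χ = 1 then DirichletCharacter.LFunctionTrivChar₁ q else DirichletCharacter.LFunction χ

theorem Lf_one {q : ℕ} [NeZero q] : Lf (1 : DirichletCharacter ℂ q) =
    DirichletCharacter.LFunctionTrivChar₁ q := by simp [Lf]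

theorem Lf_one_apply {q : ℕ} [NeZero q] {s : ℂ} (hs : s ≠ 1) :
    Lf (1 : DirichletCharacter ℂ q) s =
    (s - 1) * DirichletCharacter.LFunction (1 : DirichletCharacter ℂ q) s := by
  rw [Lf_one, DirichletCharacter.LFunctionTrivChar₁, Function.update_of_ne hs,
    DirichletCharacter.LFunctionTrivChar]

theorem Lf_ne {q : ℕ} [NeZero q] {χ : DirichletCharacter ℂ q} (h : χ ≠ 1) :
    Lf χ = DirichletCharacter.LFunction χ := by simp [Lf, h]

theorem Lf_diff {q : ℕ} [NeZero q] (χ : DirichletCharacter ℂ q) : Differentiable ℂ (Lf χ) := by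
  by_cases h : χ = 1
  · subst h; rw [Lf_one]; exact DirichletCharacter.differentiable_LFunctionTrivChar₁ q
  · rw [Lf_ne h]; exact DirichletCharacter.differentiable_LFunction h

theorem isPreconnected_half (r : ℝ) : IsPreconnected {s : ℂ | r < s.re} :=
  (convex_halfSpace_re_gt r).isPreconnected

theorem isOpen_half (r : ℝ) : IsOpen {s : ℂ | r < s.re} := isOpen_lt continuous_const continuous_re

/-- identity theorem on half planes -/
theorem eq_of_eq_half {f g : ℂ → ℂ} {r : ℝ} (hr : r ≤ 1)
    (hf : ∀ s : ℂ, r < s.re → DifferentiableAt ℂ f s)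
    (hg : ∀ s : ℂ, r < s.re → DifferentiableAt ℂ g s) (h : ∀ s : ℂ, 1 < s.re → f s = g s)
    {s : ℂ} (hs : r < s.re) : f s = g s := by
  have hf' : AnalyticOnNhd ℂ f {s : ℂ | r < s.re} :=
    DifferentiableOn.analyticOnNhd (fun s hs => (hf s hs).differentiableWithinAt) (isOpen_half r)
  have hg' : AnalyticOnNhd ℂ g {s : ℂ | r < s.re} :=
    DifferentiableOn.analyticOnNhd (fun s hs => (hg s hs).differentiableWithinAt) (isOpen_half r)
  have h2 : r < (2 : ℂ).re := by simp; linarith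
  refine hf'.eqOn_of_preconnected_of_eventuallyEq hg' (isPreconnected_half r) h2 ?_ hs
  filter_upwards [(isOpen_half 1).mem_nhds (by simp : (2 : ℂ) ∈ {s : ℂ | 1 < s.re})] with z hz
  exact h z hz

theorem LFunction_eq_errI {q : ℕ} [NeZero q] {χ : DirichletCharacter ℂ q} (hχ : χ ≠ 1)
    {s : ℂ} (hs : 0 < s.re) : DirichletCharacter.LFunction χ s =
      s * errI (fun t : ℝ => (∑ k ∈ Icc 1 ⌊t⌋₊, χ (k : ZMod q)) - 0 * t) s := by
  have hE := norm_sum_char_le hχ zero_le_one le_rfl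
  have hm : Measurable (fun t : ℝ => (∑ k ∈ Icc 1 ⌊t⌋₊, χ (k : ZMod q)) - 0 * (t : ℂ)) :=
    (measurable_summatory fun k => χ (k : ZMod q)).sub (by fun_prop)
  refine eq_of_eq_half (g := fun s => s * errI (fun t : ℝ => (∑ k ∈ Icc 1 ⌊t⌋₊,
    χ (k : ZMod q)) - 0 * t) s) zero_le_one
    (fun s _ => DirichletCharacter.differentiable_LFunction hχ s) ?_ ?_ hs
  · intro s hs
    exact differentiableAt_id.mul (errI_differentiableAt hm hE (by simpa using hs))
  · intro s hs
    rw [DirichletCharacter.LFunction_eq_LSeries _ hs,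
      LSeries_eq_errI (a := fun n => χ (n : ZMod q)) (fun n => χ.norm_le_one _) (by norm_num) hE hs]
    simp

theorem LFunction_norm_le {q : ℕ} [NeZero q] {χ : DirichletCharacter ℂ q} (hχ : χ ≠ 1)
    {κ : ℝ} (hκ : 0 ≤ κ) (hκ1 : κ ≤ 1) {s : ℂ} (hs : 1 - κ < s.re) :
    ‖DirichletCharacter.LFunction χ s‖ ≤ ‖s‖ * ((q : ℝ) ^ κ / (s.re - (1 - κ))) := by
  rw [LFunction_eq_errI hχ (by linarith), norm_mul]
  gcongr
  exact errI_norm_le (norm_sum_char_le hχ hκ hκ1) hs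

/-- error term for zeta -/
noncomputable def zE : ℝ → ℂ := fun t : ℝ => (∑ _k ∈ Icc 1 ⌊t⌋₊, (1 : ℂ)) - 1 * t

theorem zE_le (t : ℝ) (ht : 1 < t) : ‖zE t‖ ≤ 1 * t ^ (0 : ℝ) := by
  simp only [zE, sum_const, Nat.card_Icc, Nat.add_sub_cancel, nsmul_eq_mul, mul_one, one_mul,
    Real.rpow_zero]
  rw [← ofReal_natCast, ← ofReal_sub, norm_real, Real.norm_eq_abs, abs_le]
  have h1 := Nat.floor_le (show (0:ℝ) ≤ t by linarith)
  have h2 := Nat.lt_floor_add_one t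
  constructor <;> linarith

theorem zE_meas : Measurable zE := (measurable_summatory fun _ => 1).sub (by fun_prop)

theorem zE_diff {s : ℂ} (hs : 0 < s.re) : DifferentiableAt ℂ (errI zE) s :=
  errI_differentiableAt zE_meas zE_le hs

theorem zE_norm {s : ℂ} (hs : 0 < s.re) : ‖errI zE s‖ ≤ 1 / s.re := by
  simpa using errI_norm_le zE_le hs

theorem zeta_eq_errI_aux {s : ℂ} (hs : 1 < s.re) : riemannZeta s =
      s / (s - 1) + s * errI zE s := by
  rw [← LSeries_one_eq_riemannZeta hs]
  have := LSeries_eq_errI (a := fun _ => 1) (ρ := 1) (K := 1) (r := 0)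
    (fun n => by simp) (by norm_num) zE_le hs
  rw [one_mul] at this
  exact this

theorem Zf_eq {s : ℂ} (hs : 0 < s.re) : Lf (1 : DirichletCharacter ℂ 1) s =
      s + (s - 1) * (s * errI zE s) := by
  refine eq_of_eq_half (g := fun s => s + (s - 1) * (s * errI zE s)) zero_le_one
    (fun s _ => Lf_diff 1 s) ?_ ?_ hs
  · intro s hs
    have := zE_diff hs
    fun_prop
  · intro s hs
    have h1 : s ≠ 1 := by rintro rfl; simp at hs
    have h2 : s - 1 ≠ 0 := sub_ne_zero.mpr h1
    rw [Lf_one_apply h1, DirichletCharacter.LFunction_modOne_eq, zeta_eq_errI_aux hs]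
    field_simp

theorem zeta_eq_errI {s : ℂ} (hs : 0 < s.re) (h1 : s ≠ 1) : riemannZeta s =
      s / (s - 1) + s * errI zE s := by
  have h2 : s - 1 ≠ 0 := sub_ne_zero.mpr h1
  have := Zf_eq hs
  rw [Lf_one_apply h1, DirichletCharacter.LFunction_modOne_eq] at this
  field_simp
  linear_combination this

theorem Lf_one_eq_mul {q : ℕ} [NeZero q] (s : ℂ) : Lf (1 : DirichletCharacter ℂ q) s =
    (∏ p ∈ q.primeFactors, (1 - (p : ℂ) ^ (-s))) * Lf (1 : DirichletCharacter ℂ 1) s := by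
  by_cases h1 : s = 1
  · subst h1
    rw [Lf_one, Lf_one]
    simp [DirichletCharacter.LFunctionTrivChar₁, cpow_neg]
  · rw [Lf_one_apply h1, Lf_one_apply h1, DirichletCharacter.LFunction_modOne_eq]
    have := DirichletCharacter.LFunctionTrivChar_eq_mul_riemannZeta (N := q) h1
    rw [DirichletCharacter.LFunctionTrivChar] at this
    rw [this]; ring

theorem prod_primeFactors_le {q : ℕ} [NeZero q] {s : ℂ} (hs : 0 < s.re) :
    ‖∏ p ∈ q.primeFactors, (1 - (p : ℂ) ^ (-s))‖ ≤ q := by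
  rw [norm_prod]
  have h1 : ∏ p ∈ q.primeFactors, ‖(1 - (p : ℂ) ^ (-s))‖ ≤ ∏ p ∈ q.primeFactors, (p : ℝ) := by
    refine Finset.prod_le_prod (fun _ _ => norm_nonneg _) fun p hp => ?_
    have hp' := Nat.prime_of_mem_primeFactors hp
    have h2 : ‖(p : ℂ) ^ (-s)‖ ≤ 1 := by
      rw [norm_natCast_cpow_of_pos hp'.pos]
      refine Real.rpow_le_one_of_one_le_of_nonpos (by exact_mod_cast hp'.one_lt.le) ?_
      simp; linarith
    have h3 : (2 : ℝ) ≤ p := by exact_mod_cast hp'.two_le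
    calc _ ≤ ‖(1 : ℂ)‖ + ‖(p : ℂ) ^ (-s)‖ := norm_sub_le _ _
      _ ≤ _ := by simp only [norm_one]; linarith
  refine h1.trans ?_
  have := Nat.le_of_dvd (NeZero.pos q) (Nat.prod_primeFactors_dvd q)
  rw [← Nat.cast_prod]
  exact Nat.cast_le.mpr this

theorem Zf_norm_le {s : ℂ} (hs : 1 / 4 ≤ s.re) : ‖Lf (1 : DirichletCharacter ℂ 1) s‖ ≤
    5 * (‖s‖ + 2) ^ 2 := by
  have hs0 : 0 < s.re := by linarith
  rw [Zf_eq hs0]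
  have h4 : ‖errI zE s‖ ≤ 4 := (zE_norm hs0).trans (by
    rw [div_le_iff₀ hs0]; linarith)
  have h5 : ‖s - 1‖ ≤ ‖s‖ + 1 := by simpa using norm_sub_le s 1
  calc ‖s + (s - 1) * (s * errI zE s)‖ ≤ ‖s‖ + ‖s - 1‖ * (‖s‖ * ‖errI zE s‖) := by
        rw [← norm_mul, ← norm_mul]; exact norm_add_le _ _
    _ ≤ ‖s‖ + (‖s‖ + 1) * (‖s‖ * 4) := by gcongr
    _ ≤ _ := by nlinarith [norm_nonneg s]

/-- F2 -/
theorem Lf_norm_le {q : ℕ} [NeZero q] (χ : DirichletCharacter ℂ q) {s : ℂ} (hs : 1 / 4 ≤ s.re) :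
    ‖Lf χ s‖ ≤ 5 * q * (‖s‖ + 2) ^ 2 := by
  have hq : (1 : ℝ) ≤ q := by exact_mod_cast NeZero.one_le
  by_cases h : χ = 1
  · subst h
    rw [Lf_one_eq_mul, norm_mul]
    calc _ ≤ (q : ℝ) * (5 * (‖s‖ + 2) ^ 2) :=
          mul_le_mul (prod_primeFactors_le (by linarith)) (Zf_norm_le hs) (norm_nonneg _)
            (by positivity)
      _ = _ := by ring
  · rw [Lf_ne h]
    have := LFunction_norm_le h zero_le_one le_rfl (s := s) (by linarith)
    rw [Real.rpow_one, sub_self, sub_zero] at this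
    refine this.trans ?_
    have h2 : (q : ℝ) / s.re ≤ q * 4 := by
      rw [div_le_iff₀ (by linarith)]; nlinarith
    calc ‖s‖ * ((q : ℝ) / s.re) ≤ ‖s‖ * (q * 4) := by gcongr
      _ = q * (4 * ‖s‖) := by ring
      _ ≤ q * (5 * (‖s‖ + 2) ^ 2) :=
        mul_le_mul_of_nonneg_left (by nlinarith [norm_nonneg s]) (by positivity)
      _ = _ := by ring

theorem LSeries_norm_le {a : ℕ → ℂ} (ha : ∀ n, ‖a n‖ ≤ 1) {s : ℂ} (hs : 1 < s.re) :
    ‖LSeries a s‖ ≤ 2 * s.re / (s.re - 1) := by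
  have hsum : LSeriesSummable 1 (s.re : ℂ) := LSeriesSummable_one_iff.mpr (by simpa)
  have h1 : ∀ n, ‖LSeries.term a s n‖ ≤ ‖LSeries.term 1 (s.re : ℂ) n‖ := by
    intro n
    rcases eq_or_ne n 0 with rfl | hn
    · simp
    · rw [LSeries.term_of_ne_zero hn, LSeries.term_of_ne_zero hn, norm_div, norm_div,
        norm_natCast_cpow_of_pos (Nat.pos_of_ne_zero hn),
        norm_natCast_cpow_of_pos (Nat.pos_of_ne_zero hn)]
      simp only [ofReal_re]
      gcongr
      simpa using ha n
  have h2 : ‖LSeries a s‖ ≤ ∑' n, ‖LSeries.term 1 (s.re : ℂ) n‖ :=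
    tsum_of_norm_bounded hsum.norm.hasSum h1
  have h3 : ((∑' n, ‖LSeries.term 1 (s.re : ℂ) n‖ : ℝ) : ℂ) = riemannZeta s.re := by
    rw [← LSeries_one_eq_riemannZeta (by simpa), ofReal_tsum, LSeries]
    refine tsum_congr fun n => ?_
    rcases eq_or_ne n 0 with rfl | hn
    · simp
    · rw [LSeries.term_of_ne_zero hn, norm_div, norm_natCast_cpow_of_pos (Nat.pos_of_ne_zero hn)]
      simp [ofReal_cpow]
  have h4 : ‖riemannZeta s.re‖ ≤ 2 * s.re / (s.re - 1) := by
    rw [zeta_eq_errI_aux (by simpa)]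
    have h5 := zE_norm (s := (s.re : ℂ)) (by simp; linarith)
    have h6 : ‖(s.re : ℂ)‖ = s.re := by
      rw [norm_real, Real.norm_of_nonneg (by linarith)]
    have h7 : ‖(s.re : ℂ) - 1‖ = s.re - 1 := by
      rw [← ofReal_one, ← ofReal_sub, norm_real, Real.norm_of_nonneg (by linarith)]
    refine (norm_add_le _ _).trans ?_
    rw [norm_div, norm_mul, h6, h7]
    have h8 : s.re * ‖errI zE s.re‖ ≤ 1 := by
      have : s.re * ‖errI zE s.re‖ ≤ s.re * (1 / s.re) := by
        refine mul_le_mul_of_nonneg_left ?_ (by linarith)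
        simpa using h5
      rwa [mul_one_div, div_self (by linarith)] at this
    have h9 : 1 ≤ s.re / (s.re - 1) := by rw [le_div_iff₀ (by linarith)]; linarith
    calc _ ≤ s.re / (s.re - 1) + s.re / (s.re - 1) := by linarith
      _ = _ := by ring
  refine h2.trans (le_trans ?_ h4)
  rw [← h3, norm_real]
  exact Real.le_norm_self _

theorem LFunction_lower {q : ℕ} [NeZero q] (χ : DirichletCharacter ℂ q) {s : ℂ} (hs : 1 < s.re) :
    (s.re - 1) / (2 * s.re) ≤ ‖DirichletCharacter.LFunction χ s‖ := by
  have h := DirichletCharacter.LSeries.mul_mu_eq_one χ hs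
  rw [← DirichletCharacter.LFunction_eq_LSeries _ hs] at h
  have h2 := LSeries_norm_le (a := (fun n : ℕ => χ (n : ZMod q)) *
    (fun n : ℕ => ((ArithmeticFunction.moebius n : ℤ) : ℂ))) (s := s) (fun n => by
      rw [Pi.mul_apply, norm_mul]
      refine mul_le_one₀ (χ.norm_le_one _) (norm_nonneg _) ?_
      rw [Complex.norm_intCast]
      exact_mod_cast ArithmeticFunction.abs_moebius_le_one) hs
  have h3 := congrArg norm h
  rw [norm_mul, norm_one] at h3
  have h4 : 0 < (2 * s.re / (s.re - 1)) := by
    have : 0 < s.re - 1 := by linarith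
    have : 0 < s.re := by linarith
    positivity
  have h5 : 1 ≤ ‖DirichletCharacter.LFunction χ s‖ * (2 * s.re / (s.re - 1)) := by
    exact h3.symm.le.trans (mul_le_mul_of_nonneg_left h2 (norm_nonneg _))
  rw [← div_le_iff₀ h4, one_div_div] at h5
  exact h5

/-- F4 -/
theorem Lf_lower {q : ℕ} [NeZero q] (χ : DirichletCharacter ℂ q) {s : ℂ} (hs : 1 < s.re)
    (hs2 : s.re ≤ 2) : (s.re - 1) ^ 2 / 4 ≤ ‖Lf χ s‖ := by
  have h1 := LFunction_lower χ hs
  have h2 : (s.re - 1) / 4 ≤ (s.re - 1) / (2 * s.re) := by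
    gcongr; linarith
  by_cases h : χ = 1
  · subst h
    have hs1 : s ≠ 1 := by rintro rfl; simp at hs
    rw [Lf_one_apply hs1, norm_mul]
    have h3 : s.re - 1 ≤ ‖s - 1‖ := by simpa using Complex.re_le_norm (s - 1)
    calc (s.re - 1) ^ 2 / 4 = (s.re - 1) * ((s.re - 1) / 4) := by ring
      _ ≤ _ := by
        refine mul_le_mul h3 (h2.trans h1) (by linarith) (norm_nonneg _)
  · rw [Lf_ne h]
    refine le_trans ?_ (h2.trans h1)
    nlinarith

theorem Lf_ne_zero {q : ℕ} [NeZero q] (χ : DirichletCharacter ℂ q) {s : ℂ} (hs : 1 ≤ s.re) :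
    Lf χ s ≠ 0 := by
  by_cases h : χ = 1
  · subst h
    by_cases h1 : s = 1
    · subst h1; rw [Lf_one]; exact DirichletCharacter.LFunctionTrivChar₁_apply_one_ne_zero q
    · rw [Lf_one_apply h1]
      exact mul_ne_zero (sub_ne_zero.mpr h1)
        (DirichletCharacter.LFunction_ne_zero_of_one_le_re _ (.inr h1) hs)
  · rw [Lf_ne h]
    exact DirichletCharacter.LFunction_ne_zero_of_one_le_re _ (.inl h) hs

/-- twisted von Mangoldt series -/
noncomputable def LΛ {q : ℕ} (χ : DirichletCharacter ℂ q) (s : ℂ) : ℂ :=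
  LSeries (fun n : ℕ => χ (n : ZMod q) * (ArithmeticFunction.vonMangoldt n : ℂ)) s

/-- F3 -/
theorem Lf_logDeriv {q : ℕ} [NeZero q] (χ : DirichletCharacter ℂ q) {s : ℂ} (hs : 1 < s.re) :
    -(deriv (Lf χ) s / Lf χ s) = LΛ χ s - (open Classical in if χ = 1 then 1 / (s - 1) else 0) := by
  have h0 := DirichletCharacter.LSeries_twist_vonMangoldt_eq χ hs
  rw [← DirichletCharacter.deriv_LFunction_eq_deriv_LSeries _ hs,
    ← DirichletCharacter.LFunction_eq_LSeries _ hs] at h0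
  have h0' : LΛ χ s = - deriv (DirichletCharacter.LFunction χ) s /
    DirichletCharacter.LFunction χ s := h0
  by_cases h : χ = 1
  · subst h
    have hs1 : s ≠ 1 := by rintro rfl; simp at hs
    have hL : DirichletCharacter.LFunction (1 : DirichletCharacter ℂ q) s ≠ 0 :=
      DirichletCharacter.LFunction_ne_zero_of_one_le_re _ (.inr hs1) hs.le
    have hd := DirichletCharacter.deriv_LFunctionTrivChar₁_apply_of_ne_one q hs1
    rw [← Lf_one, DirichletCharacter.LFunctionTrivChar] at hd
    rw [hd, Lf_one_apply hs1, h0', if_pos rfl]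
    have := sub_ne_zero.mpr hs1
    field_simp
    ring
  · rw [Lf_ne h, h0', if_neg h]
    ring

end SW

namespace SW

open Complex Metric
open scoped ComplexOrder

/-- A character as an arithmetic function -/
noncomputable def cA {q : ℕ} (χ : DirichletCharacter ℂ q) : ArithmeticFunction ℂ :=
  toArithmeticFunction (fun n : ℕ => χ (n : ZMod q))

/-- twisted von Mangoldt as an arithmetic function -/
noncomputable def lA {q : ℕ} (χ : DirichletCharacter ℂ q) : ArithmeticFunction ℂ :=
  toArithmeticFunction (fun n : ℕ => χ (n : ZMod q) * (ArithmeticFunction.vonMangoldt n : ℂ))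

/-- pointwise multiplication by log -/
noncomputable def dA (f : ArithmeticFunction ℂ) : ArithmeticFunction ℂ :=
  ⟨fun n => Complex.log n * f n, by simp⟩

theorem dA_apply (f : ArithmeticFunction ℂ) (n : ℕ) : dA f n = Complex.log n * f n := rfl

theorem dA_mul (f g : ArithmeticFunction ℂ) : dA (f * g) = dA f * g + f * dA g := by
  ext n
  rw [dA_apply, ArithmeticFunction.add_apply, ArithmeticFunction.mul_apply,
    ArithmeticFunction.mul_apply, ArithmeticFunction.mul_apply, Finset.mul_sum,
    ← Finset.sum_add_distrib]
  refine Finset.sum_congr rfl fun p hp => ?_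
  obtain ⟨h1, h2⟩ := Nat.mem_divisorsAntidiagonal.mp hp
  have h3 : p.1 ≠ 0 := by rintro h; simp [h] at h1; exact h2 h1.symm
  have h4 : p.2 ≠ 0 := by rintro h; simp [h] at h1; exact h2 h1.symm
  rw [dA_apply, dA_apply, ← h1]
  simp only [Nat.cast_mul, ← ofReal_natCast, ← ofReal_mul]
  have : Complex.log ((p.1 : ℝ) * (p.2 : ℝ) : ℝ) = Complex.log (p.1 : ℝ) + Complex.log (p.2 : ℝ) := by
    rw [← ofReal_log (by positivity), ← ofReal_log (by positivity), ← ofReal_log (by positivity),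
      Real.log_mul (by exact_mod_cast h3) (by exact_mod_cast h4), ofReal_add]
  rw [this]
  ring

theorem cA_apply {q : ℕ} (χ : DirichletCharacter ℂ q) {n : ℕ} (hn : n ≠ 0) :
    cA χ n = χ (n : ZMod q) := by
  change (if n = 0 then 0 else _) = _
  rw [if_neg hn]

theorem lA_apply {q : ℕ} (χ : DirichletCharacter ℂ q) (n : ℕ) :
    lA χ n = χ (n : ZMod q) * (ArithmeticFunction.vonMangoldt n : ℂ) := by
  change (if n = 0 then 0 else _) = _
  split_ifs with h
  · subst h; simp
  · rfl

theorem dA_cA {q : ℕ} (χ : DirichletCharacter ℂ q) : dA (cA χ) = lA χ * cA χ := by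
  ext n
  have h := congrFun (DirichletCharacter.convolution_twist_vonMangoldt χ) n
  have h2 : (lA χ * cA χ) n = χ (n : ZMod q) * Complex.log n := h
  rw [h2, dA_apply]
  rcases eq_or_ne n 0 with rfl | hn
  · simp
  · rw [cA_apply _ hn]; ring

theorem LSeries_cA {q : ℕ} [NeZero q] (χ : DirichletCharacter ℂ q) {s : ℂ} (hs : 1 < s.re) :
    LSeries (cA χ) s = DirichletCharacter.LFunction χ s ∧ LSeriesSummable (cA χ) s := by
  have h : ∀ {n : ℕ}, n ≠ 0 → cA χ n = χ (n : ZMod q) := fun hn => cA_apply χ hn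
  constructor
  · rw [DirichletCharacter.LFunction_eq_LSeries _ hs]
    exact LSeries_congr h s
  · rw [LSeriesSummable_congr s h]
    exact DirichletCharacter.LSeriesSummable_of_one_lt_re χ hs

theorem LSeries_mulA {f g : ArithmeticFunction ℂ} {s : ℂ} (hf : LSeriesSummable f s)
    (hg : LSeriesSummable g s) : LSeries (f * g : ArithmeticFunction ℂ) s =
      LSeries f s * LSeries g s ∧ LSeriesSummable (f * g : ArithmeticFunction ℂ) s := by
  rw [← ArithmeticFunction.coe_mul]
  exact ⟨LSeries_convolution' hf hg, hf.convolution hg⟩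

/-- coefficients of the product of four L-functions -/
noncomputable def a4 {q : ℕ} (ψ₁ ψ₂ : DirichletCharacter ℂ q) : ArithmeticFunction ℂ :=
  cA (1 : DirichletCharacter ℂ q) * cA ψ₁ * cA ψ₂ * cA (ψ₁ * ψ₂)

theorem dA_a4 {q : ℕ} (ψ₁ ψ₂ : DirichletCharacter ℂ q) :
    dA (a4 ψ₁ ψ₂) = (lA (1 : DirichletCharacter ℂ q) + lA ψ₁ + lA ψ₂ + lA (ψ₁ * ψ₂)) * a4 ψ₁ ψ₂ := by
  rw [a4, dA_mul, dA_mul, dA_mul, dA_cA, dA_cA, dA_cA, dA_cA]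
  ring

theorem a4_one {q : ℕ} (ψ₁ ψ₂ : DirichletCharacter ℂ q) : a4 ψ₁ ψ₂ 1 = 1 := by
  simp only [a4, ArithmeticFunction.mul_apply_one, cA_apply _ one_ne_zero]
  simp

theorem quad_val {q : ℕ} {ψ : DirichletCharacter ℂ q} (h : ψ ^ 2 = 1) {x : ZMod q} (hx : IsUnit x) :
    ψ x = 1 ∨ ψ x = -1 := by
  have : ψ x ^ 2 = 1 := by
    rw [← MulChar.pow_apply' _ two_ne_zero, h, MulChar.one_apply hx]
  have h3 : (ψ x - 1) * (ψ x + 1) = 0 := by linear_combination this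
  rcases mul_eq_zero.mp h3 with h4 | h4
  · exact .inl (by linear_combination h4)
  · exact .inr (by linear_combination h4)

theorem quad_nonneg {q : ℕ} {ψ₁ ψ₂ : DirichletCharacter ℂ q} (h1 : ψ₁ ^ 2 = 1) (h2 : ψ₂ ^ 2 = 1)
    (n : ℕ) : 0 ≤ (lA (1 : DirichletCharacter ℂ q) + lA ψ₁ + lA ψ₂ + lA (ψ₁ * ψ₂)) n := by
  simp only [ArithmeticFunction.add_apply, lA_apply]
  have hΛ : (0 : ℂ) ≤ (ArithmeticFunction.vonMangoldt n : ℂ) := by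
    exact_mod_cast ArithmeticFunction.vonMangoldt_nonneg
  rw [← add_mul, ← add_mul, ← add_mul]
  refine mul_nonneg ?_ hΛ
  by_cases hx : IsUnit (n : ZMod q)
  · rw [MulChar.one_apply hx, MulChar.mul_apply]
    rcases quad_val h1 hx with h | h <;> rcases quad_val h2 hx with h' | h' <;> rw [h, h'] <;>
      norm_num
  · simp [MulChar.map_nonunit _ hx]

theorem a4_nonneg {q : ℕ} {ψ₁ ψ₂ : DirichletCharacter ℂ q} (h1 : ψ₁ ^ 2 = 1) (h2 : ψ₂ ^ 2 = 1)
    (n : ℕ) : 0 ≤ a4 ψ₁ ψ₂ n := by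
  induction n using Nat.strong_induction_on with
  | _ n ih =>
    rcases Nat.lt_or_ge n 2 with h | h
    · interval_cases n
      · simp
      · rw [a4_one]; exact zero_le_one
    · have hd := congrArg (fun f : ArithmeticFunction ℂ => f n) (dA_a4 ψ₁ ψ₂)
      simp only [dA_apply] at hd
      rw [ArithmeticFunction.mul_apply] at hd
      have hpos : 0 ≤ Complex.log n * a4 ψ₁ ψ₂ n := by
        rw [hd]
        refine Finset.sum_nonneg fun p hp => ?_
        obtain ⟨h3, h4⟩ := Nat.mem_divisorsAntidiagonal.mp hp
        by_cases hp1 : p.1 = 1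
        · rw [hp1]
          simp [lA_apply]
        · refine mul_nonneg (quad_nonneg h1 h2 _) (ih _ ?_)
          have h5 : p.1 ≠ 0 := by rintro h; simp [h] at h3; exact h4 h3.symm
          have h6 : p.2 ≠ 0 := by rintro h; simp [h] at h3; exact h4 h3.symm
          have : 2 ≤ p.1 := by omega
          nlinarith [Nat.pos_of_ne_zero h6]
      have hl : 0 < Real.log n := Real.log_pos (by exact_mod_cast h)
      rw [← natCast_log] at hpos
      have h7 : a4 ψ₁ ψ₂ n = ((Real.log n)⁻¹ : ℝ) * ((Real.log n : ℝ) * a4 ψ₁ ψ₂ n) := by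
        rw [← mul_assoc, ← ofReal_mul, inv_mul_cancel₀ hl.ne', ofReal_one, one_mul]
      rw [h7]
      refine mul_nonneg ?_ hpos
      exact_mod_cast (inv_pos.mpr hl).le

/-- The product of four entire functions. -/
noncomputable def H4 {q : ℕ} [NeZero q] (ψ₁ ψ₂ : DirichletCharacter ℂ q) (s : ℂ) : ℂ :=
  Lf (1 : DirichletCharacter ℂ q) s * Lf ψ₁ s * Lf ψ₂ s * Lf (ψ₁ * ψ₂) s

theorem H4_diff {q : ℕ} [NeZero q] (ψ₁ ψ₂ : DirichletCharacter ℂ q) :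
    Differentiable ℂ (H4 ψ₁ ψ₂) :=
  (((Lf_diff _).mul (Lf_diff _)).mul (Lf_diff _)).mul (Lf_diff _)

theorem a4_LSeries {q : ℕ} [NeZero q] {ψ₁ ψ₂ : DirichletCharacter ℂ q} (h1 : ψ₁ ≠ 1)
    (h2 : ψ₂ ≠ 1) (h3 : ψ₁ * ψ₂ ≠ 1) {s : ℂ} (hs : 1 < s.re) :
    LSeries (a4 ψ₁ ψ₂) s = H4 ψ₁ ψ₂ s / (s - 1) ∧ LSeriesSummable (a4 ψ₁ ψ₂) s := by
  obtain ⟨e0, s0⟩ := LSeries_cA (1 : DirichletCharacter ℂ q) hs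
  obtain ⟨e1, s1⟩ := LSeries_cA ψ₁ hs
  obtain ⟨e2, s2⟩ := LSeries_cA ψ₂ hs
  obtain ⟨e3, s3⟩ := LSeries_cA (ψ₁ * ψ₂) hs
  obtain ⟨e4, s4⟩ := LSeries_mulA s0 s1
  obtain ⟨e5, s5⟩ := LSeries_mulA s4 s2
  obtain ⟨e6, s6⟩ := LSeries_mulA s5 s3
  refine ⟨?_, s6⟩
  rw [a4, e6, e5, e4, e0, e1, e2, e3, H4, Lf_ne h1, Lf_ne h2, Lf_ne h3]
  have hs1 : s ≠ 1 := by rintro rfl; simp at hs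
  have := sub_ne_zero.mpr hs1
  rw [Lf_one_apply hs1]
  field_simp

theorem H4_norm_le {q : ℕ} [NeZero q] (ψ₁ ψ₂ : DirichletCharacter ℂ q) {s : ℂ}
    (hs : 1 / 4 ≤ s.re) (hs' : ‖s‖ ≤ 4) : ‖H4 ψ₁ ψ₂ s‖ ≤ (180 * q) ^ 4 := by
  have h : ∀ χ : DirichletCharacter ℂ q, ‖Lf χ s‖ ≤ 180 * q := by
    intro χ
    refine (Lf_norm_le χ hs).trans ?_
    have : (‖s‖ + 2) ^ 2 ≤ 36 := by nlinarith [norm_nonneg s]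
    calc 5 * (q : ℝ) * (‖s‖ + 2) ^ 2 ≤ 5 * q * 36 := by gcongr
      _ = _ := by ring
  rw [H4, norm_mul, norm_mul, norm_mul]
  calc _ ≤ (180 * q : ℝ) * (180 * q) * (180 * q) * (180 * q) := by
        gcongr <;> exact h _
    _ = _ := by ring

end SW

namespace SW

open Complex Metric
open scoped ComplexOrder

theorem iter_inv_two (m : ℕ) (l : ℂ) :
    iteratedDeriv m (fun s : ℂ => l * (s - 1)⁻¹) 2 = l * ((-1) ^ m * m.factorial) := by
  rw [iteratedDeriv_const_mul_field l (fun s : ℂ => (s - 1)⁻¹)]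
  have := congrFun (iteratedDeriv_comp_sub_const (𝕜 := ℂ) m (fun z : ℂ => z⁻¹) 1) 2
  rw [this, iteratedDeriv_eq_iterate]
  have h2 := iter_deriv_inv m (2 - 1 : ℂ)
  rw [show (fun z : ℂ => z⁻¹) = Inv.inv from rfl, h2]
  norm_num

theorem a4_abs {q : ℕ} [NeZero q] {ψ₁ ψ₂ : DirichletCharacter ℂ q} (h1 : ψ₁ ≠ 1)
    (h2 : ψ₂ ≠ 1) (h3 : ψ₁ * ψ₂ ≠ 1) : LSeries.abscissaOfAbsConv (a4 ψ₁ ψ₂) < (2 : ℝ) := by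
  have hs := (a4_LSeries h1 h2 h3 (s := ((3 / 2 : ℝ) : ℂ)) (by norm_num)).2
  refine lt_of_le_of_lt hs.abscissaOfAbsConv_le ?_
  rw [ofReal_re]
  exact_mod_cast (by norm_num : (3 / 2 : ℝ) < 2)

/-- Taylor coefficients at `2` -/
noncomputable def b4 {q : ℕ} (ψ₁ ψ₂ : DirichletCharacter ℂ q) (m : ℕ) : ℂ :=
  (-1) ^ m * iteratedDeriv m (LSeries (a4 ψ₁ ψ₂)) 2 / m.factorial

theorem b4_nonneg {q : ℕ} [NeZero q] {ψ₁ ψ₂ : DirichletCharacter ℂ q} (h1 : ψ₁ ≠ 1)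
    (h2 : ψ₂ ≠ 1) (h3 : ψ₁ * ψ₂ ≠ 1) (hq1 : ψ₁ ^ 2 = 1) (hq2 : ψ₂ ^ 2 = 1) (m : ℕ) :
    0 ≤ (b4 ψ₁ ψ₂ m).re := by
  have h := LSeries.iteratedDeriv_alternating (a := a4 ψ₁ ψ₂) (fun n => a4_nonneg hq1 hq2 n)
    (a4_abs h1 h2 h3) m
  rw [ofReal_ofNat] at h
  have h4 : 0 ≤ b4 ψ₁ ψ₂ m := by
    rw [b4]
    exact div_nonneg h (by exact_mod_cast (Nat.factorial_pos m).le)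
  exact (Complex.le_def.mp h4).1

theorem b4_zero {q : ℕ} [NeZero q] {ψ₁ ψ₂ : DirichletCharacter ℂ q} (h1 : ψ₁ ≠ 1)
    (h2 : ψ₂ ≠ 1) (h3 : ψ₁ * ψ₂ ≠ 1) (hq1 : ψ₁ ^ 2 = 1) (hq2 : ψ₂ ^ 2 = 1) :
    1 ≤ (b4 ψ₁ ψ₂ 0).re := by
  have hs := (a4_LSeries h1 h2 h3 (s := 2) (by norm_num)).2
  simp only [b4, pow_zero, iteratedDeriv_zero, one_mul, Nat.factorial_zero, Nat.cast_one, div_one]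
  have hr : HasSum (fun n => (LSeries.term (a4 ψ₁ ψ₂) 2 n).re) (LSeries (a4 ψ₁ ψ₂) 2).re :=
    Complex.hasSum_re hs.hasSum
  have ht : ∀ n, 0 ≤ (LSeries.term (a4 ψ₁ ψ₂) 2 n).re := by
    intro n
    have := LSeries.term_nonneg (a := a4 ψ₁ ψ₂) (n := n) (a4_nonneg hq1 hq2 n) 2
    rw [ofReal_ofNat] at this
    exact (Complex.le_def.mp this).1
  have := le_hasSum hr 1 (fun n _ => ht n)
  simpa [LSeries.term, a4_one] using this

/-- `(H(s)-H(1))/(s-1)` -/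
noncomputable def D4 {q : ℕ} [NeZero q] (ψ₁ ψ₂ : DirichletCharacter ℂ q) : ℂ → ℂ :=
  dslope (H4 ψ₁ ψ₂) 1

theorem D4_diff {q : ℕ} [NeZero q] (ψ₁ ψ₂ : DirichletCharacter ℂ q) :
    Differentiable ℂ (D4 ψ₁ ψ₂) := by
  have := (Complex.differentiableOn_dslope (f := H4 ψ₁ ψ₂) (s := Set.univ) (c := 1)
    Filter.univ_mem).mpr (H4_diff ψ₁ ψ₂).differentiableOn
  exact differentiableOn_univ.mp this

theorem D4_apply {q : ℕ} [NeZero q] (ψ₁ ψ₂ : DirichletCharacter ℂ q) {s : ℂ} (hs : s ≠ 1) :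
    D4 ψ₁ ψ₂ s = (H4 ψ₁ ψ₂ s - H4 ψ₁ ψ₂ 1) / (s - 1) := by
  rw [D4, dslope_of_ne _ hs, slope_def_field]

theorem D4_iter {q : ℕ} [NeZero q] {ψ₁ ψ₂ : DirichletCharacter ℂ q} (h1 : ψ₁ ≠ 1)
    (h2 : ψ₂ ≠ 1) (h3 : ψ₁ * ψ₂ ≠ 1) (m : ℕ) :
    (m.factorial : ℂ)⁻¹ * iteratedDeriv m (D4 ψ₁ ψ₂) 2 =
      (-1) ^ m * (b4 ψ₁ ψ₂ m - H4 ψ₁ ψ₂ 1) := by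
  have he : LSeries (a4 ψ₁ ψ₂) =ᶠ[nhds 2]
      (D4 ψ₁ ψ₂ + fun s : ℂ => H4 ψ₁ ψ₂ 1 * (s - 1)⁻¹) := by
    filter_upwards [(isOpen_half 1).mem_nhds (by simp : (2 : ℂ) ∈ {s : ℂ | 1 < s.re})] with s hs
    have hs1 : s ≠ 1 := by rintro rfl; simp at hs
    rw [(a4_LSeries h1 h2 h3 hs).1, Pi.add_apply, D4_apply _ _ hs1]
    ring
  have h4 := he.iteratedDeriv_eq m
  rw [iteratedDeriv_add, iter_inv_two] at h4
  · have hm : (m.factorial : ℂ) ≠ 0 := by exact_mod_cast (Nat.factorial_pos m).ne'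
    have hp : ((-1 : ℂ) ^ m) * (-1) ^ m = 1 := by rw [← mul_pow]; simp
    rw [b4, h4]
    field_simp
    linear_combination (-iteratedDeriv m (D4 ψ₁ ψ₂) 2) * hp +
      (H4 ψ₁ ψ₂ 1 * m.factorial) * (-(-1) ^ m) * hp
  · exact (D4_diff ψ₁ ψ₂).contDiff.contDiffAt
  · refine contDiffAt_const.mul (ContDiffAt.inv (by fun_prop) (by norm_num))

theorem D4_bound {q : ℕ} [NeZero q] (ψ₁ ψ₂ : DirichletCharacter ℂ q) (m : ℕ) :
    ‖(m.factorial : ℂ)⁻¹ * iteratedDeriv m (D4 ψ₁ ψ₂) 2‖ ≤ 6 * (180 * q) ^ 4 * (3 / 4) ^ m := by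
  have hb : ∀ z ∈ sphere (2 : ℂ) (4 / 3), ‖D4 ψ₁ ψ₂ z‖ ≤ 6 * (180 * q) ^ 4 := by
    intro z hz
    rw [mem_sphere_iff_norm] at hz
    have hz1 : 1 / 3 ≤ ‖z - 1‖ := by
      have : ‖z - 2‖ ≤ ‖z - 1‖ + ‖(1 : ℂ)‖ := by
        rw [show z - 2 = (z - 1) - 1 by ring]; exact norm_sub_le _ _
      rw [norm_one, hz] at this; linarith
    have hne : z ≠ 1 := by rintro rfl; norm_num at hz1
    have hz2 : ‖z‖ ≤ 4 := by
      have : ‖z‖ ≤ ‖z - 2‖ + ‖(2 : ℂ)‖ := by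
        nth_rewrite 1 [show z = (z - 2) + 2 by ring]; exact norm_add_le _ _
      rw [hz, Complex.norm_ofNat] at this; linarith
    have hz3 : 1 / 4 ≤ z.re := by
      have := (abs_le.mp ((abs_re_le_norm (z - 2)).trans hz.le)).1
      simp at this; linarith
    rw [D4_apply _ _ hne, norm_div, div_le_iff₀ (by linarith)]
    have e1 := H4_norm_le ψ₁ ψ₂ hz3 hz2
    have e2 := H4_norm_le ψ₁ ψ₂ (s := 1) (by norm_num) (by norm_num)
    have e3 := norm_sub_le (H4 ψ₁ ψ₂ z) (H4 ψ₁ ψ₂ 1)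
    have : 6 * (180 * (q : ℝ)) ^ 4 * (1 / 3) ≤ 6 * (180 * (q : ℝ)) ^ 4 * ‖z - 1‖ := by gcongr
    linarith
  have h := Complex.norm_iteratedDeriv_le_of_forall_mem_sphere_norm_le m (by norm_num)
    (D4_diff ψ₁ ψ₂).diffContOnCl hb
  rw [norm_mul, norm_inv, Complex.norm_natCast]
  have hm : (0 : ℝ) < m.factorial := by exact_mod_cast Nat.factorial_pos m
  rw [inv_mul_le_iff₀ hm]
  refine h.trans (le_of_eq ?_)
  rw [show (3 / 4 : ℝ) = (4 / 3)⁻¹ by norm_num, inv_pow]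
  field_simp

theorem estermann_aux {q : ℕ} [NeZero q] {ψ₁ ψ₂ : DirichletCharacter ℂ q} (h1 : ψ₁ ≠ 1)
    (h2 : ψ₂ ≠ 1) (h3 : ψ₁ * ψ₂ ≠ 1) (hq1 : ψ₁ ^ 2 = 1) (hq2 : ψ₂ ^ 2 = 1) {β : ℝ}
    (hβ : 7 / 8 ≤ β) (hβ1 : β < 1) (hH : 0 ≤ (H4 ψ₁ ψ₂ β).re) {M : ℕ} (hM0 : 0 < M)
    (hM : 12.8 * (6 * (180 * (q : ℝ)) ^ 4) ≤ (32 / 27) ^ M) :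
    (1 - β) / 2 ≤ (H4 ψ₁ ψ₂ 1).re * (2 - β) ^ M := by
  set l := (H4 ψ₁ ψ₂ 1).re with hl
  set K : ℝ := 6 * (180 * (q : ℝ)) ^ 4 with hK
  have hK0 : 0 ≤ K := by positivity
  set t : ℕ → ℝ := fun m => (2 - β) ^ m * ((b4 ψ₁ ψ₂ m).re - l) with ht
  have hsum : HasSum t (D4 ψ₁ ψ₂ β).re := by
    have h := Complex.hasSum_re
      (Complex.hasSum_taylorSeries_of_entire (D4_diff ψ₁ ψ₂) 2 (β : ℂ))
    refine h.congr_fun ?_ |> fun x => x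
    intro m
    have e : (m.factorial : ℂ)⁻¹ • ((β : ℂ) - 2) ^ m • iteratedDeriv m (D4 ψ₁ ψ₂) 2 =
        (((2 - β) ^ m : ℝ) : ℂ) * (b4 ψ₁ ψ₂ m - H4 ψ₁ ψ₂ 1) := by
      rw [smul_eq_mul, smul_eq_mul, mul_left_comm, D4_iter h1 h2 h3, ← mul_assoc, ← mul_pow]
      push_cast; congr 2; ring
    rw [e, re_ofReal_mul, sub_re]
  have hbd : ∀ m, |t m| ≤ K * (27 / 32) ^ m := by
    intro m
    have e := D4_bound ψ₁ ψ₂ m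
    rw [D4_iter h1 h2 h3, norm_mul, norm_pow, norm_neg, norm_one, one_pow, one_mul] at e
    have e2 := (abs_re_le_norm (b4 ψ₁ ψ₂ m - H4 ψ₁ ψ₂ 1)).trans e
    rw [sub_re] at e2
    rw [ht, abs_mul, abs_of_nonneg (pow_nonneg (by linarith) m)]
    calc (2 - β) ^ m * |(b4 ψ₁ ψ₂ m).re - (H4 ψ₁ ψ₂ 1).re| ≤ (9 / 8) ^ m * (K * (3 / 4) ^ m) := by
          gcongr
          · linarith
          · linarith
      _ = K * ((9 / 8) * (3 / 4)) ^ m := by rw [mul_pow]; ring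
      _ = _ := by norm_num
  have hgeo : HasSum (fun m : ℕ => K * (27 / 32 : ℝ) ^ (m + M)) (K * (27 / 32) ^ M * (32 / 5)) := by
    have := (hasSum_geometric_of_lt_one (r := (27 / 32 : ℝ)) (by norm_num) (by norm_num)).mul_left
      (K * (27 / 32) ^ M)
    rw [show (1 - 27 / 32 : ℝ)⁻¹ = 32 / 5 by norm_num] at this
    refine this.congr_fun ?_ |> fun x => x
    intro m; rw [pow_add]; ring
  have htail : -(K * (27 / 32) ^ M * (32 / 5)) ≤ ∑' m, t (m + M) := by
    have hs2 : Summable fun m => t (m + M) := (summable_nat_add_iff M).mpr hsum.summable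
    have := tsum_of_norm_bounded (f := fun m => t (m + M)) hgeo (fun m => hbd (m + M))
    rw [Real.norm_eq_abs] at this
    exact (abs_le.mp this).1
  have hhead : 1 - l * ∑ m ∈ range M, (2 - β) ^ m ≤ ∑ m ∈ range M, t m := by
    obtain ⟨k, rfl⟩ : ∃ k, M = k + 1 := ⟨M - 1, by omega⟩
    have e1 : ∀ m, -(l * (2 - β) ^ m) ≤ t m := by
      intro m
      have := b4_nonneg h1 h2 h3 hq1 hq2 m
      have hp : 0 ≤ (2 - β) ^ m := pow_nonneg (by linarith) m
      simp only [ht]; nlinarith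
    have e2 : 1 - l * (2 - β) ^ 0 ≤ t 0 := by
      have := b4_zero h1 h2 h3 hq1 hq2
      simp only [ht, pow_zero]; linarith
    rw [Finset.sum_range_succ', Finset.sum_range_succ', mul_add]
    have e3 : -(l * ∑ m ∈ range k, (2 - β) ^ (m + 1)) ≤ ∑ m ∈ range k, t (m + 1) := by
      rw [Finset.mul_sum, ← Finset.sum_neg_distrib]
      exact Finset.sum_le_sum fun m _ => e1 (m + 1)
    linarith
  have hD : (D4 ψ₁ ψ₂ β).re = ∑ m ∈ range M, t m + ∑' m, t (m + M) := by
    rw [← hsum.tsum_eq]; exact (hsum.summable.sum_add_tsum_nat_add M).symm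
  have hD2 : (D4 ψ₁ ψ₂ β).re * (1 - β) ≤ l := by
    have hne : (β : ℂ) ≠ 1 := by exact_mod_cast hβ1.ne
    have e : D4 ψ₁ ψ₂ β * ((1 - β : ℝ) : ℂ) = H4 ψ₁ ψ₂ 1 - H4 ψ₁ ψ₂ β := by
      rw [D4_apply _ _ hne]
      have : (β : ℂ) - 1 ≠ 0 := sub_ne_zero.mpr hne
      push_cast
      field_simp
      ring
    have e2 := congrArg Complex.re e
    rw [re_mul_ofReal, sub_re] at e2
    rw [e2]; linarith
  have hg : (∑ m ∈ range M, (2 - β) ^ m) * (1 - β) = (2 - β) ^ M - 1 := by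
    have := geom_sum_mul (2 - β) M
    rw [← this]; ring
  have hT : K * (27 / 32) ^ M * (32 / 5) ≤ 1 / 2 := by
    have e : (27 / 32 : ℝ) ^ M * (32 / 27) ^ M = 1 := by rw [← mul_pow]; norm_num
    have e2 : (27 / 32 : ℝ) ^ M * (12.8 * K) ≤ 1 := by
      rw [← e]; gcongr
    norm_num at e2
    linarith
  have h0 : 0 < 1 - β := by linarith
  have hfin : 1 - l * ∑ m ∈ range M, (2 - β) ^ m - 1 / 2 ≤ (D4 ψ₁ ψ₂ β).re := by rw [hD]; linarith
  have := mul_le_mul_of_nonneg_right hfin h0.le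
  have e5 : (1 - l * ∑ m ∈ range M, (2 - β) ^ m - 1 / 2) * (1 - β) =
      (1 - β) / 2 - l * ((2 - β) ^ M - 1) := by rw [← hg]; ring
  rw [e5] at this
  linarith

theorem estermann : ∃ A : ℝ, 0 < A ∧ ∃ c : ℝ, 0 < c ∧ ∀ (q : ℕ) [NeZero q]
    (ψ₁ ψ₂ : DirichletCharacter ℂ q), ψ₁ ≠ 1 → ψ₂ ≠ 1 → ψ₁ * ψ₂ ≠ 1 → ψ₁ ^ 2 = 1 → ψ₂ ^ 2 = 1 →
    ∀ β : ℝ, 7 / 8 ≤ β → β < 1 → 0 ≤ (H4 ψ₁ ψ₂ β).re →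
    c * (1 - β) * (q : ℝ) ^ (-(A * (1 - β))) ≤ (H4 ψ₁ ψ₂ 1).re := by
  set L := Real.log (32 / 27) with hL
  have hLpos : 0 < L := Real.log_pos (by norm_num)
  set K0 : ℝ := 12.8 * (6 * 180 ^ 4) with hK0
  have hK01 : 1 ≤ K0 := by rw [hK0]; norm_num
  set E := Real.log K0 / L + 1 with hE
  have hE0 : 0 < E := by
    have := Real.log_nonneg hK01
    positivity
  refine ⟨4 / L, by positivity, Real.exp (-E) / 2, by positivity, ?_⟩
  intro q _ ψ₁ ψ₂ h1 h2 h3 hq1 hq2 β hβ hβ1 hH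
  have hq : (1 : ℝ) ≤ q := by exact_mod_cast NeZero.one_le
  have hq0 : (0 : ℝ) < q := by linarith
  set Y := Real.log (K0 * q ^ 4) / L with hY
  have hKq : 1 ≤ K0 * (q : ℝ) ^ 4 := by
    have : (1 : ℝ) ≤ (q : ℝ) ^ 4 := one_le_pow₀ hq
    nlinarith
  have hY0 : 0 ≤ Y := div_nonneg (Real.log_nonneg hKq) hLpos.le
  set M := ⌊Y⌋₊ + 1 with hM
  have hM1 : Y ≤ M := by rw [hM]; push_cast; exact (Nat.lt_floor_add_one Y).le
  have hM2 : (M : ℝ) ≤ Y + 1 := by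
    rw [hM]; push_cast; linarith [Nat.floor_le hY0]
  have key := estermann_aux h1 h2 h3 hq1 hq2 hβ hβ1 hH (M := M) (by omega) (by
    have e : 12.8 * (6 * (180 * (q : ℝ)) ^ 4) = K0 * q ^ 4 := by rw [hK0]; ring
    rw [e, ← Real.log_le_log_iff (by linarith) (by positivity), Real.log_pow, ← hL]
    rw [hY, div_le_iff₀ hLpos] at hM1
    exact hM1)
  have hu : (2 - β) ^ M ≤ Real.exp ((1 - β) * (Y + 1)) := by
    have e1 : 2 - β ≤ Real.exp (1 - β) := by
      have := Real.add_one_le_exp (1 - β); linarith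
    calc (2 - β) ^ M ≤ Real.exp (1 - β) ^ M := by gcongr; linarith
      _ = Real.exp ((1 - β) * M) := by rw [← Real.exp_nat_mul]; ring_nf
      _ ≤ _ := by gcongr
  have hl0 : 0 < (H4 ψ₁ ψ₂ 1).re := by
    by_contra hneg
    push Not at hneg
    have : (H4 ψ₁ ψ₂ 1).re * (2 - β) ^ M ≤ 0 :=
      mul_nonpos_of_nonpos_of_nonneg hneg (pow_nonneg (by linarith) _)
    linarith
  have k2 : (1 - β) / 2 ≤ (H4 ψ₁ ψ₂ 1).re * Real.exp ((1 - β) * (Y + 1)) :=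
    key.trans (by gcongr)
  have hYe : Y + 1 = E + 4 / L * Real.log q := by
    rw [hY, hE, Real.log_mul (by positivity) (by positivity), Real.log_pow]
    push_cast; field_simp; ring
  have k3 : Real.exp (-((1 - β) * (Y + 1))) * ((1 - β) / 2) ≤ (H4 ψ₁ ψ₂ 1).re := by
    rw [Real.exp_neg, inv_mul_le_iff₀ (Real.exp_pos _)]; linarith
  refine le_trans ?_ k3
  rw [Real.rpow_def_of_pos hq0]
  have e6 : Real.exp (-E) ≤ Real.exp (-((1 - β) * E)) := by
    gcongr; nlinarith
  have e7 : Real.exp (-((1 - β) * (Y + 1))) =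
      Real.exp (-((1 - β) * E)) * Real.exp (Real.log q * -(4 / L * (1 - β))) := by
    rw [← Real.exp_add, hYe]; congr 1; ring
  rw [e7]
  calc Real.exp (-E) / 2 * (1 - β) * Real.exp (Real.log q * -(4 / L * (1 - β)))
      = Real.exp (-E) * (Real.exp (Real.log q * -(4 / L * (1 - β))) * ((1 - β) / 2)) := by ring
    _ ≤ Real.exp (-((1 - β) * E)) * (Real.exp (Real.log q * -(4 / L * (1 - β))) * ((1 - β) / 2)) := by
        refine mul_le_mul_of_nonneg_right e6 ?_
        have : 0 ≤ (1 - β) / 2 := by linarith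
        positivity
    _ = _ := by ring

end SW

namespace SW

open Complex Metric
open scoped ComplexOrder

theorem sieg_upper {q : ℕ} [NeZero q] {χ : DirichletCharacter ℂ q} (hχ : χ ≠ 1) {κ : ℝ} (hκ : 0 < κ)
    (hκ1 : κ ≤ 1) {s : ℂ} (hs : ‖s - 1‖ ≤ κ / 2) : ‖Lf χ s‖ ≤ 4 * (q : ℝ) ^ κ / κ := by
  rw [Lf_ne hχ]
  have h1 : |(s - 1).re| ≤ ‖s - 1‖ := abs_re_le_norm _
  rw [sub_re, one_re] at h1
  have h2 := (abs_le.1 h1).1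
  have h3 : ‖s‖ ≤ ‖s - 1‖ + 1 := by
    have := norm_add_le (s - 1) 1
    simpa using this
  refine (LFunction_norm_le hχ hκ.le hκ1 (s := s) (by linarith)).trans ?_
  have hq : 0 ≤ (q : ℝ) ^ κ := by positivity
  calc ‖s‖ * ((q : ℝ) ^ κ / (s.re - (1 - κ))) ≤ 2 * ((q : ℝ) ^ κ / (κ / 2)) := by
        have hp : 0 < s.re - (1 - κ) := by linarith
        gcongr
        · linarith
        · linarith
    _ = _ := by field_simp; ring

theorem sieg_zero {q : ℕ} [NeZero q] {χ : DirichletCharacter ℂ q} (hχ : χ ≠ 1) {κ : ℝ} (hκ : 0 < κ)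
    (hκ1 : κ ≤ 1) {s : ℂ} (hs : ‖s - 1‖ ≤ κ / 4) (h0 : Lf χ s = 0) :
    ‖Lf χ 1‖ ≤ 16 * (q : ℝ) ^ κ / κ ^ 2 * ‖s - 1‖ := by
  have hd : ∀ z ∈ closedBall (1 : ℂ) (κ / 4), ‖deriv (Lf χ) z‖ ≤ 16 * (q : ℝ) ^ κ / κ ^ 2 := by
    intro z hz
    have := Complex.norm_deriv_le_of_forall_mem_sphere_norm_le (c := z) (R := κ / 4)
      (C := 4 * (q : ℝ) ^ κ / κ) (f := Lf χ) (by positivity) (Lf_diff χ).diffContOnCl ?_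
    · refine this.trans (le_of_eq ?_)
      field_simp; ring
    · intro w hw
      apply sieg_upper hχ hκ hκ1
      rw [mem_sphere, dist_eq_norm] at hw
      rw [mem_closedBall, dist_eq_norm] at hz
      calc ‖w - 1‖ = ‖(w - z) + (z - 1)‖ := by ring_nf
        _ ≤ _ := norm_add_le _ _
        _ ≤ κ / 2 := by linarith
  have := (convex_closedBall (1 : ℂ) (κ / 4)).norm_image_sub_le_of_norm_deriv_le (f := Lf χ)
    (x := s) (y := 1) (fun z _ => (Lf_diff χ) z) hd
    (by rwa [mem_closedBall, dist_eq_norm]) (mem_closedBall_self (by positivity))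
  rwa [h0, sub_zero, norm_sub_rev] at this

theorem Zf_one : Lf (1 : DirichletCharacter ℂ 1) 1 = 1 := by
  rw [Zf_eq (by norm_num)]; simp

theorem Lf_one_one_le (q : ℕ) [NeZero q] : ‖Lf (1 : DirichletCharacter ℂ q) 1‖ ≤ 1 := by
  rw [Lf_one_eq_mul, Zf_one, mul_one, norm_prod]
  apply Finset.prod_le_one
  · intros; positivity
  · intro p hp
    have hp := (Nat.prime_of_mem_primeFactors hp).two_le
    have hp' : (2 : ℝ) ≤ p := by exact_mod_cast hp
    rw [show (1 : ℂ) - (p : ℂ) ^ (-1 : ℂ) = ((1 - (p : ℝ)⁻¹ : ℝ) : ℂ) by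
      rw [cpow_neg_one]; push_cast; ring]
    rw [norm_real, Real.norm_eq_abs, abs_le]
    have : (p : ℝ)⁻¹ ≤ 1 := inv_le_one_of_one_le₀ (by linarith)
    have h2 : 0 ≤ (p : ℝ)⁻¹ := by positivity
    constructor <;> linarith

/-- core of Siegel -/
theorem sieg_core : ∃ A : ℝ, 0 < A ∧ ∀ ε : ℝ, 0 < ε → ε ≤ 1 → ∀ β : ℝ, 7 / 8 ≤ β → β < 1 →
    A * (1 - β) ≤ ε / 2 → ∃ c : ℝ, 0 < c ∧
    ∀ (q : ℕ) [NeZero q] (ψ₁ ψ₂ : DirichletCharacter ℂ q), ψ₁ ≠ 1 → ψ₂ ≠ 1 → ψ₁ * ψ₂ ≠ 1 →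
    ψ₁ ^ 2 = 1 → ψ₂ ^ 2 = 1 → 0 ≤ (H4 ψ₁ ψ₂ β).re → ∀ s : ℂ, Lf ψ₂ s = 0 →
    c * (q : ℝ) ^ (-ε) ≤ ‖s - 1‖ := by
  obtain ⟨A, hA, c, hc, h⟩ := estermann
  refine ⟨A, hA, fun ε hε hε1 β hβ hβ1 hAβ => ?_⟩
  set κ := ε / 6 with hκ
  have hκ0 : 0 < κ := by positivity
  have hκ1 : κ ≤ 1 := by linarith
  have hβ' : 0 < 1 - β := by linarith
  refine ⟨min (κ / 4) (c * (1 - β) * κ ^ 4 / 256), by positivity, ?_⟩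
  intro q _ ψ₁ ψ₂ h1 h2 h3 hq1 hq2 hH s hs
  have hq : (1 : ℝ) ≤ q := by exact_mod_cast NeZero.one_le
  have hq0 : (0 : ℝ) < q := by linarith
  have hqε : (q : ℝ) ^ (-ε) ≤ 1 := Real.rpow_le_one_of_one_le_of_nonpos hq (by linarith)
  have hqε0 : 0 < (q : ℝ) ^ (-ε) := by positivity
  rcases lt_or_ge (κ / 4) ‖s - 1‖ with hc1 | hc1
  · calc _ ≤ κ / 4 * 1 := by gcongr; exact min_le_left _ _
      _ ≤ _ := by linarith
  have e1 := h q ψ₁ ψ₂ h1 h2 h3 hq1 hq2 β hβ hβ1 hH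
  have e2 : (H4 ψ₁ ψ₂ 1).re ≤ ‖H4 ψ₁ ψ₂ 1‖ := re_le_norm _
  have u1 := sieg_upper h1 hκ0 hκ1 (s := 1) (by simp; positivity)
  have u3 := sieg_upper h3 hκ0 hκ1 (s := 1) (by simp; positivity)
  have u2 := sieg_zero h2 hκ0 hκ1 hc1 hs
  have e3 : ‖H4 ψ₁ ψ₂ 1‖ ≤ 1 * (4 * (q : ℝ) ^ κ / κ) * (16 * (q : ℝ) ^ κ / κ ^ 2 * ‖s - 1‖) *
      (4 * (q : ℝ) ^ κ / κ) := by
    rw [H4, norm_mul, norm_mul, norm_mul]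
    gcongr
    exact Lf_one_one_le q
  have e4 : c * (1 - β) * (q : ℝ) ^ (-(ε / 2)) ≤ 256 * ((q : ℝ) ^ κ) ^ 3 / κ ^ 4 * ‖s - 1‖ := by
    calc c * (1 - β) * (q : ℝ) ^ (-(ε / 2)) ≤ c * (1 - β) * (q : ℝ) ^ (-(A * (1 - β))) := by
          gcongr
      _ ≤ _ := (e1.trans e2).trans e3
      _ = _ := by ring
  have e5 : (q : ℝ) ^ (-ε) * ((q : ℝ) ^ κ) ^ 3 = (q : ℝ) ^ (-(ε / 2)) := by
    rw [← Real.rpow_natCast, ← Real.rpow_mul hq0.le, ← Real.rpow_add hq0]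
    congr 1
    push_cast
    rw [hκ]; ring
  have hX : 0 < ((q : ℝ) ^ κ) ^ 3 := by positivity
  rw [← e5] at e4
  have e6 : c * (1 - β) * (q : ℝ) ^ (-ε) ≤ 256 / κ ^ 4 * ‖s - 1‖ := by
    refine le_of_mul_le_mul_right (a := ((q : ℝ) ^ κ) ^ 3) ?_ hX
    calc _ = _ := by rw [mul_assoc]
      _ ≤ _ := e4
      _ = _ := by ring
  calc _ ≤ (c * (1 - β) * κ ^ 4 / 256) * (q : ℝ) ^ (-ε) := by gcongr; exact min_le_right _ _
    _ = κ ^ 4 / 256 * (c * (1 - β) * (q : ℝ) ^ (-ε)) := by ring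
    _ ≤ κ ^ 4 / 256 * (256 / κ ^ 4 * ‖s - 1‖) := by gcongr
    _ = ‖s - 1‖ := by field_simp

theorem euler_ne {p : ℕ} (hp : p.Prime) {s : ℂ} (hs : 0 < s.re) {z : ℂ} (hz : ‖z‖ ≤ 1) :
    1 - z * (p : ℂ) ^ (-s) ≠ 0 := by
  intro h
  have h1 : ‖z * (p : ℂ) ^ (-s)‖ = 1 := by
    rw [← sub_eq_zero.1 h, norm_one]
  rw [norm_mul, Complex.norm_natCast_cpow_of_pos hp.pos] at h1
  have : (p : ℝ) ^ (-s).re < 1 :=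
    Real.rpow_lt_one_of_one_lt_of_neg (by exact_mod_cast hp.one_lt) (by simpa using hs)
  have h3 : 0 ≤ (p : ℝ) ^ (-s).re := by positivity
  nlinarith [norm_nonneg z]

/-- zeros of principal characters near 1 -/
theorem Zf_near : ∃ δ : ℝ, 0 < δ ∧ δ ≤ 1 / 2 ∧ ∀ (q : ℕ) [NeZero q] (s : ℂ), ‖s - 1‖ < δ →
    Lf (1 : DirichletCharacter ℂ q) s ≠ 0 := by
  have hc : ContinuousAt (Lf (1 : DirichletCharacter ℂ 1)) 1 := (Lf_diff _).continuous.continuousAt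
  have := hc.eventually_ne (y := 0) (by rw [Zf_one]; norm_num)
  rw [Metric.eventually_nhds_iff] at this
  obtain ⟨d, hd, h⟩ := this
  refine ⟨min d (1 / 2), by positivity, min_le_right _ _, fun q _ s hs => ?_⟩
  rw [lt_min_iff] at hs
  rw [Lf_one_eq_mul]
  refine mul_ne_zero ?_ (h (by rw [dist_eq_norm]; exact hs.1))
  rw [Finset.prod_ne_zero_iff]
  intro p hp
  have h1 : |(s - 1).re| ≤ ‖s - 1‖ := abs_re_le_norm _
  rw [sub_re, one_re] at h1
  have h2 := (abs_le.1 h1).1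
  have := euler_ne (Nat.prime_of_mem_primeFactors hp) (s := s) (by linarith) (z := 1) (by simp)
  simpa using this

theorem H4_pos {q : ℕ} [NeZero q] {ψ₁ ψ₂ : DirichletCharacter ℂ q} (h1 : ψ₁ ≠ 1)
    (h2 : ψ₂ ≠ 1) (h3 : ψ₁ * ψ₂ ≠ 1) (hq1 : ψ₁ ^ 2 = 1) (hq2 : ψ₂ ^ 2 = 1) {x : ℝ} (hx : 1 < x) :
    0 < H4 ψ₁ ψ₂ x := by
  have habs : LSeries.abscissaOfAbsConv (a4 ψ₁ ψ₂) < (x : ℝ) := by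
    have hs := (a4_LSeries h1 h2 h3 (s := (((1 + x) / 2 : ℝ) : ℂ)) (by rw [ofReal_re]; linarith)).2
    refine lt_of_le_of_lt hs.abscissaOfAbsConv_le ?_
    rw [ofReal_re]
    exact_mod_cast (by linarith : (1 + x) / 2 < x)
  have h := LSeries.positive (a := a4 ψ₁ ψ₂) (fun n => a4_nonneg hq1 hq2 n)
    (by rw [a4_one]; exact zero_lt_one) habs
  rw [(a4_LSeries h1 h2 h3 (s := (x : ℂ)) (by rwa [ofReal_re])).1] at h
  have hx1 : (0 : ℂ) < (x : ℂ) - 1 := by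
    have : (0 : ℝ) < x - 1 := by linarith
    exact_mod_cast this
  have := mul_pos h hx1
  rwa [div_mul_cancel₀ _ hx1.ne'] at this

theorem H4_real {q : ℕ} [NeZero q] {ψ₁ ψ₂ : DirichletCharacter ℂ q} (h1 : ψ₁ ≠ 1)
    (h2 : ψ₂ ≠ 1) (h3 : ψ₁ * ψ₂ ≠ 1) (hq1 : ψ₁ ^ 2 = 1) (hq2 : ψ₂ ^ 2 = 1) (x : ℝ) :
    (H4 ψ₁ ψ₂ x).im = 0 := by
  set g : ℂ → ℂ := fun s => (starRingEnd ℂ) (H4 ψ₁ ψ₂ ((starRingEnd ℂ) s)) with hg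
  have hgd : Differentiable ℂ g := by
    intro s
    have := (H4_diff ψ₁ ψ₂ ((starRingEnd ℂ) s)).conj_conj
    rw [Complex.conj_conj] at this
    exact this
  have heq : g = H4 ψ₁ ψ₂ := by
    have ha : AnalyticOnNhd ℂ g Set.univ := hgd.differentiableOn.analyticOnNhd isOpen_univ
    have hb : AnalyticOnNhd ℂ (H4 ψ₁ ψ₂) Set.univ :=
      (H4_diff ψ₁ ψ₂).differentiableOn.analyticOnNhd isOpen_univ
    refine ha.eq_of_frequently_eq hb (z₀ := ((2 : ℝ) : ℂ)) ?_
    have hT : Filter.Tendsto (fun x : ℝ => (x : ℂ)) (nhdsWithin 2 {2}ᶜ)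
        (nhdsWithin ((2 : ℝ) : ℂ) {((2 : ℝ) : ℂ)}ᶜ) := by
      apply tendsto_nhdsWithin_of_tendsto_nhds_of_eventually_within
      · exact (Complex.continuous_ofReal.tendsto 2).mono_left nhdsWithin_le_nhds
      · filter_upwards [self_mem_nhdsWithin] with y hy
        simp only [Set.mem_compl_iff, Set.mem_singleton_iff, Complex.ofReal_inj]
        exact hy
    refine hT.frequently ?_
    apply Filter.Eventually.frequently
    have : ∀ᶠ y : ℝ in nhdsWithin 2 {2}ᶜ, 1 < y :=
      nhdsWithin_le_nhds (lt_mem_nhds (by norm_num : (1 : ℝ) < 2))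
    filter_upwards [this] with y hy
    have hp := H4_pos h1 h2 h3 hq1 hq2 hy
    simp only [hg, Complex.conj_ofReal]
    rw [Complex.conj_eq_iff_im]
    exact (Complex.pos_iff.1 hp).2.symm
  have := congrFun heq x
  simp only [hg, Complex.conj_ofReal] at this
  exact Complex.conj_eq_iff_im.1 this

theorem H4_nonneg {q : ℕ} [NeZero q] {ψ₁ ψ₂ : DirichletCharacter ℂ q} (h1 : ψ₁ ≠ 1)
    (h2 : ψ₂ ≠ 1) (h3 : ψ₁ * ψ₂ ≠ 1) (hq1 : ψ₁ ^ 2 = 1) (hq2 : ψ₂ ^ 2 = 1) {β : ℝ} (hβ : β < 1)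
    (hno : ∀ x : ℝ, β ≤ x → x < 1 → H4 ψ₁ ψ₂ x ≠ 0) : 0 ≤ (H4 ψ₁ ψ₂ β).re := by
  by_contra hlt
  push Not at hlt
  have hc : ContinuousOn (fun x : ℝ => (H4 ψ₁ ψ₂ x).re) (Set.Icc β 2) :=
    (continuous_re.comp ((H4_diff ψ₁ ψ₂).continuous.comp continuous_ofReal)).continuousOn
  have h2p : 0 < (H4 ψ₁ ψ₂ (2 : ℝ)).re := (Complex.pos_iff.1 (H4_pos h1 h2 h3 hq1 hq2 (x := 2) (by norm_num))).1
  obtain ⟨x, hx, hx0⟩ := intermediate_value_Icc (by linarith) hc (⟨hlt.le, h2p.le⟩ :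
    (0 : ℝ) ∈ Set.Icc (H4 ψ₁ ψ₂ β).re (H4 ψ₁ ψ₂ (2 : ℝ)).re)
  have hz : H4 ψ₁ ψ₂ x = 0 := Complex.ext hx0 (H4_real h1 h2 h3 hq1 hq2 x)
  rcases lt_or_ge x 1 with h | h
  · exact hno x hx.1 h hz
  · rw [H4] at hz
    have hne : ∀ χ : DirichletCharacter ℂ q, Lf χ x ≠ 0 := fun χ => Lf_ne_zero χ (by rwa [ofReal_re])
    exact mul_ne_zero (mul_ne_zero (mul_ne_zero (hne _) (hne _)) (hne _)) (hne _) hz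

theorem sieg_one {q₁ : ℕ} [NeZero q₁] {χ₁ : DirichletCharacter ℂ q₁} (h₁ : χ₁ ≠ 1) (hq₁ : χ₁ ^ 2 = 1)
    {ε β c : ℝ} (hε : 0 < ε) (hc : 0 < c)
    (hcore : ∀ (q : ℕ) [NeZero q] (ψ₁ ψ₂ : DirichletCharacter ℂ q), ψ₁ ≠ 1 → ψ₂ ≠ 1 → ψ₁ * ψ₂ ≠ 1 →
      ψ₁ ^ 2 = 1 → ψ₂ ^ 2 = 1 → 0 ≤ (H4 ψ₁ ψ₂ β).re → ∀ s : ℂ, Lf ψ₂ s = 0 →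
      c * (q : ℝ) ^ (-ε) ≤ ‖s - 1‖)
    (hH : ∀ (N : ℕ) [NeZero N] (hd : q₁ ∣ N) (ψ : DirichletCharacter ℂ N), ψ ≠ 1 →
      DirichletCharacter.changeLevel hd χ₁ ≠ 1 →
      DirichletCharacter.changeLevel hd χ₁ * ψ ≠ 1 → (DirichletCharacter.changeLevel hd χ₁) ^ 2 = 1 →
      ψ ^ 2 = 1 → 0 ≤ (H4 (DirichletCharacter.changeLevel hd χ₁) ψ β).re) :
    ∃ c' : ℝ, 0 < c' ∧ ∀ (q : ℕ) [NeZero q] (χ : DirichletCharacter ℂ q), χ ≠ 1 → χ ^ 2 = 1 →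
      ∀ s : ℂ, Lf χ s = 0 → c' * (q : ℝ) ^ (-ε) ≤ ‖s - 1‖ := by
  have hct : ContinuousAt (Lf χ₁) 1 := (Lf_diff _).continuous.continuousAt
  have := hct.eventually_ne (y := 0) (Lf_ne_zero χ₁ (by simp))
  rw [Metric.eventually_nhds_iff] at this
  obtain ⟨d, hd, hne⟩ := this
  have hq1p : (0 : ℝ) < q₁ := by exact_mod_cast Nat.pos_of_ne_zero (NeZero.ne q₁)
  refine ⟨min (min d (1 / 2)) (c * (q₁ : ℝ) ^ (-ε)), by positivity, ?_⟩
  intro q _ χ hχ hχ2 s hs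
  have hq : (1 : ℝ) ≤ q := by exact_mod_cast NeZero.one_le
  have hqε : (q : ℝ) ^ (-ε) ≤ 1 := Real.rpow_le_one_of_one_le_of_nonpos hq (by linarith)
  have hqε0 : 0 < (q : ℝ) ^ (-ε) := by positivity
  rcases le_or_gt (min d (1 / 2)) ‖s - 1‖ with hfar | hnear
  · calc _ ≤ min d (1 / 2) * 1 := mul_le_mul (min_le_left _ _) hqε hqε0.le (by positivity)
      _ ≤ _ := by linarith
  rw [lt_min_iff] at hnear
  have hre : 0 < s.re := by
    have h1 : |(s - 1).re| ≤ ‖s - 1‖ := abs_re_le_norm _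
    rw [sub_re, one_re] at h1
    have h2 := (abs_le.1 h1).1
    linarith
  have : NeZero (q₁ * q) := ⟨mul_ne_zero (NeZero.ne _) (NeZero.ne _)⟩
  set ψ₁ := DirichletCharacter.changeLevel (Dvd.intro q rfl : q₁ ∣ q₁ * q) χ₁ with hψ₁
  set ψ₂ := DirichletCharacter.changeLevel (Dvd.intro_left q₁ rfl : q ∣ q₁ * q) χ with hψ₂
  have e1 : ψ₁ ≠ 1 := fun h => h₁ ((DirichletCharacter.changeLevel_eq_one_iff _).1 h)
  have e2 : ψ₂ ≠ 1 := fun h => hχ ((DirichletCharacter.changeLevel_eq_one_iff _).1 h)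
  have s1 : ψ₁ ^ 2 = 1 := by rw [hψ₁, ← map_pow, hq₁, map_one]
  have s2 : ψ₂ ^ 2 = 1 := by rw [hψ₂, ← map_pow, hχ2, map_one]
  have hz2 : Lf ψ₂ s = 0 := by
    rw [Lf_ne hχ] at hs
    rw [Lf_ne e2, hψ₂, DirichletCharacter.LFunction_changeLevel _ χ (.inl hχ), hs, zero_mul]
  by_cases e3 : ψ₁ * ψ₂ = 1
  · exfalso
    have hEq : ψ₂ = ψ₁ := by
      calc ψ₂ = ψ₁ ^ 2 * ψ₂ := by rw [s1, one_mul]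
        _ = ψ₁ * (ψ₁ * ψ₂) := by rw [sq, mul_assoc]
        _ = ψ₁ := by rw [e3, mul_one]
    rw [hEq, Lf_ne e1, hψ₁, DirichletCharacter.LFunction_changeLevel _ χ₁ (.inl h₁), ← Lf_ne h₁] at hz2
    refine mul_ne_zero (hne (by rw [dist_eq_norm]; exact hnear.1)) ?_ hz2
    rw [Finset.prod_ne_zero_iff]
    intro p hp
    exact euler_ne (Nat.prime_of_mem_primeFactors hp) hre (DirichletCharacter.norm_le_one _ _)
  · have := hcore (q₁ * q) ψ₁ ψ₂ e1 e2 e3 s1 s2 (hH _ _ ψ₂ e2 e1 e3 s1 s2) s hz2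
    refine le_trans ?_ this
    push_cast
    rw [Real.mul_rpow hq1p.le (by linarith), ← mul_assoc]
    gcongr
    exact min_le_right _ _

theorem siegel_nontriv (ε : ℝ) (hε : 0 < ε) (hε1 : ε ≤ 1) : ∃ c : ℝ, 0 < c ∧ ∀ (q : ℕ) [NeZero q]
    (χ : DirichletCharacter ℂ q), χ ≠ 1 → χ ^ 2 = 1 → ∀ s : ℂ, Lf χ s = 0 →
    c * (q : ℝ) ^ (-ε) ≤ ‖s - 1‖ := by
  obtain ⟨A, hA, hcore⟩ := sieg_core
  obtain ⟨δ₀, hδ₀, hδ₀', hZ⟩ := Zf_near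
  set δ := min (δ₀ / 2) (min (1 / 8) (ε / (2 * A))) with hδ
  have hδp : 0 < δ := by positivity
  have d1 : δ ≤ δ₀ / 2 := min_le_left _ _
  have d2 : δ ≤ 1 / 8 := (min_le_right _ _).trans (min_le_left _ _)
  have d3 : δ ≤ ε / (2 * A) := (min_le_right _ _).trans (min_le_right _ _)
  have hAδ : A * δ ≤ ε / 2 := by
    calc A * δ ≤ A * (ε / (2 * A)) := by gcongr
      _ = ε / 2 := by field_simp
  by_cases hA' : ∃ (q : ℕ) (_ : NeZero q) (χ : DirichletCharacter ℂ q), χ ≠ 1 ∧ χ ^ 2 = 1 ∧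
      ∃ x : ℝ, 1 - δ ≤ x ∧ x < 1 ∧ Lf χ x = 0
  · obtain ⟨q₁, _, χ₁, h1, h2, β, hβ, hβ1, hz⟩ := hA'
    have hAβ : A * (1 - β) ≤ ε / 2 := le_trans (by gcongr; linarith) hAδ
    obtain ⟨c, hc, hcc⟩ := hcore ε hε hε1 β (by linarith) hβ1 hAβ
    refine sieg_one h1 h2 hε hc hcc ?_
    intro N _ hd ψ _ hn _ _ _
    rw [H4, Lf_ne hn, DirichletCharacter.LFunction_changeLevel _ χ₁ (.inl h1), ← Lf_ne h1, hz]
    simp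
  · push Not at hA'
    by_cases hE : ∃ (q : ℕ) (_ : NeZero q) (χ : DirichletCharacter ℂ q), χ ≠ 1 ∧ χ ^ 2 = 1
    · obtain ⟨q₁, _, χ₁, h1, h2⟩ := hE
      have hAβ : A * (1 - (1 - δ)) ≤ ε / 2 := by simpa using hAδ
      obtain ⟨c, hc, hcc⟩ := hcore ε hε hε1 (1 - δ) (by linarith) (by linarith) hAβ
      refine sieg_one h1 h2 hε hc hcc ?_
      intro N _ hd ψ hψ hn hn2 sn sψ
      refine H4_nonneg hn hψ hn2 sn sψ (by linarith) ?_
      intro x hx hx1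
      rw [H4]
      refine mul_ne_zero (mul_ne_zero (mul_ne_zero (hZ N x ?_) (hA' N _ _ hn sn x hx hx1))
        (hA' N _ _ hψ sψ x hx hx1)) (hA' N _ _ hn2 (by rw [mul_pow, sn, sψ, one_mul]) x hx hx1)
      rw [show (x : ℂ) - 1 = ((x - 1 : ℝ) : ℂ) by push_cast; rfl, norm_real, Real.norm_eq_abs,
        abs_lt]
      constructor <;> linarith
    · push Not at hE
      exact ⟨1, one_pos, fun q _ χ h1 h2 => absurd h2 (hE q ‹_› χ h1)⟩

theorem siegel (ε : ℝ) (hε : 0 < ε) (hε1 : ε ≤ 1) : ∃ c : ℝ, 0 < c ∧ c ≤ 1 / 2 ∧ ∀ (q : ℕ) [NeZero q]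
    (χ : DirichletCharacter ℂ q), χ ^ 2 = 1 → ∀ s : ℂ, Lf χ s = 0 →
    c * (q : ℝ) ^ (-ε) ≤ ‖s - 1‖ := by
  obtain ⟨c, hc, h⟩ := siegel_nontriv ε hε hε1
  obtain ⟨δ, hδ, hδ', hZ⟩ := Zf_near
  refine ⟨min c δ, by positivity, (min_le_right _ _).trans hδ', fun q _ χ hχ s hs => ?_⟩
  have hq : (1 : ℝ) ≤ q := by exact_mod_cast NeZero.one_le
  have hqε : (q : ℝ) ^ (-ε) ≤ 1 := Real.rpow_le_one_of_one_le_of_nonpos hq (by linarith)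
  have hqε0 : 0 < (q : ℝ) ^ (-ε) := by positivity
  by_cases h1 : χ = 1
  · subst h1
    have : δ ≤ ‖s - 1‖ := by
      by_contra hlt
      exact hZ q s (not_le.1 hlt) hs
    calc _ ≤ δ * 1 := by gcongr; exact min_le_right _ _
      _ ≤ _ := by linarith
  · refine le_trans ?_ (h q χ h1 hχ s hs)
    gcongr
    exact min_le_left _ _
end SW

namespace SW

open Complex Metric

theorem three_four_one_term (z : ℂ) (b : ℝ) (h : (z = 0 ∧ b = 0) ∨ (‖z‖ = 1 ∧ b = 1)) :
    0 ≤ 3 * b + 4 * z.re + (z ^ 2).re := by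
  rcases h with ⟨rfl, rfl⟩ | ⟨h, rfl⟩
  · simp
  · have h1 : z.re ^ 2 + z.im ^ 2 = 1 := by
      have := Complex.sq_norm z
      rw [h, Complex.normSq_apply] at this
      nlinarith
    rw [sq, mul_re]
    nlinarith [sq_nonneg (1 + z.re)]

theorem term_eq_aux (u : ℂ) {n : ℕ} (hn : n ≠ 0) (l : ℝ) (σ t : ℝ) :
    LSeries.term (fun _ => u * (l : ℂ)) (σ + t * I) n =
      ((l * (n : ℝ) ^ (-σ) : ℝ) : ℂ) * (u * (n : ℂ) ^ (-(t * I) : ℂ)) := by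
  rw [LSeries.term_of_ne_zero hn, div_eq_mul_inv, ← cpow_neg, neg_add,
    cpow_add _ _ (by exact_mod_cast hn)]
  push_cast
  rw [Complex.ofReal_cpow (by positivity)]
  push_cast
  ring

theorem three_four_one {q : ℕ} [NeZero q] (χ : DirichletCharacter ℂ q) {σ : ℝ} (hσ : 1 < σ) (t : ℝ) :
    0 ≤ 3 * (LΛ (1 : DirichletCharacter ℂ q) σ).re + 4 * (LΛ χ (σ + t * I)).re +
      (LΛ (χ ^ 2) (σ + (2 * t : ℝ) * I)).re := by
  have hs0 := DirichletCharacter.LSeriesSummable_twist_vonMangoldt (1 : DirichletCharacter ℂ q)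
    (s := (σ + (0 : ℝ) * I)) (by simpa using hσ)
  have hs1 := DirichletCharacter.LSeriesSummable_twist_vonMangoldt χ
    (s := (σ + t * I)) (by simpa using hσ)
  have hs2 := DirichletCharacter.LSeriesSummable_twist_vonMangoldt (χ ^ 2)
    (s := (σ + (2 * t : ℝ) * I)) (by simpa using hσ)
  have h0 := Complex.hasSum_re hs0.hasSum
  have h1 := Complex.hasSum_re hs1.hasSum
  have h2 := Complex.hasSum_re hs2.hasSum
  have H := ((h0.mul_left 3).add (h1.mul_left 4)).add h2
  have e0 : LΛ (1 : DirichletCharacter ℂ q) σ = LΛ (1 : DirichletCharacter ℂ q) (σ + (0 : ℝ) * I) := by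
    simp
  rw [e0]
  refine le_of_le_of_eq ?_ (show _ = _ from H.tsum_eq)
  refine tsum_nonneg fun n => ?_
  rcases eq_or_ne n 0 with rfl | hn
  · simp
  set l : ℝ := ArithmeticFunction.vonMangoldt n
  have hl : 0 ≤ l := ArithmeticFunction.vonMangoldt_nonneg
  have key : ∀ (ψ : DirichletCharacter ℂ q) (u : ℝ),
      LSeries.term ((fun n : ℕ => ψ n) * fun n => ((ArithmeticFunction.vonMangoldt n : ℝ) : ℂ)) (σ + u * I) n =
      ((l * (n : ℝ) ^ (-σ) : ℝ) : ℂ) * (ψ n * (n : ℂ) ^ (-(u * I) : ℂ)) := by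
    intro ψ u
    rw [← term_eq_aux (ψ n) hn l σ u, LSeries.term_of_ne_zero hn, LSeries.term_of_ne_zero hn]
    rfl
  have hnc : (n : ℂ) ≠ 0 := by exact_mod_cast hn
  erw [key 1 0, key χ t, key (χ ^ 2) (2 * t)]
  rw [re_ofReal_mul, re_ofReal_mul, re_ofReal_mul]
  have hz : (χ ^ 2) n * (n : ℂ) ^ (-(((2 * t : ℝ) : ℂ) * I)) = (χ n * (n : ℂ) ^ (-(t * I) : ℂ)) ^ 2 := by
    rw [mul_pow, ← cpow_nat_mul, MulChar.pow_apply' _ two_ne_zero]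
    congr 2
    push_cast; ring
  rw [hz]
  have := three_four_one_term (χ n * (n : ℂ) ^ (-(t * I) : ℂ))
    ((1 : DirichletCharacter ℂ q) n * (n : ℂ) ^ (-(((0 : ℝ) : ℂ) * I))).re ?_
  · have hk : 0 ≤ l * (n : ℝ) ^ (-σ) := by positivity
    nlinarith [mul_nonneg hk this]
  · by_cases hu : IsUnit (n : ZMod q)
    · right
      constructor
      · rw [norm_mul, show ‖χ (n : ZMod q)‖ = 1 from χ.unit_norm_eq_one hu.unit, norm_natCast_cpow_of_pos (Nat.pos_of_ne_zero hn)]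
        simp
      · rw [MulChar.one_apply hu]; simp
    · left
      rw [MulChar.map_nonunit _ hu, MulChar.map_nonunit _ hu]
      simp

theorem Lf_ratio {q : ℕ} [NeZero q] (χ : DirichletCharacter ℂ q) {η T : ℝ} (hη : 0 < η) (hη1 : η ≤ 1 / 2)
    (hT : 0 ≤ T) {c : ℂ} (hc : c.re = 1 + η) (hi : |c.im| ≤ 2 * T) {z : ℂ} (hz : ‖z - c‖ ≤ 1 / 2) :
    ‖Lf χ z‖ ≤ Real.exp (Real.log (20 * q * (2 * T + 5) ^ 2 / η ^ 2)) * ‖Lf χ c‖ := by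
  have hq : (0 : ℝ) < q := by exact_mod_cast Nat.pos_of_ne_zero (NeZero.ne q)
  rw [Real.exp_log (by positivity)]
  have h1 : |(z - c).re| ≤ ‖z - c‖ := abs_re_le_norm _
  rw [sub_re] at h1
  have h2 := (abs_le.1 h1).1
  have h3 : ‖z‖ ≤ ‖z - c‖ + ‖c‖ := by
    have := norm_add_le (z - c) c
    simpa using this
  have h4 : ‖c‖ ≤ |c.re| + |c.im| := norm_le_abs_re_add_abs_im c
  rw [abs_of_pos (by rw [hc]; linarith)] at h4
  have hl := Lf_lower χ (s := c) (by linarith) (by linarith)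
  have hu := Lf_norm_le χ (s := z) (by linarith)
  rw [hc] at hl
  calc ‖Lf χ z‖ ≤ 5 * q * (‖z‖ + 2) ^ 2 := hu
    _ ≤ 5 * q * (2 * T + 5) ^ 2 := by
        have : ‖z‖ + 2 ≤ 2 * T + 5 := by linarith
        exact mul_le_mul_of_nonneg_left (pow_le_pow_left₀ (by positivity) this 2) (by positivity)
    _ = 20 * q * (2 * T + 5) ^ 2 / η ^ 2 * (η ^ 2 / 4) := by field_simp; ring
    _ ≤ _ := by
      gcongr
      calc η ^ 2 / 4 = (1 + η - 1) ^ 2 / 4 := by ring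
        _ ≤ _ := hl

theorem log_inv_le {η : ℝ} (hη : 0 < η) : Real.log (1 / η) ≤ 2 * Real.sqrt (1 / η) := by
  have h := Real.log_le_sub_one_of_pos (x := Real.sqrt (1 / η)) (by positivity)
  rw [Real.log_sqrt (by positivity)] at h
  linarith

theorem logM_le {q : ℕ} [NeZero q] {η T : ℝ} (hη : 0 < η) (hT : 0 ≤ T) :
    Real.log (20 * q * (2 * T + 5) ^ 2 / η ^ 2) ≤
      11 * (Real.log q + Real.log (T + 2)) + 4 * Real.sqrt (1 / η) := by
  have hq : (1 : ℝ) ≤ q := by exact_mod_cast NeZero.one_le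
  have hq0 : 0 ≤ Real.log q := Real.log_nonneg hq
  have h1 : Real.log (20 * q * (2 * T + 5) ^ 2 / η ^ 2) =
      Real.log 20 + Real.log q + 2 * Real.log (2 * T + 5) + 2 * Real.log (1 / η) := by
    rw [Real.log_div (by positivity) (by positivity), Real.log_mul (by positivity) (by positivity),
      Real.log_mul (by positivity) (by positivity), Real.log_pow, Real.log_pow, Real.log_div one_ne_zero hη.ne',
      Real.log_one]
    push_cast; ring
  have h2 : Real.log 20 ≤ 5 * Real.log (T + 2) := by
    rw [show (5 : ℝ) * Real.log (T + 2) = Real.log ((T + 2) ^ 5) by rw [Real.log_pow]; norm_num]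
    apply Real.log_le_log (by norm_num)
    calc (20 : ℝ) ≤ 2 ^ 5 := by norm_num
      _ ≤ (T + 2) ^ 5 := by gcongr; linarith
  have h3 : Real.log (2 * T + 5) ≤ 3 * Real.log (T + 2) := by
    rw [show (3 : ℝ) * Real.log (T + 2) = Real.log ((T + 2) ^ 3) by rw [Real.log_pow]; norm_num]
    apply Real.log_le_log (by positivity)
    nlinarith [mul_nonneg hT hT, mul_nonneg (mul_nonneg hT hT) hT]
  have h4 := log_inv_le hη
  rw [h1]
  linarith

theorem re_inv_pole {η t : ℝ} (hη : 0 < η) (ht : 10 * η ≤ |t|) :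
    (1 / ((1 + η : ℝ) + t * I - 1 : ℂ)).re ≤ 1 / (101 * η) := by
  have e : ((1 + η : ℝ) + t * I - 1 : ℂ) = (η + t * I : ℂ) := by push_cast; ring
  have hre : (η + t * I : ℂ).re = η := by simp
  have him : (η + t * I : ℂ).im = t := by simp
  rw [e, one_div, inv_re, normSq_apply, hre, him]
  have h2 : 100 * η ^ 2 ≤ t * t := by
    rw [← abs_mul_abs_self t]
    nlinarith
  rw [div_le_div_iff₀ (by nlinarith) (by positivity)]
  nlinarith

theorem LΛ_re_eq {q : ℕ} [NeZero q] (χ : DirichletCharacter ℂ q) {s : ℂ} (hs : 1 < s.re) {E : ℝ}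
    (hE : 0 ≤ E) (h : χ = 1 → (1 / (s - 1)).re ≤ E) :
    (LΛ χ s).re ≤ (-(deriv (Lf χ) s / Lf χ s)).re + E := by
  classical
  have := Lf_logDeriv χ hs
  by_cases hχ : χ = 1
  · rw [this, if_pos hχ, sub_re]
    have := h hχ
    linarith
  · rw [this, if_neg hχ, sub_zero]
    linarith

theorem zfr_aux {q : ℕ} [NeZero q] (χ : DirichletCharacter ℂ q) {ρ : ℂ} (h0 : Lf χ ρ = 0) {η : ℝ}
    (hη : 0 < η) (hη1 : η ≤ 1 / 10 ^ 10)
    (hηL : η ≤ 1 / (10 ^ 6 * (Real.log q + Real.log (|ρ.im| + 2))))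
    (hcase : χ ^ 2 ≠ 1 ∨ 10 * η ≤ |ρ.im|) : ρ.re ≤ 1 - η / 7 := by
  classical
  by_contra hcon
  push Not at hcon
  have hρ1 : ρ.re < 1 := by
    by_contra hge
    exact Lf_ne_zero χ (not_lt.1 hge) h0
  set t := ρ.im with ht
  set σ : ℝ := 1 + η with hσ
  set M := Real.log (20 * q * (2 * |t| + 5) ^ 2 / η ^ 2) with hM
  have hq : (1 : ℝ) ≤ q := by exact_mod_cast NeZero.one_le
  have hL : 0 < Real.log q + Real.log (|t| + 2) := by
    have h1 := Real.log_nonneg hq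
    have h2 : 0 < Real.log (|t| + 2) := Real.log_pos (by linarith [abs_nonneg t])
    linarith
  have hMpos : 0 < M := by
    apply Real.log_pos
    rw [lt_div_iff₀ (by positivity)]
    have a1 : η ^ 2 < 1 := by nlinarith
    have a2 : (1 : ℝ) ≤ (2 * |t| + 5) ^ 2 := by nlinarith [abs_nonneg t]
    nlinarith
  have hMle : 768 * M ≤ 1 / 10 * (1 / η) := by
    have h1 := logM_le (q := q) hη (abs_nonneg t)
    have h2 : Real.log q + Real.log (|t| + 2) ≤ 1 / 10 ^ 6 * (1 / η) := by
      rw [le_div_iff₀ (by positivity)] at hηL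
      rw [div_mul_div_comm, le_div_iff₀ (by positivity)]
      nlinarith
    have h3 : Real.sqrt (1 / η) ≤ 1 / 10 ^ 5 * (1 / η) := by
      rw [Real.sqrt_le_left (by positivity)]
      have : (10 : ℝ) ^ 10 ≤ 1 / η := by
        rw [le_div_iff₀ hη]
        calc (10 : ℝ) ^ 10 * η ≤ 10 ^ 10 * (1 / 10 ^ 10) := by gcongr
          _ = 1 := by norm_num
      have h5 : 0 < 1 / η := by positivity
      calc 1 / η = 1 / η * 1 := by ring
        _ ≤ 1 / η * (1 / 10 ^ 10 * (1 / η)) := by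
          gcongr
          linarith
        _ = _ := by ring
    have h6 : 0 < 1 / η := by positivity
    have : M ≤ 11 * (Real.log q + Real.log (|t| + 2)) + 4 * Real.sqrt (1 / η) := h1
    linarith
  have hlan : ∀ (ψ : DirichletCharacter ℂ q) (u : ℝ), |u| ≤ 2 * |t| →
      (-(deriv (Lf ψ) (σ + u * I) / Lf ψ (σ + u * I))).re ≤ 48 * M / (1 / 2) := by
    intro ψ u hu
    have hre : (σ + u * I : ℂ).re = 1 + η := by simp [hσ]
    refine landau (by norm_num) hMpos (Lf_diff ψ) (Lf_ne_zero ψ (by rw [hre]; linarith)) ?_ ?_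
    · intro z hz
      exact Lf_ratio ψ hη (by linarith) (abs_nonneg t) hre (by simpa using hu) hz
    · intro z hz
      rw [hre]
      by_contra hlt
      exact Lf_ne_zero ψ (by linarith [not_le.1 hlt]) hz
  have hρe : ρ - (σ + t * I : ℂ) = ((ρ.re - σ : ℝ) : ℂ) := by
    apply Complex.ext <;> simp [ht]
  have hρn : ‖ρ - (σ + t * I : ℂ)‖ = σ - ρ.re := by
    rw [hρe, norm_real, Real.norm_eq_abs, abs_of_neg (by linarith)]; ring
  have hlz : (-(deriv (Lf χ) (σ + t * I) / Lf χ (σ + t * I))).re ≤ 48 * M / (1 / 2) +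
      (ρ.re - σ) * (1 / (σ - ρ.re) ^ 2 - 1 / (1 / 2) ^ 2) := by
    have hre : (σ + t * I : ℂ).re = 1 + η := by simp [hσ]
    have := landau_zero (f := Lf χ) (r := 1 / 2) (M := M) (c := (σ + t * I : ℂ)) (ρ := ρ) (by norm_num) hMpos (Lf_diff χ)
      (Lf_ne_zero χ (by rw [hre]; linarith)) ?_ ?_ h0 (by rw [hρn]; linarith)
    · rw [hρn] at this
      simpa [hσ] using this
    · intro z hz
      exact Lf_ratio χ hη (by linarith) (abs_nonneg t) hre (by simp; linarith [abs_nonneg t]) hz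
    · intro z hz
      rw [hre]
      by_contra hlt
      exact Lf_ne_zero χ (by linarith [not_le.1 hlt]) hz
  have h341 := three_four_one χ (σ := σ) (by linarith) t
  have b0 : (LΛ (1 : DirichletCharacter ℂ q) σ).re ≤ 48 * M / (1 / 2) + 1 / η := by
    have h1 := hlan 1 0 (by simp)
    have h2 := LΛ_re_eq (1 : DirichletCharacter ℂ q) (s := (σ : ℂ)) (by rw [ofReal_re]; linarith)
      (E := 1 / η) (by positivity) (fun _ => by
        rw [show (1 : ℂ) / ((σ : ℂ) - 1) = ((1 / η : ℝ) : ℂ) by rw [hσ]; push_cast; ring_nf, ofReal_re])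
    simp only [ofReal_zero, zero_mul, add_zero] at h1
    linarith
  have b1 : (LΛ χ (σ + t * I)).re ≤ 48 * M / (1 / 2) +
      (ρ.re - σ) * (1 / (σ - ρ.re) ^ 2 - 1 / (1 / 2) ^ 2) + 1 / (101 * η) := by
    have h2 := LΛ_re_eq χ (s := (σ + t * I : ℂ)) (by simp; linarith)
      (E := 1 / (101 * η)) (by positivity) (fun h => by
        rcases hcase with h' | h'
        · exact absurd (by rw [h, one_pow]) h'
        · exact re_inv_pole hη h')
    linarith
  have b2 : (LΛ (χ ^ 2) (σ + (2 * t : ℝ) * I)).re ≤ 48 * M / (1 / 2) + 1 / (101 * η) := by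
    have h1 := hlan (χ ^ 2) (2 * t) (by rw [abs_mul]; simp)
    have h2 := LΛ_re_eq (χ ^ 2) (s := (σ + (2 * t : ℝ) * I : ℂ)) (by simp; linarith)
      (E := 1 / (101 * η)) (by positivity) (fun h => by
        rcases hcase with h' | h'
        · exact absurd h h'
        · exact re_inv_pole hη (by rw [abs_mul, abs_two]; linarith [abs_nonneg t]))
    linarith
  set d := σ - ρ.re with hd
  have hd0 : 0 < d := by linarith
  have hdle : d ≤ 8 / 7 * η := by linarith
  have e1 : (ρ.re - σ) * (1 / d ^ 2 - 1 / (1 / 2) ^ 2) = -(1 / d) + 4 * d := by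
    have : ρ.re - σ = -d := by rw [hd]; ring
    rw [this]; field_simp; ring
  rw [e1] at b1
  have e2 : 7 / 8 * (1 / η) ≤ 1 / d := by
    rw [div_mul_div_comm, div_le_div_iff₀ (by positivity) hd0]
    linarith
  have e3 : 1 / (101 * η) = 1 / 101 * (1 / η) := by field_simp
  rw [e3] at b1 b2
  have e4 : 1 ≤ 1 / η := by rw [le_div_iff₀ hη]; linarith
  linarith

theorem zfr (ε : ℝ) (hε : 0 < ε) (hε1 : ε ≤ 1) : ∃ c : ℝ, 0 < c ∧ c ≤ 1 / 2 ∧ ∀ (q : ℕ) [NeZero q]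
    (χ : DirichletCharacter ℂ q) (ρ : ℂ), Lf χ ρ = 0 →
    ρ.re ≤ 1 - c / ((q : ℝ) ^ ε + Real.log (|ρ.im| + 2)) := by
  obtain ⟨c, hc, hc2, h⟩ := siegel ε hε hε1
  set k := min (ε / 10 ^ 10) (c / 20) with hk
  have hk0 : 0 < k := by positivity
  have k1 : k ≤ ε / 10 ^ 10 := min_le_left _ _
  have k2 : k ≤ c / 20 := min_le_right _ _
  refine ⟨k / 7, by positivity, by linarith, fun q _ χ ρ hρ => ?_⟩
  set W := (q : ℝ) ^ ε + Real.log (|ρ.im| + 2) with hW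
  have hq : (1 : ℝ) ≤ q := by exact_mod_cast NeZero.one_le
  have hqε : 1 ≤ (q : ℝ) ^ ε := Real.one_le_rpow hq hε.le
  have hlt : 0 < Real.log (|ρ.im| + 2) := Real.log_pos (by linarith [abs_nonneg ρ.im])
  have hlq : Real.log q ≤ (q : ℝ) ^ ε / ε := Real.log_le_rpow_div (by linarith) hε
  have hlq0 : 0 ≤ Real.log q := Real.log_nonneg hq
  have hW1 : 1 ≤ W := by linarith
  have hη : 0 < k / W := by positivity
  have hkW : k / W ≤ k := div_le_self hk0.le hW1
  have hLW : Real.log q + Real.log (|ρ.im| + 2) ≤ W / ε := by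
    rw [hW, add_div]
    have : Real.log (|ρ.im| + 2) ≤ Real.log (|ρ.im| + 2) / ε := by
      rw [le_div_iff₀ hε]; nlinarith
    linarith
  have e : k / 7 / W = k / W / 7 := by ring
  rw [e]
  by_cases hcase : χ ^ 2 ≠ 1 ∨ 10 * (k / W) ≤ |ρ.im|
  · refine zfr_aux χ hρ hη ?_ ?_ hcase
    · refine hkW.trans (k1.trans ?_)
      gcongr
    · rw [div_le_div_iff₀ (by positivity) (by positivity)]
      calc k * (10 ^ 6 * (Real.log q + Real.log (|ρ.im| + 2)))
          ≤ ε / 10 ^ 10 * (10 ^ 6 * (W / ε)) := by gcongr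
        _ ≤ 1 * W := by field_simp; norm_num
  · push Not at hcase
    obtain ⟨h2, h3⟩ := hcase
    have h4 := h q χ h2 ρ hρ
    have h5 : ‖ρ - 1‖ ≤ |ρ.re - 1| + |ρ.im| := by
      have := norm_le_abs_re_add_abs_im (ρ - 1)
      simpa using this
    have hρ1 : ρ.re < 1 := by
      by_contra hge
      exact Lf_ne_zero χ (not_lt.1 hge) hρ
    rw [abs_of_neg (by linarith)] at h5
    have h6 : c / W ≤ c * (q : ℝ) ^ (-ε) := by
      rw [Real.rpow_neg (by linarith), div_eq_mul_inv]
      gcongr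
      linarith
    have h7 : k / W ≤ c / W / 20 := by
      rw [div_right_comm]
      gcongr
    linarith

theorem logDeriv_region (ε : ℝ) (hε : 0 < ε) (hε1 : ε ≤ 1) : ∃ c : ℝ, 0 < c ∧ c ≤ 1 / 8 ∧ ∃ C : ℝ, 0 < C ∧
    ∀ (q : ℕ) [NeZero q] (χ : DirichletCharacter ℂ q) (T : ℝ), 3 ≤ T → ∀ s : ℂ, |s.im| ≤ T →
    1 - c / ((q : ℝ) ^ ε + Real.log T) ≤ s.re → s.re ≤ 3 / 2 →
    Lf χ s ≠ 0 ∧ ‖deriv (Lf χ) s / Lf χ s‖ ≤ C * ((q : ℝ) ^ ε + Real.log T) ^ 2 := by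
  obtain ⟨c, hc, hc2, hz⟩ := zfr ε hε hε1
  set b := c / 16 with hb
  refine ⟨b / 2, by positivity, by linarith, 8 / b * (11 / ε + 11 * 2 + 4 / b), by positivity, ?_⟩
  intro q _ χ T hT s hsi hsr hsr2
  set W := (q : ℝ) ^ ε + Real.log T with hW
  have hq : (1 : ℝ) ≤ q := by exact_mod_cast NeZero.one_le
  have hqε : 1 ≤ (q : ℝ) ^ ε := Real.one_le_rpow hq hε.le
  have hlT : 0 < Real.log T := Real.log_pos (by linarith)
  have hlq : Real.log q ≤ (q : ℝ) ^ ε / ε := Real.log_le_rpow_div (by linarith) hε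
  have hW1 : 1 ≤ W := by linarith
  set w := b / W with hw
  have hw0 : 0 < w := by positivity
  have hwb : w ≤ b := div_le_self (by positivity) hW1
  have hwe : b / 2 / W = w / 2 := by rw [hw]; ring
  rw [hwe] at hsr
  have hnz : ∀ z : ℂ, |z.im| ≤ T + 1 → 1 - 4 * w < z.re → Lf χ z ≠ 0 := by
    intro z hzi hzr h0
    have h1 := hz q χ z h0
    have h2 : Real.log (|z.im| + 2) ≤ 2 * Real.log T := by
      rw [show (2 : ℝ) * Real.log T = Real.log (T ^ 2) by rw [Real.log_pow]; norm_num]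
      apply Real.log_le_log (by positivity)
      nlinarith
    have hlz : 0 < Real.log (|z.im| + 2) := Real.log_pos (by linarith [abs_nonneg z.im])
    have h3 : 4 * w ≤ c / ((q : ℝ) ^ ε + Real.log (|z.im| + 2)) := by
      rw [le_div_iff₀ (by positivity)]
      calc 4 * w * ((q : ℝ) ^ ε + Real.log (|z.im| + 2)) ≤ 4 * w * (2 * W) := by gcongr; linarith
        _ = 8 * b := by rw [hw]; field_simp; ring
        _ ≤ c := by rw [hb]; linarith
    linarith
  set z₀ : ℂ := ((max s.re (1 + w) : ℝ) : ℂ) + s.im * I with hz₀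
  have hre : z₀.re = max s.re (1 + w) := by simp [hz₀]
  have him : z₀.im = s.im := by simp [hz₀]
  have m1 : 1 + w ≤ z₀.re := by rw [hre]; exact le_max_right _ _
  have m2 : z₀.re ≤ 3 / 2 := by rw [hre]; exact max_le hsr2 (by linarith)
  set η := z₀.re - 1 with hη
  have hη0 : w ≤ η := by linarith
  set M := Real.log (20 * q * (2 * T + 5) ^ 2 / w ^ 2) with hM
  have hMpos : 0 < M := by
    apply Real.log_pos
    rw [lt_div_iff₀ (by positivity)]
    have a1 : w ^ 2 < 1 := by nlinarith
    have a2 : (1 : ℝ) ≤ (2 * T + 5) ^ 2 := by nlinarith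
    nlinarith
  refine ⟨hnz s (by linarith) (by linarith), ?_⟩
  have hd : ∀ z : ℂ, DifferentiableAt ℂ (fun z => Lf χ (z₀ + z)) z := fun z =>
    ((Lf_diff χ).comp ((differentiable_id).const_add z₀)) z
  have key := logDeriv_bound (f := fun z => Lf χ (z₀ + z)) (R := 3 * w) (M := M) (z := s - z₀)
    (by positivity) hMpos (fun z _ => (hd z).differentiableWithinAt) ?_ ?_ ?_
  · have hder : deriv (fun z => Lf χ (z₀ + z)) (s - z₀) = deriv (Lf χ) s := by
      rw [deriv_comp_const_add]; simp
    rw [hder] at key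
    simp only [add_sub_cancel] at key
    refine key.trans ?_
    have h1 := logM_le (q := q) hw0 (T := T) (by linarith)
    have h2 : Real.log (T + 2) ≤ 2 * Real.log T := by
      rw [show (2 : ℝ) * Real.log T = Real.log (T ^ 2) by rw [Real.log_pow]; norm_num]
      apply Real.log_le_log (by positivity)
      nlinarith
    have h3 : Real.sqrt (1 / w) ≤ W / b := by
      have e : 1 / w = W / b := by rw [hw]; field_simp
      have e1 : 1 ≤ W / b := by rw [le_div_iff₀ (by positivity)]; linarith
      rw [e, Real.sqrt_le_left (by positivity)]
      nlinarith
    have hqW : (q : ℝ) ^ ε / ε ≤ W / ε := by gcongr; linarith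
    have h4 : M ≤ (11 / ε + 11 * 2 + 4 / b) * W := by
      have e1 : (11 / ε + 11 * 2 + 4 / b) * W = 11 * (W / ε) + 11 * (2 * W) + 4 * (W / b) := by
        ring
      rw [e1]
      have : M ≤ _ := h1
      have : Real.log T ≤ W := by linarith
      linarith
    calc 24 * M / (3 * w) = 8 / b * W * M := by rw [hw]; field_simp; ring
      _ ≤ 8 / b * W * ((11 / ε + 11 * 2 + 4 / b) * W) := by gcongr
      _ = _ := by ring
  · intro z hzb
    rw [mem_ball, dist_zero_right] at hzb
    have h1 := (abs_le.1 (abs_re_le_norm z))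
    have h2 := (abs_le.1 (abs_im_le_norm z))
    refine hnz _ ?_ ?_
    · rw [add_im, him]
      have := abs_add_le s.im z.im
      have h3 := abs_im_le_norm z
      linarith
    · rw [add_re]; linarith [h1.1]
  · intro z hzb
    rw [mem_ball, dist_zero_right] at hzb
    have h1 := Lf_ratio χ (η := η) (T := T) (by linarith) (by linarith) (by linarith) (c := z₀)
      (by rw [hη]; ring) (by rw [him]; linarith) (z := z₀ + z) (by simp; linarith)
    simp only [add_zero]
    refine h1.trans ?_
    have hη00 : 0 < η := by linarith
    have hTT : 0 < 2 * T + 5 := by linarith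
    have : Real.log (20 * q * (2 * T + 5) ^ 2 / η ^ 2) ≤ M := by
      apply Real.log_le_log (by positivity)
      gcongr
    gcongr
  · have : s - z₀ = ((s.re - max s.re (1 + w) : ℝ) : ℂ) := by
      apply Complex.ext <;> simp [hz₀]
    rw [this, norm_real, Real.norm_eq_abs, abs_le]
    rcases max_cases s.re (1 + w) with ⟨h, _⟩ | ⟨h, _⟩
    · rw [h]; constructor <;> linarith
    · rw [h]; constructor <;> linarith
end SW

namespace SW

open Complex Metric

noncomputable def ind0 : ℝ → ℂ := Set.indicator (Set.Ioc 0 1) (fun _ => 1)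
noncomputable def indp (b : ℂ) : ℝ → ℂ := Set.indicator (Set.Ioc 0 1) (fun t : ℝ => (t : ℂ) ^ b)
noncomputable def k1 (u : ℝ) : ℂ := ind0 u - indp 1 u
noncomputable def k2 (u : ℝ) : ℂ := ((1 / 2 : ℂ) • indp (-1) u - ind0 u) + (1 / 2 : ℂ) • indp 1 u

theorem k1_mellin {s : ℂ} (hs : 0 < s.re) : HasMellin k1 s (1 / (s * (s + 1))) := by
  have h1 := hasMellin_one_Ioc hs
  have h2 := hasMellin_cpow_Ioc 1 (s := s) (by simp; linarith)
  have h3 := hasMellin_sub h1.1 h2.1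
  rw [h1.2, h2.2] at h3
  have e : 1 / s - 1 / (s + 1) = 1 / (s * (s + 1)) := by
    have a1 : s ≠ 0 := by rintro rfl; simp at hs
    have a2 : s + 1 ≠ 0 := by
      intro h
      have := congrArg re h
      simp at this; linarith
    field_simp; ring
  rw [e] at h3
  exact h3

theorem k2_mellin {s : ℂ} (hs : 1 < s.re) : HasMellin k2 s (1 / ((s - 1) * (s * (s + 1)))) := by
  have h1 := hasMellin_one_Ioc (s := s) (by linarith)
  have h2 := hasMellin_cpow_Ioc 1 (s := s) (by simp; linarith)
  have h0 := hasMellin_cpow_Ioc (-1) (s := s) (by simp; linarith)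
  have h2' := hasMellin_const_smul h2.1 (1 / 2 : ℂ)
  have h0' := hasMellin_const_smul h0.1 (1 / 2 : ℂ)
  have h3 := hasMellin_sub h0'.1 h1.1
  have h4 := hasMellin_add h3.1 h2'.1
  rw [h3.2, h2'.2, h0'.2, h1.2, h2.2, h0.2] at h4
  have e : (1 / 2 : ℂ) • (1 / (s + -1)) - 1 / s + (1 / 2 : ℂ) • (1 / (s + 1)) =
      1 / ((s - 1) * (s * (s + 1))) := by
    have a1 : s ≠ 0 := by rintro rfl; simp at hs; linarith
    have a2 : s + 1 ≠ 0 := by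
      intro h
      have := congrArg re h
      simp at this; linarith
    have a3 : s - 1 ≠ 0 := by
      intro h
      have := congrArg re h
      simp at this; linarith
    rw [← sub_eq_add_neg, smul_eq_mul, smul_eq_mul]
    field_simp; ring
  rw [e] at h4
  exact h4

theorem k1_val {u : ℝ} (hu : 0 < u) : k1 u = ((max (1 - u) 0 : ℝ) : ℂ) := by
  simp only [k1, ind0, indp, Set.indicator, Set.mem_Ioc]
  by_cases h : u ≤ 1
  · simp [hu, h]
  · simp only [h, and_false, if_false, sub_zero]
    rw [max_eq_right (by linarith)]; simp

theorem k2_val {u : ℝ} (hu : 0 < u) (h : u < 1) : k2 u = ((1 / (2 * u) - 1 + u / 2 : ℝ) : ℂ) := by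
  simp only [k2, ind0, indp, Set.indicator, Set.mem_Ioc]
  simp only [hu, h.le, and_self, if_true, smul_eq_mul, cpow_neg_one, cpow_one]
  push_cast
  field_simp

theorem k1_cont {u : ℝ} (hu : 0 < u) : ContinuousAt k1 u := by
  have : ContinuousAt (fun u : ℝ => ((max (1 - u) 0 : ℝ) : ℂ)) u := by fun_prop
  refine this.congr ?_
  filter_upwards [lt_mem_nhds hu] with v hv
  exact (k1_val hv).symm

theorem k2_cont {u : ℝ} (hu : 0 < u) (h : u < 1) : ContinuousAt k2 u := by
  have : ContinuousAt (fun u : ℝ => ((1 / (2 * u) - 1 + u / 2 : ℝ) : ℂ)) u := by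
    refine continuous_ofReal.continuousAt.comp ?_
    have : 2 * u ≠ 0 := by positivity
    fun_prop (disch := assumption)
  refine this.congr ?_
  filter_upwards [lt_mem_nhds hu, gt_mem_nhds h] with v hv hv1
  exact (k2_val hv hv1).symm

theorem vline_ne {a : ℝ} (ha : 0 < a) (y : ℝ) : (a + y * I : ℂ) ≠ 0 ∧ (a + y * I + 1 : ℂ) ≠ 0 := by
  constructor
  · intro h
    have := congrArg re h
    simp at this; linarith
  · intro h
    have := congrArg re h
    simp at this; linarith

/-- lower bound for the denominators -/
theorem den_lower {s : ℂ} (hs : 1 / 2 ≤ s.re) : (1 + s.im ^ 2) / 4 ≤ ‖s * (s + 1)‖ := by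
  have h1 : ‖s‖ ^ 2 = s.re ^ 2 + s.im ^ 2 := by rw [Complex.sq_norm, normSq_apply]; ring
  have h2 : ‖s + 1‖ ^ 2 = (s.re + 1) ^ 2 + s.im ^ 2 := by
    rw [Complex.sq_norm, normSq_apply]; simp; ring
  have h3 : ‖s‖ ≤ ‖s + 1‖ := by
    refine (sq_le_sq₀ (norm_nonneg _) (norm_nonneg _)).1 ?_
    rw [h1, h2]; nlinarith
  rw [norm_mul]
  nlinarith [norm_nonneg s]

theorem ker_norm {a : ℝ} (ha : 1 / 2 ≤ a) (y : ℝ) :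
    ‖1 / ((a + y * I : ℂ) * (a + y * I + 1))‖ ≤ 4 * (1 + y ^ 2)⁻¹ := by
  have h := den_lower (s := (a + y * I : ℂ)) (by simpa using ha)
  have him : (a + y * I : ℂ).im = y := by simp
  rw [him] at h
  rw [norm_div, norm_one, div_le_iff₀ (lt_of_lt_of_le (by positivity) h)]
  calc (1 : ℝ) = 4 * (1 + y ^ 2)⁻¹ * ((1 + y ^ 2) / 4) := by field_simp
    _ ≤ _ := by gcongr

theorem ker_cont {a : ℝ} (ha : 0 < a) :
    Continuous (fun y : ℝ => 1 / ((a + y * I : ℂ) * (a + y * I + 1))) := by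
  refine Continuous.div (by fun_prop) (by fun_prop) fun y => ?_
  exact mul_ne_zero (vline_ne ha y).1 (vline_ne ha y).2

theorem ker_integrable {a : ℝ} (ha : 1 / 2 ≤ a) :
    Integrable (fun y : ℝ => 1 / ((a + y * I : ℂ) * (a + y * I + 1))) := by
  refine (integrable_inv_one_add_sq.const_mul 4).mono' (ker_cont (by linarith)).aestronglyMeasurable ?_
  exact Filter.Eventually.of_forall fun y => ker_norm ha y

theorem ker_int {a v : ℝ} (ha : 1 / 2 ≤ a) (hv : 0 < v) :
    ∫ y : ℝ, (v : ℂ) ^ (a + y * I : ℂ) * (1 / ((a + y * I : ℂ) * (a + y * I + 1))) =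
      2 * Real.pi * ((max (1 - 1 / v) 0 : ℝ) : ℂ) := by
  have hre : ∀ y : ℝ, 0 < (a + y * I : ℂ).re := fun y => by simp; linarith
  have h := mellinInv_mellin_eq a k1 (x := v⁻¹) (by positivity)
    (k1_mellin (s := (a : ℂ)) (by rw [ofReal_re]; linarith)).1 ?_ (k1_cont (by positivity))
  · rw [k1_val (by positivity), mellinInv] at h
    rw [one_div, ← h, Complex.real_smul]
    push_cast
    rw [← mul_assoc, show (2 * (Real.pi : ℂ)) * (1 / (2 * (Real.pi : ℂ))) = 1 by
      have : (Real.pi : ℂ) ≠ 0 := by exact_mod_cast Real.pi_ne_zero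
      field_simp, one_mul]
    congr 1
    funext y
    rw [(k1_mellin (hre y)).2, smul_eq_mul]
    congr 1
    rw [cpow_neg, inv_cpow _ _ (by rw [arg_ofReal_of_nonneg hv.le]; exact Real.pi_pos.ne), inv_inv]
  · have := ker_integrable ha
    refine this.congr (Filter.Eventually.of_forall fun y => ?_)
    exact ((k1_mellin (hre y)).2).symm

theorem pole_norm {a : ℝ} (ha : 1 < a) (y : ℝ) : ‖1 / (a + y * I - 1 : ℂ)‖ ≤ 1 / (a - 1) := by
  rw [norm_div, norm_one]
  have : a - 1 ≤ ‖(a + y * I - 1 : ℂ)‖ := by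
    refine le_trans (le_of_eq ?_) (re_le_norm _)
    simp
  gcongr

theorem pole_cont {a : ℝ} (ha : 1 < a) : Continuous (fun y : ℝ => 1 / (a + y * I - 1 : ℂ)) := by
  refine Continuous.div (by fun_prop) (by fun_prop) fun y h => ?_
  have := congrArg re h
  simp at this; linarith

theorem ker_pole {a v : ℝ} (ha : 1 < a) (hv : 1 < v) :
    ∫ y : ℝ, (v : ℂ) ^ (a + y * I : ℂ) * (1 / (a + y * I - 1) * (1 / ((a + y * I : ℂ) * (a + y * I + 1)))) =
      2 * Real.pi * ((v / 2 - 1 + 1 / (2 * v) : ℝ) : ℂ) := by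
  have hre : ∀ y : ℝ, 1 < (a + y * I : ℂ).re := fun y => by simp; linarith
  have hv0 : 0 < v := by linarith
  have hv1 : v⁻¹ < 1 := inv_lt_one_of_one_lt₀ hv
  have h := mellinInv_mellin_eq a k2 (x := v⁻¹) (by positivity)
    (k2_mellin (s := (a : ℂ)) (by rw [ofReal_re]; linarith)).1 ?_ (k2_cont (by positivity) hv1)
  · rw [k2_val (by positivity) hv1, mellinInv] at h
    have e : (v / 2 - 1 + 1 / (2 * v) : ℝ) = (1 / (2 * v⁻¹) - 1 + v⁻¹ / 2 : ℝ) := by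
      field_simp
    rw [e, ← h, Complex.real_smul]
    push_cast
    rw [← mul_assoc, show (2 * (Real.pi : ℂ)) * (1 / (2 * (Real.pi : ℂ))) = 1 by
      have : (Real.pi : ℂ) ≠ 0 := by exact_mod_cast Real.pi_ne_zero
      field_simp, one_mul]
    congr 1
    funext y
    rw [(k2_mellin (hre y)).2, smul_eq_mul]
    congr 1
    · rw [cpow_neg, inv_cpow _ _ (by rw [arg_ofReal_of_nonneg hv0.le]; exact Real.pi_pos.ne), inv_inv]
    · rw [div_mul_div_comm, one_mul]
  · have h1 := (ker_integrable (a := a) (by linarith)).bdd_mul (pole_cont ha).aestronglyMeasurable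
      (Filter.Eventually.of_forall (pole_norm ha))
    refine h1.congr (Filter.Eventually.of_forall fun y => ?_)
    simp only []
    rw [(k2_mellin (hre y)).2, div_mul_div_comm, one_mul]

theorem xker_norm {a x : ℝ} (ha : 1 / 2 ≤ a) (hx : 0 < x) (y : ℝ) :
    ‖(x : ℂ) ^ (a + y * I : ℂ) * (1 / ((a + y * I : ℂ) * (a + y * I + 1)))‖ ≤
      x ^ a * (4 * (1 + y ^ 2)⁻¹) := by
  rw [norm_mul, norm_cpow_eq_rpow_re_of_pos hx]
  have : (a + y * I : ℂ).re = a := by simp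
  rw [this]
  gcongr
  exact ker_norm ha y

theorem xker_cont {a x : ℝ} (ha : 1 / 2 ≤ a) (hx : 0 < x) :
    Continuous (fun y : ℝ => (x : ℂ) ^ (a + y * I : ℂ) * (1 / ((a + y * I : ℂ) * (a + y * I + 1)))) := by
  refine Continuous.mul ?_ (ker_cont (by linarith))
  refine Continuous.const_cpow (by fun_prop) (Or.inl ?_)
  exact_mod_cast hx.ne'

theorem xker_integrable {a x : ℝ} (ha : 1 / 2 ≤ a) (hx : 0 < x) :
    Integrable (fun y : ℝ => (x : ℂ) ^ (a + y * I : ℂ) * (1 / ((a + y * I : ℂ) * (a + y * I + 1)))) := by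
  refine ((integrable_inv_one_add_sq.const_mul 4).const_mul (x ^ a)).mono'
    (xker_cont ha hx).aestronglyMeasurable ?_
  exact Filter.Eventually.of_forall fun y => xker_norm ha hx y

theorem perron1 {q : ℕ} [NeZero q] (χ : DirichletCharacter ℂ q) {a x : ℝ} (ha : 1 < a) (hx : 1 < x) :
    ∫ y : ℝ, LΛ χ (a + y * I) * ((x : ℂ) ^ (a + y * I : ℂ) * (1 / ((a + y * I : ℂ) * (a + y * I + 1)))) =
    2 * Real.pi * ∑ n ∈ range (⌊x⌋₊ + 1),
      χ n * (ArithmeticFunction.vonMangoldt n : ℂ) * ((1 - n / x : ℝ) : ℂ) := by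
  have hx0 : 0 < x := by linarith
  set b : ℕ → ℂ := fun n : ℕ => χ (n : ZMod q) * (ArithmeticFunction.vonMangoldt n : ℂ) with hb
  set K : ℝ → ℂ := fun y => (x : ℂ) ^ (a + y * I : ℂ) * (1 / ((a + y * I : ℂ) * (a + y * I + 1))) with hK
  have hKi : Integrable K := xker_integrable (by linarith) hx0
  have hsum : LSeriesSummable b a := DirichletCharacter.LSeriesSummable_twist_vonMangoldt χ
    (s := (a : ℂ)) (by simpa using ha)
  have hnorm : ∀ (n : ℕ) (y : ℝ), ‖LSeries.term b (a + y * I) n‖ = ‖LSeries.term b a n‖ := by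
    intro n y
    rw [LSeries.norm_term_eq, LSeries.norm_term_eq]
    simp
  have hcont : ∀ n : ℕ, Continuous (fun y : ℝ => LSeries.term b (a + y * I) n) := by
    intro n
    rcases eq_or_ne n 0 with rfl | hn
    · simp only [LSeries.term_zero]; exact continuous_const
    · simp only [LSeries.term_of_ne_zero hn]
      refine Continuous.div continuous_const ?_ ?_
      · exact Continuous.const_cpow (by fun_prop) (Or.inl (by exact_mod_cast hn))
      · intro y
        rw [Ne, cpow_eq_zero_iff]
        push Not
        intro h
        exact absurd h (by exact_mod_cast hn)
  have hIntg : ∀ n, Integrable (fun y : ℝ => LSeries.term b (a + y * I) n * K y) := fun n =>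
    hKi.bdd_mul (c := ‖LSeries.term b a n‖) (hcont n).aestronglyMeasurable
      (Filter.Eventually.of_forall fun y => (hnorm n y).le)
  have hS := hasSum_integral_of_summable_integral_norm (F := fun n (y : ℝ) => LSeries.term b (a + y * I) n * K y)
    hIntg (by
      simp only [norm_mul, hnorm]
      simp only [integral_const_mul]
      exact (Summable.norm hsum).mul_right _)
  have hval : ∀ n : ℕ, ∫ y : ℝ, LSeries.term b (a + y * I) n * K y =
      2 * Real.pi * (b n * ((max (1 - n / x) 0 : ℝ) : ℂ)) := by
    intro n
    rcases eq_or_ne n 0 with rfl | hn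
    · simp [hb]
    have hn0 : (0 : ℝ) < n := by exact_mod_cast Nat.pos_of_ne_zero hn
    have h1 := ker_int (a := a) (v := x / n) (by linarith) (by positivity)
    rw [one_div_div] at h1
    calc ∫ y : ℝ, LSeries.term b (a + y * I) n * K y = ∫ y : ℝ, b n *
          (((x / n : ℝ) : ℂ) ^ (a + y * I : ℂ) * (1 / ((a + y * I : ℂ) * (a + y * I + 1)))) := by
          congr 1
          funext y
          rw [LSeries.term_of_ne_zero hn, hK]
          have e : (x : ℂ) ^ (a + y * I : ℂ) = ((x / n : ℝ) : ℂ) ^ (a + y * I : ℂ) * (n : ℂ) ^ (a + y * I : ℂ) := by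
            have := mul_cpow_ofReal_nonneg (a := x / n) (b := n) (by positivity) hn0.le (a + y * I : ℂ)
            rw [ofReal_natCast] at this
            rw [← this]
            congr 1
            push_cast
            field_simp
          have hne : (n : ℂ) ^ (a + y * I : ℂ) ≠ 0 := by
            rw [Ne, cpow_eq_zero_iff]
            push Not
            intro h
            exact absurd h (by exact_mod_cast hn)
          simp only [e]
          field_simp
      _ = b n * (2 * Real.pi * ((max (1 - n / x) 0 : ℝ) : ℂ)) := by
          rw [integral_const_mul, h1]
      _ = _ := by ring
  have hL : ∀ y : ℝ, ∑' n, LSeries.term b (a + y * I) n * K y = LΛ χ (a + y * I) * K y := by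
    intro y
    rw [tsum_mul_right]; rfl
  simp only [hL, hval] at hS
  rw [← hS.tsum_eq, tsum_mul_left]
  congr 1
  rw [tsum_eq_sum (s := range (⌊x⌋₊ + 1))]
  · refine Finset.sum_congr rfl fun n hn => ?_
    have hn : n ≤ ⌊x⌋₊ := by simpa [Nat.lt_succ_iff] using hn
    have : (n : ℝ) ≤ x := (Nat.le_floor_iff hx0.le).1 hn
    rw [max_eq_left]
    rw [sub_nonneg, div_le_one hx0]; exact this
  · intro n hn
    have hn : ⌊x⌋₊ < n := by simpa [Nat.lt_succ_iff] using hn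
    have : x < n := (Nat.floor_lt hx0.le).1 hn
    rw [max_eq_right]
    · simp
    · rw [sub_nonpos, one_le_div hx0]; exact this.le

noncomputable def wt (x : ℝ) : ℝ := x / 2 - 1 + 1 / (2 * x)

open Classical in
theorem perron2 {q : ℕ} [NeZero q] (χ : DirichletCharacter ℂ q) {a x : ℝ} (ha : 1 < a) (hx : 1 < x)
    (hIntg : Integrable (fun y : ℝ => -(deriv (Lf χ) (a + y * I) / Lf χ (a + y * I)) *
      ((x : ℂ) ^ (a + y * I : ℂ) * (1 / ((a + y * I : ℂ) * (a + y * I + 1)))))) :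
    ∫ y : ℝ, -(deriv (Lf χ) (a + y * I) / Lf χ (a + y * I)) *
      ((x : ℂ) ^ (a + y * I : ℂ) * (1 / ((a + y * I : ℂ) * (a + y * I + 1)))) =
    2 * Real.pi * (∑ n ∈ range (⌊x⌋₊ + 1),
      χ n * (ArithmeticFunction.vonMangoldt n : ℂ) * ((1 - n / x : ℝ) : ℂ) -
        (if χ = 1 then (wt x : ℂ) else 0)) := by
  rw [mul_sub, ← perron1 χ ha hx]
  have hre : ∀ y : ℝ, 1 < (a + y * I : ℂ).re := fun y => by simp; linarith
  by_cases h : χ = 1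
  · rw [if_pos h, wt, ← ker_pole ha hx, eq_sub_iff_add_eq, ← integral_add hIntg]
    · congr 1
      funext y
      rw [Lf_logDeriv χ (hre y), if_pos h]
      ring
    · have := (xker_integrable (a := a) (x := x) (by linarith) (by linarith)).bdd_mul
        (pole_cont ha).aestronglyMeasurable (Filter.Eventually.of_forall (pole_norm ha))
      refine this.congr (Filter.Eventually.of_forall fun y => ?_)
      simp only []
      ring
  · rw [if_neg h, mul_zero, sub_zero]
    congr 1
    funext y
    rw [Lf_logDeriv χ (hre y), if_neg h, sub_zero]
end SW

namespace SW

open Complex Metric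

/-- the integrand -/
noncomputable def GG {q : ℕ} [NeZero q] (χ : DirichletCharacter ℂ q) (x : ℝ) (s : ℂ) : ℂ :=
  -(deriv (Lf χ) s / Lf χ s) * ((x : ℂ) ^ s * (1 / (s * (s + 1))))

noncomputable def hh (y : ℝ) : ℝ := (1 + ‖y‖ ^ 2) ^ (-(5 / 4 : ℝ) / 2)

theorem hh_int : Integrable hh := integrable_rpow_neg_one_add_norm_sq (by simp; norm_num)

theorem hh_nonneg (y : ℝ) : 0 ≤ hh y := by unfold hh; positivity

theorem hh_lower (y : ℝ) : (1 + y ^ 2)⁻¹ ≤ hh y := by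
  unfold hh
  rw [Real.norm_eq_abs, sq_abs, ← Real.rpow_neg_one]
  exact Real.rpow_le_rpow_of_exponent_le (by nlinarith [sq_nonneg y]) (by norm_num)

theorem hh_tail {y T : ℝ} (hT : 1 ≤ T) (hy : T ≤ |y|) :
    |y| ^ (1 / 2 : ℝ) * (1 + y ^ 2)⁻¹ ≤ T ^ (-(1 / 4) : ℝ) * hh y := by
  unfold hh
  rw [Real.norm_eq_abs, sq_abs]
  have h0 : 0 < 1 + y ^ 2 := by positivity
  have h1 : |y| ^ (1 / 2 : ℝ) ≤ (1 + y ^ 2) ^ (1 / 4 : ℝ) := by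
    calc |y| ^ (1 / 2 : ℝ) = (|y| ^ (2 : ℝ)) ^ (1 / 4 : ℝ) := by
          rw [← Real.rpow_mul (abs_nonneg _)]; norm_num
      _ ≤ _ := by
        apply Real.rpow_le_rpow (by positivity) _ (by norm_num)
        rw [Real.rpow_two, sq_abs]; linarith
  have h2 : (1 + y ^ 2) ^ (-(1 / 8) : ℝ) ≤ T ^ (-(1 / 4) : ℝ) := by
    calc (1 + y ^ 2) ^ (-(1 / 8) : ℝ) ≤ (T ^ (2 : ℝ)) ^ (-(1 / 8) : ℝ) := by
          apply Real.rpow_le_rpow_of_nonpos (by positivity) _ (by norm_num)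
          rw [Real.rpow_two, ← sq_abs y]
          nlinarith
      _ = _ := by rw [← Real.rpow_mul (by linarith)]; norm_num
  calc |y| ^ (1 / 2 : ℝ) * (1 + y ^ 2)⁻¹ ≤ (1 + y ^ 2) ^ (1 / 4 : ℝ) * (1 + y ^ 2)⁻¹ := by gcongr
    _ = (1 + y ^ 2) ^ (-(1 / 8) : ℝ) * (1 + y ^ 2) ^ (-(5 / 4 : ℝ) / 2) := by
      rw [← Real.rpow_neg_one, ← Real.rpow_add h0, ← Real.rpow_add h0]; norm_num
    _ ≤ _ := by gcongr

theorem GG_norm {q : ℕ} [NeZero q] (χ : DirichletCharacter ℂ q) {x D : ℝ} (hx : 0 < x) (hD : 0 ≤ D) {a y : ℝ}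
    (ha : 1 / 2 ≤ a) (h : ‖deriv (Lf χ) (a + y * I) / Lf χ (a + y * I)‖ ≤ D) :
    ‖GG χ x (a + y * I)‖ ≤ D * (x ^ a * (4 * (1 + y ^ 2)⁻¹)) := by
  rw [GG, norm_mul, norm_neg]
  exact mul_le_mul h (xker_norm ha hx y) (norm_nonneg _) hD

theorem Lf_deriv_diff {q : ℕ} [NeZero q] (χ : DirichletCharacter ℂ q) : Differentiable ℂ (deriv (Lf χ)) :=
  fun s => ((Lf_diff χ).analyticAt s).deriv.differentiableAt

theorem GG_diffAt {q : ℕ} [NeZero q] (χ : DirichletCharacter ℂ q) {x : ℝ} (hx : 0 < x) {s : ℂ}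
    (hs : 0 < s.re) (h : Lf χ s ≠ 0) : DifferentiableAt ℂ (GG χ x) s := by
  have hs0 : s ≠ 0 := by rintro rfl; simp at hs
  have hs1 : s + 1 ≠ 0 := by
    intro h
    have := congrArg re h
    simp at this; linarith
  unfold GG
  refine DifferentiableAt.mul ((Lf_deriv_diff χ s).div (Lf_diff χ s) h).neg (DifferentiableAt.mul ?_ ?_)
  · exact differentiableAt_id.const_cpow (Or.inl (by exact_mod_cast hx.ne'))
  · exact (differentiableAt_const _).div (differentiableAt_id.mul (differentiableAt_id.add_const 1))
      (mul_ne_zero hs0 hs1)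

theorem contour {q : ℕ} [NeZero q] (χ : DirichletCharacter ℂ q) {a b x T D : ℝ} (ha : 1 < a) (hb : 1 / 2 ≤ b)
    (hb1 : b < 1) (hab : a - b ≤ 1) (hx : 1 < x) (hT : 1 ≤ T) (hD : 0 ≤ D)
    (hrect : ∀ s : ℂ, |s.im| ≤ T → b ≤ s.re → s.re ≤ a → Lf χ s ≠ 0 ∧ ‖deriv (Lf χ) s / Lf χ s‖ ≤ D)
    (htail : ∀ y : ℝ, T ≤ |y| → ‖deriv (Lf χ) (a + y * I) / Lf χ (a + y * I)‖ ≤ D * |y| ^ (1 / 2 : ℝ)) :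
    Integrable (fun y : ℝ => GG χ x (a + y * I)) ∧
    ‖∫ y : ℝ, GG χ x (a + y * I)‖ ≤ (16 + 4 * ∫ y, hh y) * D * (x ^ b + x ^ a * T ^ (-(1 / 4) : ℝ)) := by
  have hx0 : 0 < x := by linarith
  have hT0 : 0 < T := by linarith
  have hcont : Continuous (fun y : ℝ => GG χ x (a + y * I)) := by
    rw [continuous_iff_continuousAt]
    intro y
    have hd := GG_diffAt χ hx0 (s := (a + y * I : ℂ)) (by simp; linarith)
      (Lf_ne_zero χ (by simp; linarith))
    exact ContinuousAt.comp (f := fun y : ℝ => (a + y * I : ℂ)) (g := GG χ x) hd.continuousAt (by fun_prop)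
  have htl : ∀ y : ℝ, T ≤ |y| → ‖GG χ x (a + y * I)‖ ≤ 4 * D * x ^ a * T ^ (-(1 / 4) : ℝ) * hh y := by
    intro y hy
    have := GG_norm χ hx0 (by positivity) (by linarith) (htail y hy)
    refine this.trans ?_
    have h2 := hh_tail hT hy
    calc D * |y| ^ (1 / 2 : ℝ) * (x ^ a * (4 * (1 + y ^ 2)⁻¹)) =
        4 * D * x ^ a * (|y| ^ (1 / 2 : ℝ) * (1 + y ^ 2)⁻¹) := by ring
      _ ≤ 4 * D * x ^ a * (T ^ (-(1 / 4) : ℝ) * hh y) := by gcongr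
      _ = _ := by ring
  have hT4 : T ^ (-(1 / 4) : ℝ) ≤ 1 := Real.rpow_le_one_of_one_le_of_nonpos hT (by norm_num)
  have hT4p : 0 < T ^ (-(1 / 4) : ℝ) := by positivity
  have hall : ∀ y : ℝ, ‖GG χ x (a + y * I)‖ ≤ 4 * D * x ^ a * hh y := by
    intro y
    rcases le_total T |y| with hy | hy
    · refine (htl y hy).trans ?_
      have := hh_nonneg y
      refine mul_le_mul_of_nonneg_right ?_ this
      exact mul_le_of_le_one_right (by positivity) hT4
    · have h1 := hrect (a + y * I) (by simpa using hy) (by simp; linarith) (by simp)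
      refine (GG_norm χ hx0 hD (by linarith) h1.2).trans ?_
      calc D * (x ^ a * (4 * (1 + y ^ 2)⁻¹)) = 4 * D * x ^ a * (1 + y ^ 2)⁻¹ := by ring
        _ ≤ _ := by gcongr; exact hh_lower y
  have hIntg : Integrable (fun y : ℝ => GG χ x (a + y * I)) :=
    (hh_int.const_mul (4 * D * x ^ a)).mono' hcont.aestronglyMeasurable (Filter.Eventually.of_forall hall)
  refine ⟨hIntg, ?_⟩
  have hK0 : 0 ≤ ∫ y, hh y := integral_nonneg hh_nonneg
  -- tails
  have t1 : ‖∫ y in (Set.Ioc (-T) T)ᶜ, GG χ x (a + y * I)‖ ≤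
      4 * D * x ^ a * T ^ (-(1 / 4) : ℝ) * ∫ y, hh y := by
    calc _ ≤ ∫ y in (Set.Ioc (-T) T)ᶜ, 4 * D * x ^ a * T ^ (-(1 / 4) : ℝ) * hh y := by
          refine norm_integral_le_of_norm_le (hh_int.const_mul _).integrableOn ?_
          refine (ae_restrict_iff' measurableSet_Ioc.compl).2 (Filter.Eventually.of_forall fun y hy => ?_)
          apply htl
          rw [Set.mem_compl_iff, Set.mem_Ioc, not_and_or, not_lt, not_le] at hy
          rcases hy with h | h
          · rw [le_abs]; right; linarith
          · rw [le_abs]; left; linarith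
      _ ≤ ∫ y, 4 * D * x ^ a * T ^ (-(1 / 4) : ℝ) * hh y :=
          setIntegral_le_integral (hh_int.const_mul _)
            (Filter.Eventually.of_forall fun y => mul_nonneg (by positivity) (hh_nonneg y))
      _ = _ := integral_const_mul _ _
  -- rectangle
  have hrec := Complex.integral_boundary_rect_eq_zero_of_differentiableOn (GG χ x) (b + (-T : ℝ) * I) (a + T * I) ?_
  swap
  · intro s hs
    rw [mem_reProdIm] at hs
    simp only [add_re, ofReal_re, mul_re, I_re, mul_zero, ofReal_im, I_im, mul_one, sub_self, add_zero,
      add_im, mul_im, zero_add, zero_mul] at hs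
    rw [Set.uIcc_of_le (by linarith), Set.uIcc_of_le (by linarith)] at hs
    refine (GG_diffAt χ hx0 (by linarith [hs.1.1]) (hrect s (abs_le.2 hs.2) hs.1.1 hs.1.2).1).differentiableWithinAt
  simp only [add_re, ofReal_re, mul_re, I_re, mul_zero, ofReal_im, I_im, mul_one, sub_self, add_zero,
      add_im, mul_im, zero_add, zero_mul, smul_eq_mul] at hrec
  have hhor : ∀ Y : ℝ, |Y| = T → ‖∫ u in b..a, GG χ x (u + Y * I)‖ ≤ 4 * D * x ^ a * T ^ (-(1 / 4) : ℝ) := by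
    intro Y hY
    have h1 : ∀ u ∈ Set.uIoc b a, ‖GG χ x (u + Y * I)‖ ≤ 4 * D * x ^ a * T ^ (-(1 / 4) : ℝ) := by
      intro u hu
      rw [Set.uIoc_of_le (by linarith)] at hu
      have h2 := hrect (u + Y * I) (by simp [hY]) (by simp; linarith [hu.1]) (by simp; linarith [hu.2])
      refine (GG_norm χ hx0 hD (by linarith [hu.1]) h2.2).trans ?_
      have h3 : (1 + Y ^ 2)⁻¹ ≤ T ^ (-(1 / 4) : ℝ) := by
        rw [← sq_abs, hY]
        calc (1 + T ^ 2)⁻¹ ≤ T⁻¹ := by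
              gcongr
              nlinarith
          _ = T ^ (-1 : ℝ) := (Real.rpow_neg_one T).symm
          _ ≤ _ := Real.rpow_le_rpow_of_exponent_le hT (by norm_num)
      calc D * (x ^ u * (4 * (1 + Y ^ 2)⁻¹)) ≤ D * (x ^ a * (4 * T ^ (-(1 / 4) : ℝ))) := by
            gcongr
            · exact hx.le
            · exact hu.2
        _ = _ := by ring
    refine (intervalIntegral.norm_integral_le_of_norm_le_const h1).trans ?_
    rw [abs_of_pos (by linarith)]
    exact mul_le_of_le_one_right (by positivity) hab
  have hleft : ‖∫ y in (-T)..T, GG χ x (b + y * I)‖ ≤ 16 * D * x ^ b := by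
    have h1 : ‖∫ y in (-T)..T, GG χ x (b + y * I)‖ ≤ ∫ y in (-T)..T, 4 * D * x ^ b * (1 + y ^ 2)⁻¹ := by
      refine intervalIntegral.norm_integral_le_of_norm_le (by linarith) ?_
        (integrable_inv_one_add_sq.const_mul _).intervalIntegrable
      refine Filter.Eventually.of_forall fun y hy => ?_
      have h2 := hrect (b + y * I) (by simpa using abs_le.2 ⟨hy.1.le, hy.2⟩) (by simp) (by simp; linarith)
      refine (GG_norm χ hx0 hD hb h2.2).trans (le_of_eq (by ring))
    refine h1.trans ?_
    rw [intervalIntegral.integral_const_mul, integral_inv_one_add_sq]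
    have p1 := Real.arctan_lt_pi_div_two T
    have p2 := Real.neg_pi_div_two_lt_arctan (-T)
    have p3 := Real.pi_lt_four
    have : 0 ≤ 4 * D * x ^ b := by positivity
    nlinarith
  have hsplit : ∫ y : ℝ, GG χ x (a + y * I) = (∫ y in (-T)..T, GG χ x (a + y * I)) +
      ∫ y in (Set.Ioc (-T) T)ᶜ, GG χ x (a + y * I) := by
    rw [intervalIntegral.integral_of_le (by linarith), integral_add_compl measurableSet_Ioc hIntg]
  set J1 := ∫ u in b..a, GG χ x (u + (-T : ℝ) * I)
  set J2 := ∫ u in b..a, GG χ x (u + T * I)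
  set J3 := ∫ y in (-T)..T, GG χ x (b + y * I)
  set J4 := ∫ y in (-T)..T, GG χ x (a + y * I)
  have hJ4 : I * J4 = I * J3 + (J2 - J1) := by
    linear_combination hrec
  have hJ4n : ‖J4‖ ≤ ‖J3‖ + (‖J2‖ + ‖J1‖) := by
    calc ‖J4‖ = ‖I * J4‖ := by simp
      _ = ‖I * J3 + (J2 - J1)‖ := by rw [hJ4]
      _ ≤ ‖I * J3‖ + ‖J2 - J1‖ := norm_add_le _ _
      _ ≤ _ := by
        gcongr
        · simp
        · exact norm_sub_le _ _
  have n1 := hhor (-T) (by rw [abs_neg, abs_of_pos hT0])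
  have n2 := hhor T (abs_of_pos hT0)
  rw [hsplit]
  refine (norm_add_le _ _).trans ?_
  have e1 : 0 ≤ D * (x ^ a * T ^ (-(1 / 4) : ℝ)) := by positivity
  have e2 : 0 ≤ (∫ y, hh y) * (D * x ^ b) := by positivity
  calc _ ≤ 16 * D * x ^ b + (4 * D * x ^ a * T ^ (-(1 / 4) : ℝ) + 4 * D * x ^ a * T ^ (-(1 / 4) : ℝ)) +
      4 * D * x ^ a * T ^ (-(1 / 4) : ℝ) * ∫ y, hh y := by
        refine add_le_add (hJ4n.trans ?_) t1
        gcongr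
    _ ≤ _ := by nlinarith
end SW

namespace SW
open Complex Metric

open Classical in
theorem smoothed (B : ℝ) (hB : 1 ≤ B) : ∃ c, 0 < c ∧ c ≤ 1 ∧ ∃ K, 0 < K ∧ ∀ (q : ℕ) [NeZero q]
    (χ : DirichletCharacter ℂ q) (x : ℝ), Real.exp 16 ≤ x → (q : ℝ) ≤ Real.log x ^ B →
    ‖∑ n ∈ range (⌊x⌋₊ + 1), χ n * (ArithmeticFunction.vonMangoldt n : ℂ) * ((1 - n / x : ℝ) : ℂ) -
        (if χ = 1 then (wt x : ℂ) else 0)‖ ≤ K * x * Real.exp (-c * Real.sqrt (Real.log x)) := by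
  have hB0 : 0 < B := by linarith
  obtain ⟨c, hc, hc8, C, hC, H⟩ := logDeriv_region (1 / (2 * B)) (by positivity)
    (by rw [div_le_one (by positivity)]; linarith)
  have hI : 0 ≤ ∫ y, hh y := integral_nonneg hh_nonneg
  refine ⟨c / 4, by positivity, by linarith, (16 + 4 * ∫ y, hh y) * (25 * C) * (1 + Real.exp 1) * (2 * (4 / c) ^ 2),
    by positivity, ?_⟩
  intro q _ χ x hx hq
  have hx0 : 0 < x := (Real.exp_pos _).trans_le hx
  have hlog : 16 ≤ Real.log x := (Real.le_log_iff_exp_le hx0).2 hx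
  obtain ⟨l, hl, hl4, hll⟩ : ∃ l, l = Real.sqrt (Real.log x) ∧ 4 ≤ l ∧ l ^ 2 = Real.log x :=
    ⟨_, rfl, Real.le_sqrt_of_sq_le (by linarith), Real.sq_sqrt (by linarith)⟩
  rw [← hl]
  have hl0 : 0 < l := by linarith
  have hx1 : 1 < x := lt_of_lt_of_le (by simp) hx
  have hq0 : 0 < (q : ℝ) := by exact_mod_cast Nat.pos_of_ne_zero (NeZero.ne q)
  have hqe : (q : ℝ) ^ (1 / (2 * B)) ≤ l := by
    calc (q : ℝ) ^ (1 / (2 * B)) ≤ (Real.log x ^ B) ^ (1 / (2 * B)) :=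
          Real.rpow_le_rpow hq0.le hq (by positivity)
      _ = l := by
          rw [← Real.rpow_mul (by linarith), hl, Real.sqrt_eq_rpow]
          congr 1; field_simp
  have hqe0 : 0 < (q : ℝ) ^ (1 / (2 * B)) := by positivity
  have hT1 : 1 ≤ Real.exp l := by simp; linarith
  have hT3 : 3 ≤ Real.exp l := by have := Real.add_one_le_exp l; linarith
  have ha0 : (0:ℝ) < 1 / l ^ 2 := by positivity
  have ha1 : 1 / l ^ 2 ≤ 1 / 16 := by
    apply one_div_le_one_div_of_le (by norm_num); nlinarith
  have hb0 : 0 < c / (2 * l) := by positivity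
  have hb1 : c / (2 * l) ≤ 1 / 64 := by
    rw [div_le_iff₀ (by positivity)]; nlinarith
  have key := contour χ (a := 1 + 1 / l ^ 2) (b := 1 - c / (2 * l)) (x := x) (T := Real.exp l)
    (D := 25 * C * l ^ 2) (by linarith) (by linarith) (by linarith) (by linarith) hx1 hT1 (by positivity)
    (by
      intro s h1 h2 h3
      obtain ⟨h4, h5⟩ := H q χ (Real.exp l) hT3 s h1 (by
        rw [Real.log_exp]
        refine le_trans ?_ h2
        have : c / (2 * l) ≤ c / ((q : ℝ) ^ (1 / (2 * B)) + l) :=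
          div_le_div_of_nonneg_left hc.le (by positivity) (by linarith)
        linarith) (by linarith)
      refine ⟨h4, h5.trans ?_⟩
      rw [Real.log_exp]
      have : ((q : ℝ) ^ (1 / (2 * B)) + l) ^ 2 ≤ (2 * l) ^ 2 :=
        pow_le_pow_left₀ (by positivity) (by linarith) 2
      nlinarith [mul_le_mul_of_nonneg_left this hC.le, mul_pos hC (sq_pos_of_pos hl0)])
    (by
      intro y hy
      have hy3 : 3 ≤ |y| := hT3.trans hy
      obtain ⟨h4, h5⟩ := H q χ |y| hy3 ((1 + 1 / l ^ 2 : ℝ) + y * I) (by rw [add_im, ofReal_im]; simp) (by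
        have : 0 < c / ((q : ℝ) ^ (1 / (2 * B)) + Real.log |y|) := by
          have := Real.log_pos (show 1 < |y| by linarith)
          positivity
        simp only [add_re, ofReal_re, mul_re, I_re, ofReal_im, I_im]
        linarith) (by
        simp only [add_re, ofReal_re, mul_re, I_re, ofReal_im, I_im]
        linarith)
      refine h5.trans ?_
      have h6 : Real.log |y| ≤ |y| ^ (1 / 4 : ℝ) / (1 / 4) := Real.log_le_rpow_div (by positivity) (by norm_num)
      have h7 : 1 ≤ |y| ^ (1 / 4 : ℝ) := Real.one_le_rpow (by linarith) (by norm_num)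
      have h8 : |y| ^ (1 / 2 : ℝ) = (|y| ^ (1 / 4 : ℝ)) ^ 2 := by
        rw [← Real.rpow_natCast, ← Real.rpow_mul (by positivity)]; norm_num
      have h9 := Real.log_nonneg (show 1 ≤ |y| by linarith)
      rw [h8]
      generalize |y| ^ (1 / 4 : ℝ) = u at *
      have : ((q : ℝ) ^ (1 / (2 * B)) + Real.log |y|) ^ 2 ≤ (5 * (l * u)) ^ 2 :=
        pow_le_pow_left₀ (by positivity) (by nlinarith) 2
      calc _ ≤ C * (5 * (l * u)) ^ 2 := by gcongr
        _ = _ := by ring)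
  obtain ⟨hIntg, hbd⟩ := key
  have hp := perron2 χ (a := 1 + 1 / l ^ 2) (x := x) (by linarith) hx1 hIntg
  have hp2 : ∫ y : ℝ, GG χ x ((1 + 1 / l ^ 2 : ℝ) + y * I) = _ := hp
  rw [hp2, norm_mul] at hbd
  have hpi : 1 ≤ ‖(2 * Real.pi : ℂ)‖ := by
    have : (2 * Real.pi : ℂ) = ((2 * Real.pi : ℝ) : ℂ) := by push_cast; rfl
    rw [this, Complex.norm_of_nonneg (by positivity)]
    linarith [Real.pi_gt_three]
  refine (le_mul_of_one_le_left (norm_nonneg _) hpi).trans (hbd.trans ?_)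
  have e1 : x ^ (1 - c / (2 * l)) = x * Real.exp (-(c / 2) * l) := by
    rw [Real.rpow_def_of_pos hx0, ← hll]
    conv_rhs => rw [← Real.exp_log hx0, ← hll, ← Real.exp_add]
    congr 1; field_simp; ring
  have e2 : x ^ (1 + 1 / l ^ 2) = x * Real.exp 1 := by
    rw [Real.rpow_def_of_pos hx0, ← hll]
    conv_rhs => rw [← Real.exp_log hx0, ← hll, ← Real.exp_add]
    congr 1; field_simp
  have e3 : Real.exp l ^ (-(1 / 4) : ℝ) ≤ Real.exp (-(c / 2) * l) := by
    rw [← Real.exp_mul]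
    apply Real.exp_le_exp.2
    nlinarith
  have e4 : l ^ 2 * Real.exp (-(c / 2) * l) ≤ 2 * (4 / c) ^ 2 * Real.exp (-(c / 4) * l) := by
    have h1 : (c / 4 * l) ^ 2 / 2 ≤ Real.exp (c / 4 * l) := by
      have := Real.quadratic_le_exp_of_nonneg (show 0 ≤ c / 4 * l by positivity)
      have : 0 < c / 4 * l := by positivity
      linarith
    have h2 : l ^ 2 = 2 * (4 / c) ^ 2 * ((c / 4 * l) ^ 2 / 2) := by field_simp
    have h3 : Real.exp (-(c / 4) * l) = Real.exp (c / 4 * l) * Real.exp (-(c / 2) * l) := by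
      rw [← Real.exp_add]; congr 1; ring
    rw [h3, h2]
    calc _ ≤ 2 * (4 / c) ^ 2 * Real.exp (c / 4 * l) * Real.exp (-(c / 2) * l) := by gcongr
      _ = _ := by ring
  rw [e1, e2]
  calc (16 + 4 * ∫ y, hh y) * (25 * C * l ^ 2) * (x * Real.exp (-(c / 2) * l) + x * Real.exp 1 * Real.exp l ^ (-(1 / 4) : ℝ))
      ≤ (16 + 4 * ∫ y, hh y) * (25 * C * l ^ 2) * (x * Real.exp (-(c / 2) * l) + x * Real.exp 1 * Real.exp (-(c / 2) * l)) := by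
        gcongr
    _ = (16 + 4 * ∫ y, hh y) * (25 * C) * (1 + Real.exp 1) * x * (l ^ 2 * Real.exp (-(c / 2) * l)) := by ring
    _ ≤ (16 + 4 * ∫ y, hh y) * (25 * C) * (1 + Real.exp 1) * x * (2 * (4 / c) ^ 2 * Real.exp (-(c / 4) * l)) := by
        gcongr
    _ = _ := by ring

end SW

namespace SW
open Complex Metric

theorem l2exp {c l : ℝ} (hc : 0 < c) (hl : 0 ≤ l) :
    l ^ 2 * Real.exp (-(c / 2) * l) ≤ 2 * (4 / c) ^ 2 * Real.exp (-(c / 4) * l) := by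
  have h1 : (c / 4 * l) ^ 2 / 2 ≤ Real.exp (c / 4 * l) := by
    have h := Real.quadratic_le_exp_of_nonneg (show 0 ≤ c / 4 * l by positivity)
    have : 0 ≤ c / 4 * l := by positivity
    linarith
  have h2 : l ^ 2 = 2 * (4 / c) ^ 2 * ((c / 4 * l) ^ 2 / 2) := by field_simp
  have h3 : Real.exp (-(c / 4) * l) = Real.exp (c / 4 * l) * Real.exp (-(c / 2) * l) := by
    rw [← Real.exp_add]; congr 1; ring
  rw [h3, h2]
  calc _ ≤ 2 * (4 / c) ^ 2 * Real.exp (c / 4 * l) * Real.exp (-(c / 2) * l) := by gcongr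
    _ = _ := by ring

/-- differencing identity -/
theorem diff_bound (u : ℕ → ℂ) {x h M : ℝ} (hx : 0 < x) (hh : 0 < h) (hM : 0 ≤ M)
    (hu : ∀ n : ℕ, (n : ℝ) ≤ x + h → ‖u n‖ ≤ M) :
    ‖(x + h) * (∑ n ∈ range (⌊x + h⌋₊ + 1), u n * ((1 - n / (x + h) : ℝ) : ℂ)) -
      x * (∑ n ∈ range (⌊x⌋₊ + 1), u n * ((1 - n / x : ℝ) : ℂ)) -
      h * ∑ n ∈ range (⌊x⌋₊ + 1), u n‖ ≤ h * (h + 1) * M := by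
  have hle : ⌊x⌋₊ + 1 ≤ ⌊x + h⌋₊ + 1 := by
    have := Nat.floor_le_floor (show x ≤ x + h by linarith); omega
  have hxh : 0 < x + h := by linarith
  have hxc : (x : ℂ) ≠ 0 := by exact_mod_cast hx.ne'
  have hxhc : (x : ℂ) + h ≠ 0 := by exact_mod_cast hxh.ne'
  rw [← Finset.sum_range_add_sum_Ico _ hle, mul_add, mul_sum, mul_sum, mul_sum]
  have e : ∀ n ∈ range (⌊x⌋₊ + 1), ((x : ℂ) + h) * (u n * ((1 - n / (x + h) : ℝ) : ℂ)) =
      x * (u n * ((1 - n / x : ℝ) : ℂ)) + h * u n := by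
    intro n _
    push_cast
    field_simp
    ring
  rw [sum_congr rfl e, sum_add_distrib, mul_sum]
  have e2 : ∀ a b c : ℂ, a + b + c - a - b = c := by intros; ring
  rw [e2]
  refine (norm_sum_le _ _).trans ?_
  have hcard : ((Ico (⌊x⌋₊ + 1) (⌊x + h⌋₊ + 1)).card : ℝ) ≤ h + 1 := by
    rw [Nat.card_Ico, Nat.cast_sub hle]
    push_cast
    have := Nat.floor_le hxh.le
    have := Nat.lt_floor_add_one x
    linarith
  have hb : ∀ n ∈ Ico (⌊x⌋₊ + 1) (⌊x + h⌋₊ + 1), ‖((x : ℂ) + h) * (u n * ((1 - n / (x + h) : ℝ) : ℂ))‖ ≤ h * M := by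
    intro n hn
    rw [mem_Ico] at hn
    have h1 : (n : ℝ) ≤ x + h := (Nat.le_floor_iff hxh.le).1 (by omega)
    have h2 : x < n := Nat.lt_of_floor_lt (by omega)
    have e3 : ((x : ℂ) + h) * (u n * ((1 - n / (x + h) : ℝ) : ℂ)) = u n * ((x + h - n : ℝ) : ℂ) := by
      push_cast; field_simp
    rw [e3, norm_mul, Complex.norm_of_nonneg (by linarith), mul_comm]
    have := hu n h1
    have : 0 ≤ ‖u n‖ := norm_nonneg _
    apply mul_le_mul <;> linarith
  refine (sum_le_card_nsmul _ _ _ hb).trans ?_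
  rw [nsmul_eq_mul]
  calc _ ≤ (h + 1) * (h * M) := by gcongr
    _ = _ := by ring

set_option maxHeartbeats 1000000 in
open Classical in
theorem siegel_walfisz (B : ℝ) (hB : 1 ≤ B) : ∃ c, 0 < c ∧ c ≤ 1 ∧ ∃ K, 0 < K ∧ ∀ (q : ℕ) [NeZero q]
    (χ : DirichletCharacter ℂ q) (x : ℝ), Real.exp 16 ≤ x → (q : ℝ) ≤ Real.log x ^ B →
    ‖∑ n ∈ range (⌊x⌋₊ + 1), χ n * (ArithmeticFunction.vonMangoldt n : ℂ) -
        (if χ = 1 then (x : ℂ) else 0)‖ ≤ K * x * Real.exp (-c * Real.sqrt (Real.log x)) := by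
  obtain ⟨c, hc, hc1, K, hK, H⟩ := smoothed B hB
  refine ⟨c / 4, by positivity, by linarith, 5 * K + 6 * (2 * (4 / c) ^ 2), by positivity, ?_⟩
  intro q _ χ x hx hq
  have hx0 : 0 < x := (Real.exp_pos _).trans_le hx
  have hlog : 16 ≤ Real.log x := (Real.le_log_iff_exp_le hx0).2 hx
  have H1 := H q χ x hx hq
  obtain ⟨l, hl, hl4, hll⟩ : ∃ l, l = Real.sqrt (Real.log x) ∧ 4 ≤ l ∧ l ^ 2 = Real.log x :=
    ⟨_, rfl, Real.le_sqrt_of_sq_le (by linarith), Real.sq_sqrt (by linarith)⟩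
  have hxe : x = Real.exp (l ^ 2) := by rw [hll, Real.exp_log hx0]
  obtain ⟨h, hh⟩ : ∃ h, h = x * Real.exp (-(c / 2) * l) := ⟨_, rfl⟩
  have hh1 : 1 ≤ h := by
    rw [hh, hxe, ← Real.exp_add]
    apply Real.one_le_exp
    nlinarith
  have hhx : h ≤ x := by
    rw [hh]
    apply mul_le_of_le_one_right hx0.le
    apply Real.exp_le_one_iff.2
    nlinarith
  have hlm : Real.log x ≤ Real.log (x + h) := Real.log_le_log hx0 (by linarith)
  have hlm2 : Real.log (x + h) ≤ 2 * l ^ 2 := by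
    calc Real.log (x + h) ≤ Real.log (x * x) := by
          apply Real.log_le_log (by linarith)
          have : 2 ≤ x := by have := Real.add_one_le_exp (16:ℝ); linarith
          nlinarith
      _ = _ := by rw [Real.log_mul hx0.ne' hx0.ne', hll]; ring
  have H2 := H q χ (x + h) (by linarith)
    (hq.trans (Real.rpow_le_rpow (by linarith) hlm (by linarith)))
  have hsq : l ≤ Real.sqrt (Real.log (x + h)) := hl ▸ Real.sqrt_le_sqrt hlm
  have H2' := H2.trans (show _ ≤ K * (2 * x) * Real.exp (-c * l) by
    have : Real.exp (-c * √(Real.log (x + h))) ≤ Real.exp (-c * l) := by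
      apply Real.exp_le_exp.2; nlinarith
    gcongr
    linarith)
  rw [← hl] at H1 ⊢
  have hD := diff_bound (fun n => χ n * (ArithmeticFunction.vonMangoldt n : ℂ)) (x := x) (h := h)
    (M := 2 * l ^ 2) hx0 (by linarith) (by positivity) (by
      intro n hn
      rw [norm_mul, Complex.norm_of_nonneg ArithmeticFunction.vonMangoldt_nonneg]
      have h1 := χ.norm_le_one (n : ZMod q)
      have h2 : ArithmeticFunction.vonMangoldt n ≤ 2 * l ^ 2 := by
        refine (ArithmeticFunction.vonMangoldt_le_log (n := n)).trans ?_
        rcases Nat.eq_zero_or_pos n with h0 | h0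
        · subst h0; simp; positivity
        · exact (Real.log_le_log (by exact_mod_cast h0) hn).trans hlm2
      exact (mul_le_of_le_one_left ArithmeticFunction.vonMangoldt_nonneg h1).trans h2)
  generalize hs : ∑ n ∈ range (⌊x⌋₊ + 1), χ n * (ArithmeticFunction.vonMangoldt n : ℂ) = s at *
  generalize hs1 : ∑ n ∈ range (⌊x⌋₊ + 1), χ n * (ArithmeticFunction.vonMangoldt n : ℂ) * ((1 - n / x : ℝ) : ℂ) = s1 at *
  generalize hs2 : ∑ n ∈ range (⌊x + h⌋₊ + 1), χ n * (ArithmeticFunction.vonMangoldt n : ℂ) * ((1 - n / (x + h) : ℝ) : ℂ) = s2 at *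
  have h0 : 0 < h := by linarith
  have hxc : (x : ℂ) ≠ 0 := by exact_mod_cast hx0.ne'
  have hxhc : (x : ℂ) + h ≠ 0 := by exact_mod_cast (show x + h ≠ 0 by positivity)
  have hid : ∃ d : ℂ, ‖d‖ ≤ h * h ∧ (h : ℂ) * (s - (if χ = 1 then (x : ℂ) else 0)) =
      (x + h) * (s2 - (if χ = 1 then (wt (x + h) : ℂ) else 0)) -
      x * (s1 - (if χ = 1 then (wt x : ℂ) else 0)) -
      ((x + h) * s2 - x * s1 - h * s) + d := by
    by_cases h1 : χ = 1
    · refine ⟨((h ^ 2 / 2 - h : ℝ) : ℂ), ?_, ?_⟩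
      · rw [Complex.norm_real, Real.norm_eq_abs, abs_le]
        constructor <;> nlinarith
      · simp only [h1, if_true, wt]
        push_cast
        field_simp
        ring
    · refine ⟨0, by simp; positivity, ?_⟩
      simp only [h1, if_false]
      ring
  obtain ⟨d, hd, hid⟩ := hid
  have hfin : h * ‖s - (if χ = 1 then (x : ℂ) else 0)‖ ≤
      2 * x * (K * (2 * x) * Real.exp (-c * l)) + x * (K * x * Real.exp (-c * l)) +
      h * (h + 1) * (2 * l ^ 2) + h * h := by
    have : h * ‖s - (if χ = 1 then (x : ℂ) else 0)‖ = ‖(h : ℂ) * (s - (if χ = 1 then (x : ℂ) else 0))‖ := by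
      rw [norm_mul, Complex.norm_of_nonneg h0.le]
    rw [this, hid]
    refine (norm_add_le _ _).trans (add_le_add ((norm_sub_le _ _).trans (add_le_add
      ((norm_sub_le _ _).trans (add_le_add ?_ ?_)) hD)) hd)
    · rw [norm_mul]
      apply mul_le_mul _ H2' (norm_nonneg _) (by positivity)
      rw [← ofReal_add, Complex.norm_of_nonneg (by positivity)]
      linarith
    · rw [norm_mul, Complex.norm_of_nonneg hx0.le]
      gcongr
  have hex : x * Real.exp (-c * l) = h * Real.exp (-(c / 2) * l) := by
    rw [hh, mul_assoc, ← Real.exp_add]; congr 2; ring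
  have hfin2 : h * ‖s - (if χ = 1 then (x : ℂ) else 0)‖ ≤
      h * (5 * K * x * Real.exp (-(c / 2) * l) + 6 * l ^ 2 * h) := by
    refine hfin.trans ?_
    have e1 : 2 * x * (K * (2 * x) * Real.exp (-c * l)) + x * (K * x * Real.exp (-c * l)) =
      5 * K * x * (x * Real.exp (-c * l)) := by ring
    rw [e1, hex]
    have : 1 ≤ l ^ 2 := by nlinarith
    have e2 : (h + 1) * (2 * l ^ 2) + h ≤ 6 * l ^ 2 * h := by
      nlinarith [mul_le_mul_of_nonneg_left this h0.le, mul_le_mul_of_nonneg_left hh1 (sq_nonneg l)]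
    nlinarith [mul_le_mul_of_nonneg_left e2 h0.le]
  refine (le_of_mul_le_mul_left hfin2 h0).trans ?_
  have hl2 := l2exp hc (show 0 ≤ l by linarith)
  have h5 : Real.exp (-(c / 2) * l) ≤ Real.exp (-(c / 4) * l) := by
    apply Real.exp_le_exp.2; nlinarith
  calc 5 * K * x * Real.exp (-(c / 2) * l) + 6 * l ^ 2 * h =
      5 * K * x * Real.exp (-(c / 2) * l) + 6 * x * (l ^ 2 * Real.exp (-(c / 2) * l)) := by rw [hh]; ring
    _ ≤ 5 * K * x * Real.exp (-(c / 4) * l) + 6 * x * (2 * (4 / c) ^ 2 * Real.exp (-(c / 4) * l)) :=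
        add_le_add (mul_le_mul_of_nonneg_left h5 (by positivity)) (mul_le_mul_of_nonneg_left hl2 (by positivity))
    _ = _ := by ring

end SW

namespace SW
open Complex Metric

open Classical in
theorem char_expand {q : ℕ} [NeZero q] (g : ZMod q → ℂ) (b : ZMod q) :
    ∑ χ : DirichletCharacter ℂ q, (∑ a : ZMod q, if IsUnit a then g a * χ a⁻¹ else 0) * χ b =
      (q.totient : ℂ) * (if IsUnit b then g b else 0) := by
  have e1 : ∀ χ : DirichletCharacter ℂ q, (∑ a : ZMod q, if IsUnit a then g a * χ a⁻¹ else 0) * χ b =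
      ∑ a : ZMod q, if IsUnit a then g a * (χ a⁻¹ * χ b) else 0 := by
    intro χ
    rw [sum_mul]
    refine sum_congr rfl fun a _ => ?_
    split_ifs <;> ring
  rw [sum_congr rfl fun χ _ => e1 χ, sum_comm]
  have e2 : ∀ a : ZMod q, (∑ χ : DirichletCharacter ℂ q, if IsUnit a then g a * (χ a⁻¹ * χ b) else 0) =
      if a = b then (q.totient : ℂ) * (if IsUnit b then g b else 0) else 0 := by
    intro a
    by_cases ha : IsUnit a
    · simp only [ha, if_true]
      rw [← mul_sum, DirichletCharacter.sum_char_inv_mul_char_eq ℂ ha]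
      by_cases hab : a = b
      · subst hab; simp [ha, mul_comm]
      · simp [hab]
    · simp only [ha, if_false, sum_const_zero]
      by_cases hab : a = b
      · subst hab; simp [ha]
      · simp [hab]
  rw [sum_congr rfl fun a _ => e2 a]
  simp

open Classical in
theorem char_sum_bound {q : ℕ} [NeZero q] (g : ZMod q → ℂ) (hg : ∀ a, ‖g a‖ ≤ 1) (u : ℕ → ℂ) (N : ℕ)
    (x E : ℝ)
    (hE : ∀ χ : DirichletCharacter ℂ q, ‖∑ n ∈ range N, χ n * u n - (if χ = 1 then (x : ℂ) else 0)‖ ≤ E) :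
    ‖∑ n ∈ range N, (if IsUnit (n : ZMod q) then g n else 0) * u n -
      (∑ a : ZMod q, if IsUnit a then g a else 0) / (q.totient : ℂ) * x‖ ≤ q * E := by
  have hq : 0 < q := Nat.pos_of_ne_zero (NeZero.ne q)
  have hφ : 0 < q.totient := Nat.totient_pos.2 hq
  have hφc : (q.totient : ℂ) ≠ 0 := by exact_mod_cast hφ.ne'
  set Wc : DirichletCharacter ℂ q → ℂ := fun χ => ∑ a : ZMod q, if IsUnit a then g a * χ a⁻¹ else 0 with hW
  have hWn : ∀ χ, ‖Wc χ‖ ≤ q := by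
    intro χ
    refine (norm_sum_le _ _).trans ?_
    calc _ ≤ ∑ a : ZMod q, (1 : ℝ) := by
          refine sum_le_sum fun a _ => ?_
          split_ifs
          · rw [norm_mul]
            exact mul_le_one₀ (hg a) (norm_nonneg _) (χ.norm_le_one _)
          · simp
      _ = q := by simp [ZMod.card]
  have hW1 : Wc 1 = ∑ a : ZMod q, if IsUnit a then g a else 0 := by
    refine sum_congr rfl fun a _ => ?_
    split_ifs with h
    · have : IsUnit a⁻¹ := by
        obtain ⟨v, rfl⟩ := h
        rw [ZMod.inv_coe_unit]; exact Units.isUnit _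
      rw [MulChar.one_apply this, mul_one]
    · rfl
  have key : (q.totient : ℂ) * (∑ n ∈ range N, (if IsUnit (n : ZMod q) then g n else 0) * u n -
      (∑ a : ZMod q, if IsUnit a then g a else 0) / (q.totient : ℂ) * x) =
      ∑ χ : DirichletCharacter ℂ q, Wc χ * (∑ n ∈ range N, χ n * u n - (if χ = 1 then (x : ℂ) else 0)) := by
    simp only [mul_sub, sum_sub_distrib]
    congr 1
    · simp only [mul_sum]
      rw [sum_comm]
      refine sum_congr rfl fun n _ => ?_
      rw [← mul_assoc, ← char_expand g n, sum_mul]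
      refine sum_congr rfl fun χ _ => ?_
      ring
    · simp only [mul_ite, mul_zero, sum_ite_eq', mem_univ, if_true]
      rw [hW1]
      field_simp
  have hcard : (Fintype.card (DirichletCharacter ℂ q) : ℝ) = q.totient := by
    rw [← Nat.card_eq_fintype_card]
    exact_mod_cast DirichletCharacter.card_eq_totient_of_hasEnoughRootsOfUnity ℂ q
  have hφr : (0 : ℝ) < q.totient := by exact_mod_cast hφ
  refine le_of_mul_le_mul_left ?_ hφr
  have : ∀ z : ℂ, (q.totient : ℝ) * ‖z‖ = ‖(q.totient : ℂ) * z‖ := by intro z; simp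
  rw [this, key]
  refine (norm_sum_le _ _).trans ?_
  calc _ ≤ ∑ χ : DirichletCharacter ℂ q, (q * E : ℝ) := by
        refine sum_le_sum fun χ _ => ?_
        rw [norm_mul]
        exact mul_le_mul (hWn χ) (hE χ) (norm_nonneg _) (by positivity)
    _ = _ := by rw [sum_const, card_univ, nsmul_eq_mul, hcard]

theorem e_norm (t : ℝ) : ‖e t‖ = 1 := by
  unfold e
  have : (2 * Real.pi * I * t : ℂ) = ((2 * Real.pi * t : ℝ) : ℂ) * I := by push_cast; ring
  rw [this, Complex.norm_exp_ofReal_mul_I]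

theorem e_add_nat (t : ℝ) (m : ℕ) : e (t + m) = e t := by
  unfold e
  have : (2 * Real.pi * I * ((t + m : ℝ) : ℂ) : ℂ) = 2 * Real.pi * I * t + m * (2 * Real.pi * I) := by
    push_cast; ring
  rw [this, Complex.exp_add, Complex.exp_nat_mul_two_pi_mul_I, mul_one]

/-- periodic function -/
noncomputable def gz (a q : ℕ) (j : ZMod q) : ℂ := e ((a : ℝ) / q * (j.val : ℝ) ^ 5)

theorem gz_cast (a q n : ℕ) [NeZero q] : gz a q (n : ZMod q) = e ((a : ℝ) / q * (n : ℝ) ^ 5) := by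
  unfold gz
  rw [ZMod.val_natCast]
  have hq : (q : ℝ) ≠ 0 := by exact_mod_cast NeZero.ne q
  obtain ⟨m, hm⟩ : ∃ m, n ^ 5 = (n % q) ^ 5 + q * m := by
    have h : (n % q) ^ 5 ≡ n ^ 5 [MOD q] := (Nat.mod_modEq n q).pow 5
    have hle : (n % q) ^ 5 ≤ n ^ 5 := Nat.pow_le_pow_left (Nat.mod_le n q) 5
    obtain ⟨m, hm⟩ := (Nat.modEq_iff_dvd' hle).1 h
    exact ⟨m, by omega⟩
  have h2 : (a : ℝ) / q * (n : ℝ) ^ 5 = a / q * ((n % q : ℕ) : ℝ) ^ 5 + ((a * m : ℕ) : ℝ) := by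
    have : (n : ℝ) ^ 5 = ((n % q : ℕ) : ℝ) ^ 5 + q * m := by exact_mod_cast hm
    rw [this]; push_cast; field_simp
  rw [h2, e_add_nat]

open Classical in
theorem S_eq (a q : ℕ) [NeZero q] : S 5 q a = ∑ j : ZMod q, if IsUnit j then gz a q j else 0 := by
  unfold S
  rw [sum_filter]
  have e1 : ∀ n ∈ Icc 1 q, (if Nat.gcd n q = 1 then e ((a : ℝ) * (n : ℝ) ^ 5 / q) else 0) =
      (fun j : ZMod q => if IsUnit j then gz a q j else 0) (n : ZMod q) := by
    intro n _
    simp only [ZMod.isUnit_iff_coprime, gz_cast, Nat.Coprime]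
    congr 2; ring
  have main : ∀ h : ZMod q → ℂ, ∑ n ∈ Icc 1 q, h (n : ZMod q) = ∑ j, h j := by
    intro h
    have h1 := sum_range_succ (fun n : ℕ => h n) q
    rw [sum_range_succ'] at h1
    simp only [Nat.cast_zero, CharP.cast_eq_zero, add_left_inj] at h1
    rw [← sum_range_zmod, ← h1, Finset.range_eq_Ico, Finset.sum_Ico_add' (fun n : ℕ => h n) 0 q 1]
    refine sum_congr ?_ fun _ _ => rfl
    ext n; simp only [mem_Ico, mem_Icc]; omega
  exact (sum_congr rfl e1).trans (main (fun j : ZMod q => if IsUnit j then gz a q j else 0))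

open Classical in
theorem prime_sum_bound {q : ℕ} [NeZero q] (g : ZMod q → ℂ) (hg : ∀ a, ‖g a‖ ≤ 1) {x : ℝ} (hx : 1 ≤ x) :
    ‖∑ n ∈ range (⌊x⌋₊ + 1) with n.Prime, g n * (Real.log n : ℂ) -
      ∑ n ∈ range (⌊x⌋₊ + 1), (if IsUnit (n : ZMod q) then g n else 0) *
        (ArithmeticFunction.vonMangoldt n : ℂ)‖ ≤ (q : ℝ) ^ 2 + 2 * Real.sqrt x * Real.log x + q ^ 2 := by
  have hpt : ∀ n ∈ range (⌊x⌋₊ + 1), ‖(if n.Prime then g n * (Real.log n : ℂ) else 0) -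
      (if IsUnit (n : ZMod q) then g n else 0) * (ArithmeticFunction.vonMangoldt n : ℂ)‖ ≤
      (if n ≤ q then (q : ℝ) else 0) + (if ¬ n.Prime then ArithmeticFunction.vonMangoldt n else 0) := by
    intro n _
    have hL := ArithmeticFunction.vonMangoldt_nonneg (n := n)
    by_cases hp : n.Prime
    · simp only [hp, if_true, not_true, if_false, add_zero]
      rw [ArithmeticFunction.vonMangoldt_apply_prime hp]
      by_cases hu : IsUnit (n : ZMod q)
      · simp only [hu, if_true, sub_self, norm_zero]
        split_ifs <;> positivity
      · simp only [hu, if_false, zero_mul, sub_zero]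
        have hd : n ∣ q := by
          rw [ZMod.isUnit_iff_coprime] at hu
          by_contra h
          exact hu ((Nat.Prime.coprime_iff_not_dvd hp).2 h)
        have hle : n ≤ q := Nat.le_of_dvd (Nat.pos_of_ne_zero (NeZero.ne q)) hd
        rw [if_pos hle, norm_mul, Complex.norm_of_nonneg (Real.log_nonneg (by exact_mod_cast hp.one_le))]
        have h1 : Real.log n ≤ q := by
          have h2 := Real.log_le_sub_one_of_pos (show (0 : ℝ) < n by exact_mod_cast hp.pos)
          have h3 : (n : ℝ) ≤ q := by exact_mod_cast hle
          linarith
        exact (mul_le_of_le_one_left (Real.log_nonneg (by exact_mod_cast hp.one_le)) (hg _)).trans h1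
    · simp only [hp, if_false, not_false_iff, if_true, zero_sub, norm_neg]
      rw [norm_mul, Complex.norm_of_nonneg hL]
      have h1 : ‖(if IsUnit (n : ZMod q) then g n else 0)‖ ≤ 1 := by
        split_ifs
        · exact hg _
        · simp
      have h2 := mul_le_of_le_one_left hL h1
      have h3 : (0 : ℝ) ≤ if n ≤ q then (q : ℝ) else 0 := by split_ifs <;> positivity
      linarith
  rw [sum_filter, ← sum_sub_distrib]
  refine (norm_sum_le _ _).trans ((sum_le_sum hpt).trans ?_)
  rw [sum_add_distrib]
  have h1 : ∑ n ∈ range (⌊x⌋₊ + 1), (if n ≤ q then (q : ℝ) else 0) ≤ (q : ℝ) ^ 2 + q ^ 2 := by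
    rw [← sum_filter, sum_const, nsmul_eq_mul]
    have : (#(range (⌊x⌋₊ + 1) |>.filter (fun n => n ≤ q)) : ℝ) ≤ q + 1 := by
      have : #(range (⌊x⌋₊ + 1) |>.filter (fun n => n ≤ q)) ≤ #(range (q + 1)) := by
        apply card_le_card
        intro n hn
        simp only [mem_filter, mem_range] at hn ⊢
        omega
      rw [card_range] at this
      exact_mod_cast this
    have hq1 : (1 : ℝ) ≤ q := by exact_mod_cast Nat.pos_of_ne_zero (NeZero.ne q)
    nlinarith
  have h2 : ∑ n ∈ range (⌊x⌋₊ + 1), (if ¬ n.Prime then ArithmeticFunction.vonMangoldt n else 0) ≤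
      2 * Real.sqrt x * Real.log x := by
    refine le_trans (le_of_eq ?_) (Chebyshev.psi_sub_theta_le hx)
    rw [Chebyshev.psi_sub_theta_eq_sum_not_prime, sum_filter, Finset.sum_range_succ']
    simp only [ArithmeticFunction.map_zero, ite_self, add_zero]
    rw [Finset.range_eq_Ico, Finset.sum_Ico_add' (fun n : ℕ => if ¬ n.Prime then ArithmeticFunction.vonMangoldt n else 0) 0 _ 1]
    refine sum_congr ?_ fun _ _ => rfl
    ext n; simp only [mem_Ico, mem_Ioc]; omega
  linarith

end SW

namespace SW
open Complex Metric

set_option maxHeartbeats 1600000 in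
theorem main_kappa (B : ℝ) (hB : 1 ≤ B) (κ : ℝ) (hκ : 0 < κ) (hκ1 : κ ≤ 1) :
    ∃ c2 : ℝ, 0 < c2 ∧ ∃ C : ℝ, 0 < C ∧ ∃ N : ℕ, ∀ n : ℕ, N ≤ n →
      ∀ a q : ℕ, 1 ≤ q → (q : ℝ) ≤ Real.log n ^ B →
      1 ≤ (n : ℝ) ^ κ ∧ 1 ≤ n ∧
        ‖∑ p ∈ range (⌊(n : ℝ) ^ κ⌋₊ + 1) with p.Prime, e ((a : ℝ) / q * (p : ℝ) ^ 5) * (Real.log p : ℂ) -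
          S 5 q a / (Nat.totient q : ℂ) * (((n : ℝ) ^ κ : ℝ) : ℂ)‖ ≤
          C * (n : ℝ) ^ κ * Real.exp (-c2 * Real.sqrt (Real.log n)) := by
  classical
  obtain ⟨c, hc, hc1, K, hK, H⟩ := siegel_walfisz (B + 1) (by linarith)
  obtain ⟨b, hb, hb0⟩ : ∃ b, b = c * Real.sqrt κ / 2 ∧ 0 < b := ⟨_, rfl, by positivity⟩
  have htend : Filter.Tendsto (fun n : ℕ => Real.sqrt (Real.log n)) Filter.atTop Filter.atTop :=
    Real.tendsto_sqrt_atTop.comp (Real.tendsto_log_atTop.comp tendsto_natCast_atTop_atTop)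
  have E1 : ∀ᶠ l : ℝ in Filter.atTop, l ^ (2 * B) ≤ Real.exp (b * l) := by
    have := (isLittleO_rpow_exp_pos_mul_atTop (2 * B) hb0).bound (show (0:ℝ) < 1 by norm_num)
    filter_upwards [this] with l hl
    rw [one_mul, Real.norm_of_nonneg (Real.exp_pos _).le] at hl
    exact (le_abs_self _).trans hl
  have hev := htend.eventually (E1.and ((Filter.eventually_ge_atTop (4 * b / κ)).and
    ((Filter.eventually_ge_atTop (16 / κ)).and ((Filter.eventually_ge_atTop (κ ^ (-(B + 1)))).and
      (Filter.eventually_ge_atTop (1 : ℝ))))))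
  obtain ⟨N, hN⟩ := Filter.eventually_atTop.1 hev
  refine ⟨b, hb0, 4 + K, by positivity, max N 1, ?_⟩
  intro n hn a q hq1 hq
  have : NeZero q := ⟨by omega⟩
  obtain ⟨h1, h2, h3, h4, h5⟩ := hN n ((le_max_left _ _).trans hn)
  have hn1 : 1 ≤ n := (le_max_right _ _).trans hn
  have hn0 : (0 : ℝ) < n := by exact_mod_cast hn1
  have hlog0 : 0 ≤ Real.log n := Real.log_nonneg (by exact_mod_cast hn1)
  have hll : Real.sqrt (Real.log n) ^ 2 = Real.log n := Real.sq_sqrt hlog0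
  generalize Real.sqrt (Real.log n) = l at *
  have hl0 : 0 < l := by linarith
  rw [div_le_iff₀ hκ] at h2 h3
  have hx : (n : ℝ) ^ κ = Real.exp (κ * l ^ 2) := by
    rw [Real.rpow_def_of_pos hn0, hll, mul_comm]
  rw [hx]
  obtain ⟨x, hxx⟩ : ∃ x, x = Real.exp (κ * l ^ 2) := ⟨_, rfl⟩
  rw [← hxx]
  have hlogx : Real.log x = κ * l ^ 2 := by rw [hxx, Real.log_exp]
  have hx1 : 1 ≤ x := by rw [hxx]; apply Real.one_le_exp; positivity
  have hx16 : Real.exp 16 ≤ x := by rw [hxx]; apply Real.exp_le_exp.2; nlinarith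
  have hqe : (q : ℝ) ≤ Real.exp (b * l) := by
    refine hq.trans (le_trans (le_of_eq ?_) h1)
    rw [← hll, ← Real.rpow_natCast, ← Real.rpow_mul hl0.le]; norm_num
  have hqx : (q : ℝ) ≤ Real.log x ^ (B + 1) := by
    refine hq.trans ?_
    rw [hlogx, Real.mul_rpow hκ.le (by positivity), ← hll, Real.rpow_add_one (x := l ^ 2) (by positivity) B]
    have h6 : κ ^ (B + 1) * κ ^ (-(B + 1)) = 1 := by
      rw [← Real.rpow_add hκ]; simp
    have h7 : 0 < κ ^ (B + 1) := by positivity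
    have h8 : 1 ≤ κ ^ (B + 1) * l ^ 2 := by
      refine h6.symm.le.trans (mul_le_mul_of_nonneg_left ?_ h7.le); nlinarith
    have h9 : 0 < (l ^ 2) ^ B := by positivity
    nlinarith [mul_le_mul_of_nonneg_left h8 h9.le]
  have hsl : Real.sqrt (Real.log x) = Real.sqrt κ * l := by
    rw [hlogx, Real.sqrt_mul hκ.le, Real.sqrt_sq hl0.le]
  refine ⟨hx1, hn1, ?_⟩
  have hg : ∀ j, ‖gz a q j‖ ≤ 1 := fun j => (e_norm _).le
  have A1 := prime_sum_bound (gz a q) hg hx1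
  have A2 := char_sum_bound (gz a q) hg (fun n => (ArithmeticFunction.vonMangoldt n : ℂ)) (⌊x⌋₊ + 1) x
    (K * x * Real.exp (-c * Real.sqrt (Real.log x))) (fun χ => by
      convert H q χ x hx16 hqx)
  rw [← S_eq, hsl] at A2
  have A3 : ∑ p ∈ range (⌊x⌋₊ + 1) with p.Prime, e ((a : ℝ) / q * (p : ℝ) ^ 5) * (Real.log p : ℂ) =
      ∑ p ∈ range (⌊x⌋₊ + 1) with p.Prime, gz a q p * (Real.log p : ℂ) :=
    sum_congr rfl fun p _ => by rw [gz_cast]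
  rw [A3]
  refine (norm_sub_le_norm_sub_add_norm_sub _ _ _).trans ((add_le_add A1 A2).trans ?_)
  have hq0 : (0 : ℝ) ≤ q := by positivity
  have B1 : (q : ℝ) ^ 2 ≤ x * Real.exp (-b * l) := by
    calc (q : ℝ) ^ 2 ≤ Real.exp (b * l) ^ 2 := by gcongr
      _ = Real.exp (2 * b * l) := by rw [← Real.exp_nat_mul]; congr 1; push_cast; ring
      _ ≤ Real.exp (κ * l ^ 2 + -b * l) := by
          apply Real.exp_le_exp.2
          nlinarith
      _ = _ := by rw [Real.exp_add, ← hxx]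
  have B2 : Real.sqrt x * Real.log x ≤ x * Real.exp (-b * l) := by
    have s1 : Real.sqrt x = Real.exp (κ * l ^ 2 / 2) := by rw [hxx, Real.exp_half]
    have s2 : Real.log x ≤ Real.exp (b * l) := by
      rw [hlogx]
      refine le_trans ?_ h1
      have : l ^ 2 ≤ l ^ (2 * B) := by
        rw [← Real.rpow_natCast]
        exact Real.rpow_le_rpow_of_exponent_le h5 (by push_cast; linarith)
      nlinarith [sq_nonneg l]
    rw [s1]
    calc _ ≤ Real.exp (κ * l ^ 2 / 2) * Real.exp (b * l) := by gcongr
      _ = Real.exp (κ * l ^ 2 / 2 + b * l) := by rw [Real.exp_add]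
      _ ≤ Real.exp (κ * l ^ 2 + -b * l) := by
          apply Real.exp_le_exp.2
          nlinarith
      _ = _ := by rw [Real.exp_add, ← hxx]
  have B3 : (q : ℝ) * (K * x * Real.exp (-c * (Real.sqrt κ * l))) ≤ K * (x * Real.exp (-b * l)) := by
    have : Real.exp (-b * l) = Real.exp (b * l) * Real.exp (-c * (Real.sqrt κ * l)) := by
      rw [← Real.exp_add, hb]; congr 1; ring
    rw [this]
    calc _ ≤ Real.exp (b * l) * (K * x * Real.exp (-c * (Real.sqrt κ * l))) := by gcongr
      _ = _ := by ring
  nlinarith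

end SW

/-- Major-arc approximation of `f_{5,c}(a/q)` (Lemma "hua6", second part). -/
theorem f5_rational_approx (B : ℝ) (hB : 1 ≤ B) (c : ℕ) (hc : c = 6 ∨ c = 7) :
    ∃ c2 : ℝ, 0 < c2 ∧ ∃ C : ℝ, 0 < C ∧ ∃ N : ℕ, ∀ n : ℕ, N ≤ n →
      ∀ a q : ℕ, a ≤ q → 1 ≤ q → (q : ℝ) ≤ Real.log n ^ B → Nat.gcd a q = 1 →
        ‖f5 n c ((a : ℝ) / q) - S 5 q a / (Nat.totient q : ℂ) * (P n 5 ^ θ c : ℝ)‖ ≤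
          C * P n 5 ^ θ c * Real.exp (-c2 * Real.sqrt (Real.log n)) := by
  have hθ : 0 < θ c ∧ θ c ≤ 1 := by
    unfold θ; split_ifs <;> norm_num
  obtain ⟨c2, hc2, C, hC, N, H⟩ := SW.main_kappa B hB ((5 : ℝ)⁻¹ * θ c) (by have := hθ.1; positivity)
    (by have := hθ.2; linarith)
  refine ⟨c2, hc2, C, hC, N, ?_⟩
  intro n hn a q _ hq1 hq _
  obtain ⟨hx1, hn1, hmain⟩ := H n hn a q hq1 hq
  have hP : P n 5 ^ θ c = (n : ℝ) ^ ((5 : ℝ)⁻¹ * θ c) := by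
    unfold P
    rw [← Real.rpow_mul (by positivity)]; norm_num
  have hxn : (n : ℝ) ^ ((5 : ℝ)⁻¹ * θ c) ≤ n := by
    have h := Real.rpow_le_rpow_of_exponent_le (show (1 : ℝ) ≤ n by exact_mod_cast hn1)
      (show (5 : ℝ)⁻¹ * θ c ≤ 1 by have := hθ.2; linarith)
    rwa [Real.rpow_one] at h
  rw [hP]
  have hf : f5 n c ((a : ℝ) / q) = ∑ p ∈ range (⌊(n : ℝ) ^ ((5 : ℝ)⁻¹ * θ c)⌋₊ + 1) with p.Prime,
      e ((a : ℝ) / q * (p : ℝ) ^ 5) * (Real.log p : ℂ) := by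
    unfold f5
    rw [hP]
    refine sum_congr ?_ fun _ _ => rfl
    ext p
    simp only [mem_filter, mem_range, Nat.lt_succ_iff]
    constructor
    · rintro ⟨_, hp, _, h⟩
      exact ⟨Nat.le_floor h, hp⟩
    · rintro ⟨h, hp⟩
      have h2 := (Nat.le_floor_iff (by linarith)).1 h
      exact ⟨by exact_mod_cast h2.trans hxn, hp, by exact_mod_cast hp.one_lt, h2⟩
  rw [hf]
  exact hmain
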